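/- Let q ∈ (2,∞), p ∈ [2,q], p' = p/(p-1). Let ∇a ∈ L^p(D) and ∇b ∈ L^{p',∞}(D), and let φ solve Δφ = ∇^⊥a·∇b in D with zero boundary data. Then ‖∇φ‖_{L^{2,p}(D)} ≤ C_q ‖∇a‖_{L^p(D)} ‖∇b‖_{L^{p',∞}(D)} for a constant C_q depending only on q. -/

import Mathlib

open MeasureTheory Metric Real
open scoped ENNReal NNReal RealInnerProductSpace

noncomputable section

abbrev E2 := EuclideanSpace ℝ (Fin 2)
abbrev E3 := EuclideanSpace ℝ (Fin 3)

/-- `i`-th partial derivative. -/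
def pd {F : Type*} [NormedAddCommGroup F] [NormedSpace ℝ F]
    (i : Fin 2) (f : E2 → F) (x : E2) : F :=
  fderiv ℝ f x (EuclideanSpace.single i 1)

/-- Laplacian on `ℝ²`. -/
def lap {F : Type*} [NormedAddCommGroup F] [NormedSpace ℝ F]
    (f : E2 → F) (x : E2) : F :=
  pd 0 (pd 0 f) x + pd 1 (pd 1 f) x

/-- cross product in `ℝ³`. -/
def cross3 (u v : E3) : E3 :=
  (WithLp.equiv 2 (Fin 3 → ℝ)).symm
    (crossProduct (WithLp.equiv 2 (Fin 3 → ℝ) u) (WithLp.equiv 2 (Fin 3 → ℝ) v))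

/-- weak `L^p` (Marcinkiewicz) quasinorm of `f` on the set `s`. -/
def wnorm (p : ℝ) (f : E2 → ℝ) (s : Set E2) : ℝ≥0∞ :=
  ⨆ t : ℝ≥0, (t : ℝ≥0∞) * (volume {x ∈ s | (t : ℝ) < |f x|}) ^ (1 / p)

/-- Lorentz `L^{p,q}` quasinorm (with `q = ∞` giving weak `L^p`). -/
def lorentzNorm (p : ℝ) (q : ℝ≥0∞) (f : E2 → ℝ) (s : Set E2) : ℝ≥0∞ :=
  if q = ⊤ then wnorm p f s
  else (∫⁻ t in Set.Ioi (0 : ℝ),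
    (ENNReal.ofReal t * (volume {x ∈ s | t < |f x|}) ^ (1 / p)) ^ q.toReal
      / ENNReal.ofReal t) ^ (1 / q.toReal)

open scoped ComplexConjugate

theorem two_rpow_add (x y : ℝ) : (2 : ℝ≥0∞) ^ (x + y) = 2 ^ x * 2 ^ y :=
  ENNReal.rpow_add _ _ two_ne_zero ENNReal.ofNat_ne_top

theorem two_rpow_ne_zero (x : ℝ) : (2 : ℝ≥0∞) ^ x ≠ 0 := by
  simp [ENNReal.rpow_eq_zero_iff]

theorem two_rpow_ne_top (x : ℝ) : (2 : ℝ≥0∞) ^ x ≠ ⊤ := by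
  simp [ENNReal.rpow_eq_top_iff]

theorem two_rpow_le_two_rpow {x y : ℝ} (h : x ≤ y) : (2 : ℝ≥0∞) ^ x ≤ 2 ^ y :=
  ENNReal.rpow_le_rpow_of_exponent_le one_le_two h

theorem ofReal_two_rpow (x : ℝ) : ENNReal.ofReal ((2 : ℝ) ^ x) = 2 ^ x := by
  rw [← ENNReal.ofReal_rpow_of_pos two_pos]; simp

theorem volume_closedBall_two_rpow (x : ℂ) (k : ℝ) :
    volume (closedBall x ((2 : ℝ) ^ k)) = 2 ^ (2 * k) * NNReal.pi := by
  rw [Complex.volume_closedBall, ofReal_two_rpow, ← ENNReal.rpow_natCast, ← ENNReal.rpow_mul]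
  congr 2
  push_cast; ring

theorem pi_le_four_ennreal : (NNReal.pi : ℝ≥0∞) ≤ 4 := by
  exact_mod_cast (show NNReal.pi ≤ 4 from Real.pi_le_four)

/-- Weak type `(1,1)` bound for the dyadic centred Hardy-Littlewood maximal function. -/
theorem mul_volume_maximal_lt_le (u : ℂ → ℝ≥0∞) (l : ℝ≥0∞) :
    l * volume {x | ∃ k : ℤ, l < 2 ^ (-2 * k : ℝ) * ∫⁻ y in closedBall x ((2 : ℝ) ^ (k : ℝ)), u y}
      ≤ 64 * ∫⁻ y, u y := by
  by_cases hu : ∫⁻ y, u y = ⊤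
  · rw [hu, ENNReal.mul_top (by norm_num)]; exact le_top
  rcases eq_or_ne l 0 with rfl | hl
  · simp
  set s : Set ℂ := {x | ∃ k : ℤ, l < 2 ^ (-2 * k : ℝ) *
    ∫⁻ y in closedBall x ((2 : ℝ) ^ (k : ℝ)), u y} with hs
  choose! κ hκ using fun x (hx : x ∈ s) => hx
  have hball : ∀ x ∈ s, l * 2 ^ (2 * κ x : ℝ) ≤ ∫⁻ y in closedBall x ((2 : ℝ) ^ (κ x : ℝ)), u y := by
    intro x hx
    calc l * 2 ^ (2 * κ x : ℝ) ≤ (2 ^ (-2 * κ x : ℝ) *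
          ∫⁻ y in closedBall x ((2 : ℝ) ^ (κ x : ℝ)), u y) * 2 ^ (2 * κ x : ℝ) := by
          gcongr; exact (hκ x hx).le
      _ = (2 ^ (-2 * κ x : ℝ) * 2 ^ (2 * κ x : ℝ)) *
          ∫⁻ y in closedBall x ((2 : ℝ) ^ (κ x : ℝ)), u y := by ring
      _ = _ := by rw [← two_rpow_add]; simp
  obtain ⟨R, hR⟩ : ∃ R : ℝ, ∀ x ∈ s, (2 : ℝ) ^ (κ x : ℝ) ≤ R := by
    have hfin : (∫⁻ y, u y) / l ≠ ⊤ := ENNReal.div_ne_top hu hl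
    refine ⟨((∫⁻ y, u y) / l).toReal + 1, fun x hx => ?_⟩
    by_cases h1 : (κ x : ℝ) ≤ 0
    · calc (2 : ℝ) ^ (κ x : ℝ) ≤ 1 := Real.rpow_le_one_of_one_le_of_nonpos one_le_two h1
        _ ≤ _ := by linarith [ENNReal.toReal_nonneg (a := (∫⁻ y, u y) / l)]
    · have h2 : (2 : ℝ≥0∞) ^ (κ x : ℝ) ≤ (∫⁻ y, u y) / l := by
        rw [ENNReal.le_div_iff_mul_le (Or.inl hl) (Or.inr hu), mul_comm]
        calc l * 2 ^ (κ x : ℝ) ≤ l * 2 ^ (2 * κ x : ℝ) := by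
              exact mul_le_mul' le_rfl (two_rpow_le_two_rpow (by linarith))
          _ ≤ _ := (hball x hx).trans (setLIntegral_le_lintegral _ _)
      rw [← ofReal_two_rpow, ENNReal.ofReal_le_iff_le_toReal hfin] at h2
      linarith
  obtain ⟨v, hvs, hdisj, hcov⟩ := Vitali.exists_disjoint_subfamily_covering_enlargement_closedBall
    s (fun x => x) (fun x => (2 : ℝ) ^ (κ x : ℝ)) R hR 4 (by norm_num)
  have hcount : v.Countable := hdisj.countable_of_nonempty_interior fun x _ =>
    ⟨x, ball_subset_interior_closedBall (mem_ball_self (by positivity))⟩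
  have hsub : s ⊆ ⋃ x ∈ v, closedBall x (4 * (2 : ℝ) ^ (κ x : ℝ)) := by
    intro x hx
    obtain ⟨b, hb, hxb⟩ := hcov x hx
    exact Set.mem_biUnion hb (hxb (mem_closedBall_self (by positivity)))
  have hvol : ∀ x : ℂ, volume (closedBall x (4 * (2 : ℝ) ^ (κ x : ℝ))) ≤ 64 * 2 ^ (2 * κ x : ℝ) := by
    intro x
    have : 4 * (2 : ℝ) ^ (κ x : ℝ) = 2 ^ (2 + κ x : ℝ) := by
      rw [Real.rpow_add two_pos]; norm_num
    rw [this, volume_closedBall_two_rpow, mul_add, two_rpow_add]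
    calc (2 : ℝ≥0∞) ^ (2 * 2 : ℝ) * 2 ^ (2 * κ x : ℝ) * NNReal.pi
        ≤ 2 ^ ((4 : ℕ) : ℝ) * 2 ^ (2 * κ x : ℝ) * 4 := by
          gcongr
          · norm_num
          · norm_num
          · exact pi_le_four_ennreal
      _ = 64 * 2 ^ (2 * κ x : ℝ) := by rw [ENNReal.rpow_natCast]; ring
  calc l * volume s ≤ l * ∑' x : v, volume (closedBall (x : ℂ) (4 * (2 : ℝ) ^ (κ x : ℝ))) := by
        gcongr
        exact (measure_mono hsub).trans (measure_biUnion_le _ hcount _)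
    _ ≤ l * ∑' x : v, 64 * 2 ^ (2 * κ x : ℝ) := by
        gcongr with x; exact hvol x
    _ = 64 * ∑' x : v, l * 2 ^ (2 * κ x : ℝ) := by
        rw [ENNReal.tsum_mul_left, ENNReal.tsum_mul_left]; ring
    _ ≤ 64 * ∑' x : v, ∫⁻ y in closedBall (x : ℂ) ((2 : ℝ) ^ (κ x : ℝ)), u y := by
        gcongr with x; exact hball x (hvs x.2)
    _ = 64 * ∫⁻ y in ⋃ x ∈ v, closedBall x ((2 : ℝ) ^ (κ x : ℝ)), u y := by
        rw [lintegral_biUnion hcount (fun _ _ => measurableSet_closedBall) hdisj]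
    _ ≤ _ := by gcongr; exact Measure.restrict_le_self

/-- Discrete Jensen inequality with weights in `ℝ≥0∞`. -/
theorem tsum_mul_rpow_le {ι : Type*} {r : ℝ} (hr : 1 ≤ r) (w e : ι → ℝ≥0∞) :
    (∑' i, w i * e i) ^ r ≤ (∑' i, w i) ^ (r - 1) * ∑' i, w i * e i ^ r := by
  have hr0 : 0 < r := by linarith
  have h : ∑' i, w i * e i ≤ (∑' i, w i) ^ (1 - r⁻¹) * (∑' i, w i * e i ^ r) ^ r⁻¹ := by
    rw [ENNReal.tsum_eq_iSup_sum]
    refine iSup_le fun s => (ENNReal.inner_le_weight_mul_Lp_of_nonneg s hr w e).trans ?_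
    have h1 : 0 ≤ 1 - r⁻¹ := by rw [sub_nonneg]; exact inv_le_one_of_one_le₀ hr
    gcongr
    · exact ENNReal.sum_le_tsum s
    · exact ENNReal.sum_le_tsum s
  calc (∑' i, w i * e i) ^ r
      ≤ ((∑' i, w i) ^ (1 - r⁻¹) * (∑' i, w i * e i ^ r) ^ r⁻¹) ^ r := by gcongr
    _ = _ := by
        rw [ENNReal.mul_rpow_of_nonneg _ _ hr0.le, ← ENNReal.rpow_mul, ← ENNReal.rpow_mul,
          inv_mul_cancel₀ hr0.ne', ENNReal.rpow_one, sub_mul, inv_mul_cancel₀ hr0.ne', one_mul]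

/-- Discrete Young inequality `ℓ¹ * ℓʳ ⊆ ℓʳ`. -/
theorem tsum_convolution_rpow_le {r : ℝ} (hr : 1 ≤ r) (w : ℕ → ℝ≥0∞) (e : ℤ → ℝ≥0∞)
    (σ : ℕ → ℤ) :
    ∑' j : ℤ, (∑' n, w n * e (j + σ n)) ^ r ≤ (∑' n, w n) ^ r * ∑' j, e j ^ r := by
  calc ∑' j : ℤ, (∑' n, w n * e (j + σ n)) ^ r
      ≤ ∑' j : ℤ, (∑' n, w n) ^ (r - 1) * ∑' n, w n * e (j + σ n) ^ r := by
        gcongr with j; exact tsum_mul_rpow_le hr _ _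
    _ = (∑' n, w n) ^ (r - 1) * ∑' n, w n * ∑' j : ℤ, e (j + σ n) ^ r := by
        rw [ENNReal.tsum_mul_left, ENNReal.tsum_comm]
        simp_rw [ENNReal.tsum_mul_left]
    _ = (∑' n, w n) ^ (r - 1) * ((∑' n, w n) * ∑' j, e j ^ r) := by
        congr 1
        rw [← ENNReal.tsum_mul_right]
        congr with n; congr 1
        exact (Equiv.addRight (σ n)).tsum_eq (fun j => e j ^ r)
    _ ≤ _ := by
        rw [← mul_assoc]
        gcongr
        nth_rw 2 [← ENNReal.rpow_one (∑' n, w n)]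
        rw [← ENNReal.rpow_add_of_nonneg _ _ (by linarith) zero_le_one]
        simp

/-- The decreasing rearrangement of `f` at the dyadic measure `4 ^ j`. -/
def dyadicLevel (f : ℂ → ℝ≥0∞) (j : ℤ) : ℝ≥0∞ :=
  sInf {l | volume {x | l < f x} ≤ 2 ^ (2 * j : ℝ)}

/-- The dyadic Hardy average `∑ₙ 4⁻ⁿ f^*(4^(j-n))ˢ` of the rearrangement of `f`. -/
def hardyAverage (s : ℝ) (f : ℂ → ℝ≥0∞) (j : ℤ) : ℝ≥0∞ :=
  ∑' n : ℕ, 2 ^ (-2 * n : ℝ) * dyadicLevel f (j - n) ^ s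

theorem volume_dyadicLevel_lt_le (f : ℂ → ℝ≥0∞) (j : ℤ) :
    volume {x | dyadicLevel f j < f x} ≤ 2 ^ (2 * j : ℝ) := by
  set S : Set ℝ≥0∞ := {l | volume {x | l < f x} ≤ 2 ^ (2 * j : ℝ)} with hS
  have hne : S.Nonempty := ⟨⊤, by simp [hS]⟩
  obtain ⟨u, hu_anti, hu_tendsto, hu_mem⟩ := exists_seq_tendsto_sInf hne (OrderBot.bddBelow S)
  have hunion : {x | dyadicLevel f j < f x} = ⋃ n, {x | u n < f x} := by
    ext x
    simp only [Set.mem_ofPred_eq, Set.mem_iUnion]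
    constructor
    · intro hx
      exact ((tendsto_order.1 hu_tendsto).2 _ hx).exists
    · rintro ⟨n, hn⟩
      exact (sInf_le (hu_mem n)).trans_lt hn
  rw [hunion, Monotone.measure_iUnion]
  · exact iSup_le hu_mem
  · intro m n hmn x hx
    exact (hu_anti hmn).trans_lt hx

theorem lt_volume_of_lt_dyadicLevel {f : ℂ → ℝ≥0∞} {j : ℤ} {l : ℝ≥0∞} (h : l < dyadicLevel f j) :
    2 ^ (2 * j : ℝ) < volume {x | l < f x} := by
  by_contra! hle
  exact (sInf_le (show l ∈ {l | volume {x | l < f x} ≤ 2 ^ (2 * j : ℝ)} from hle)).not_gt h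

theorem dyadicLevel_rpow_le_hardyAverage (s : ℝ) (f : ℂ → ℝ≥0∞) (j : ℤ) :
    dyadicLevel f j ^ s ≤ hardyAverage s f j := by
  have := ENNReal.le_tsum (f := fun n : ℕ => (2 : ℝ≥0∞) ^ (-2 * n : ℝ) * dyadicLevel f (j - n) ^ s) 0
  refine le_trans (le_of_eq ?_) this
  simp

theorem lintegral_dyadicLevel_lt_rpow_le {s : ℝ} (hs : 0 ≤ s) {f : ℂ → ℝ≥0∞} (hf : Measurable f)
    (j : ℤ) :
    ∫⁻ x in {x | dyadicLevel f j < f x}, f x ^ s ≤ 4 * 2 ^ (2 * j : ℝ) * hardyAverage s f j := by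
  have hmeas : ∀ i : ℤ, MeasurableSet {x | dyadicLevel f i < f x} :=
    fun i => measurableSet_lt measurable_const hf
  have hnull : volume {x | ∀ n : ℕ, dyadicLevel f (j - n) < f x} = 0 := by
    have hlim : Filter.Tendsto (fun n : ℕ => (2 : ℝ≥0∞) ^ (2 * j : ℝ) * 4⁻¹ ^ n) Filter.atTop
        (nhds (2 ^ (2 * j : ℝ) * 0)) :=
      ENNReal.Tendsto.const_mul (ENNReal.tendsto_pow_atTop_nhds_zero_of_lt_one (by simp))
        (Or.inr (two_rpow_ne_top _))
    rw [mul_zero] at hlim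
    refine le_antisymm (ge_of_tendsto' hlim fun n => ?_) zero_le
    calc volume {x | ∀ n : ℕ, dyadicLevel f (j - n) < f x}
        ≤ volume {x | dyadicLevel f (j - n) < f x} := measure_mono fun x hx => hx n
      _ ≤ 2 ^ (2 * (j - n : ℤ) : ℝ) := volume_dyadicLevel_lt_le f _
      _ = 2 ^ (2 * j : ℝ) * 4⁻¹ ^ n := by
          have : (2 * (j - n : ℤ) : ℝ) = 2 * j + -2 * n := by push_cast; ring
          rw [this, two_rpow_add]
          congr 1
          rw [ENNReal.rpow_mul, ENNReal.rpow_natCast, ENNReal.rpow_neg]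
          norm_num
  have hae : ∀ᵐ x, ({x | dyadicLevel f j < f x}.indicator (fun x => f x ^ s) x) ≤
      ∑' n : ℕ, ({x | dyadicLevel f (j - n) < f x}.indicator
        (fun _ => dyadicLevel f (j - (n + 1 : ℕ)) ^ s)) x := by
    have : ∀ᵐ x, ¬ ∀ n : ℕ, dyadicLevel f (j - n) < f x := by
      rw [ae_iff]; simpa using hnull
    filter_upwards [this] with x hx
    by_cases hxj : dyadicLevel f j < f x
    · push Not at hx
      classical
      have hpos : Nat.find hx ≠ 0 := by
        intro h0
        have := Nat.find_spec hx
        rw [h0] at this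
        simp only [Nat.cast_zero, sub_zero] at this
        exact this.not_gt hxj
      obtain ⟨m, hm⟩ := Nat.exists_eq_succ_of_ne_zero hpos
      have h1 : f x ≤ dyadicLevel f (j - (m + 1 : ℕ)) := by
        have := Nat.find_spec hx; rwa [hm] at this
      have h2 : dyadicLevel f (j - m) < f x := by
        have := Nat.find_min hx (m := m) (by omega)
        simpa using this
      refine le_trans ?_ (ENNReal.le_tsum m)
      rw [Set.indicator_of_mem (by exact hxj), Set.indicator_of_mem (by exact h2)]
      gcongr
    · rw [Set.indicator_of_notMem (by exact hxj)]; exact zero_le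
  calc ∫⁻ x in {x | dyadicLevel f j < f x}, f x ^ s
      = ∫⁻ x, {x | dyadicLevel f j < f x}.indicator (fun x => f x ^ s) x :=
        (lintegral_indicator (hmeas j) _).symm
    _ ≤ ∫⁻ x, ∑' n : ℕ, ({x | dyadicLevel f (j - n) < f x}.indicator
        (fun _ => dyadicLevel f (j - (n + 1 : ℕ)) ^ s)) x := lintegral_mono_ae hae
    _ = ∑' n : ℕ, dyadicLevel f (j - (n + 1 : ℕ)) ^ s *
          volume {x | dyadicLevel f (j - n) < f x} := by
        rw [lintegral_tsum fun n => (measurable_const.indicator (hmeas _)).aemeasurable]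
        congr with n
        rw [lintegral_indicator_const (hmeas _)]
    _ ≤ ∑' n : ℕ, 4 * 2 ^ (2 * j : ℝ) *
          (2 ^ (-2 * (n + 1 : ℕ) : ℝ) * dyadicLevel f (j - (n + 1 : ℕ)) ^ s) := by
        refine ENNReal.tsum_le_tsum fun n => ?_
        calc dyadicLevel f (j - (n + 1 : ℕ)) ^ s * volume {x | dyadicLevel f (j - n) < f x}
            ≤ dyadicLevel f (j - (n + 1 : ℕ)) ^ s * 2 ^ (2 * (j - n : ℤ) : ℝ) := by
              gcongr; exact volume_dyadicLevel_lt_le f _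
          _ = _ := by
              have : (2 * (j - n : ℤ) : ℝ) = (2 : ℕ) + (2 * j + -2 * (n + 1 : ℕ)) := by
                push_cast; ring
              rw [this, two_rpow_add, two_rpow_add, ENNReal.rpow_natCast]
              ring
    _ ≤ _ := by
        rw [ENNReal.tsum_mul_left]
        gcongr
        exact ENNReal.tsum_comp_le_tsum_of_injective (f := fun n : ℕ => n + 1) (add_left_injective 1)
          (fun n : ℕ => (2 : ℝ≥0∞) ^ (-2 * n : ℝ) * dyadicLevel f (j - n) ^ s)

theorem setLIntegral_closedBall_rpow_le {s : ℝ} (hs : 0 ≤ s) (f : ℂ → ℝ≥0∞)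
    (x : ℂ) (j k : ℤ) :
    2 ^ (-2 * k : ℝ) * ∫⁻ y in closedBall x ((2 : ℝ) ^ (k : ℝ)), f y ^ s ≤
      4 * hardyAverage s f j + 2 ^ (-2 * k : ℝ) * ∫⁻ y in closedBall x ((2 : ℝ) ^ (k : ℝ)),
        {y | dyadicLevel f j < f y}.indicator (fun y => f y ^ s) y := by
  have hle : ∀ y, f y ^ s ≤ dyadicLevel f j ^ s +
      {y | dyadicLevel f j < f y}.indicator (fun y => f y ^ s) y := by
    intro y
    by_cases hy : dyadicLevel f j < f y
    · rw [Set.indicator_of_mem (by exact hy)]; exact le_add_self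
    · rw [Set.indicator_of_notMem (by exact hy), add_zero]
      exact ENNReal.rpow_le_rpow (not_lt.1 hy) hs
  calc 2 ^ (-2 * k : ℝ) * ∫⁻ y in closedBall x ((2 : ℝ) ^ (k : ℝ)), f y ^ s
      ≤ 2 ^ (-2 * k : ℝ) * ∫⁻ y in closedBall x ((2 : ℝ) ^ (k : ℝ)), (dyadicLevel f j ^ s +
      {y | dyadicLevel f j < f y}.indicator (fun y => f y ^ s) y) := by
        gcongr with y; exact hle y
    _ = (2 ^ (-2 * k : ℝ) * 2 ^ (2 * k : ℝ)) * (NNReal.pi * dyadicLevel f j ^ s) +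
        2 ^ (-2 * k : ℝ) * ∫⁻ y in closedBall x ((2 : ℝ) ^ (k : ℝ)),
        {y | dyadicLevel f j < f y}.indicator (fun y => f y ^ s) y := by
        rw [lintegral_add_left measurable_const, setLIntegral_const, volume_closedBall_two_rpow]
        ring
    _ ≤ _ := by
        rw [← two_rpow_add]
        simp only [neg_mul, neg_add_cancel, ENNReal.rpow_zero, one_mul]
        gcongr
        · exact pi_le_four_ennreal
        · exact dyadicLevel_rpow_le_hardyAverage s f j

theorem average_rpow_le_hardyAverage {s : ℝ} (hs : 0 ≤ s) {f : ℂ → ℝ≥0∞} (hf : Measurable f)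
    (x : ℂ) (k : ℤ) :
    2 ^ (-2 * k : ℝ) * ∫⁻ y in closedBall x ((2 : ℝ) ^ (k : ℝ)), f y ^ s ≤
      8 * hardyAverage s f k := by
  refine (setLIntegral_closedBall_rpow_le hs f x k k).trans ?_
  have : 2 ^ (-2 * k : ℝ) * ∫⁻ y in closedBall x ((2 : ℝ) ^ (k : ℝ)),
      {y | dyadicLevel f k < f y}.indicator (fun y => f y ^ s) y ≤ 4 * hardyAverage s f k := by
    calc _ ≤ 2 ^ (-2 * k : ℝ) * (4 * 2 ^ (2 * k : ℝ) * hardyAverage s f k) := by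
          gcongr
          refine (setLIntegral_le_lintegral _ _).trans ?_
          rw [lintegral_indicator (measurableSet_lt measurable_const hf)]
          exact lintegral_dyadicLevel_lt_rpow_le hs hf k
      _ = (2 ^ (-2 * k : ℝ) * 2 ^ (2 * k : ℝ)) * (4 * hardyAverage s f k) := by ring
      _ = _ := by rw [← two_rpow_add]; simp
  calc _ ≤ 4 * hardyAverage s f k + 4 * hardyAverage s f k := by gcongr
    _ = _ := by ring

theorem volume_hardyAverage_lt_average_le {s : ℝ} (hs : 0 ≤ s) {f : ℂ → ℝ≥0∞} (hf : Measurable f)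
    (j : ℤ) :
    volume {x | ∃ k : ℤ, 8 * hardyAverage s f j <
      2 ^ (-2 * k : ℝ) * ∫⁻ y in closedBall x ((2 : ℝ) ^ (k : ℝ)), f y ^ s} ≤
      256 * 2 ^ (2 * j : ℝ) := by
  set u : ℂ → ℝ≥0∞ := {y | dyadicLevel f j < f y}.indicator (fun y => f y ^ s) with hu
  have hinteg : ∫⁻ y, u y ≤ 4 * 2 ^ (2 * j : ℝ) * hardyAverage s f j := by
    rw [hu, lintegral_indicator (measurableSet_lt measurable_const hf)]
    exact lintegral_dyadicLevel_lt_rpow_le hs hf j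
  set l := hardyAverage s f j with hl
  rcases eq_or_ne l ⊤ with htop | htop
  · simp [htop]
  have hsub : {x | ∃ k : ℤ, 8 * l <
      2 ^ (-2 * k : ℝ) * ∫⁻ y in closedBall x ((2 : ℝ) ^ (k : ℝ)), f y ^ s} ⊆
      {x | ∃ k : ℤ, l < 2 ^ (-2 * k : ℝ) * ∫⁻ y in closedBall x ((2 : ℝ) ^ (k : ℝ)), u y} := by
    rintro x ⟨k, hk⟩
    refine ⟨k, ?_⟩
    have := hk.trans_le (setLIntegral_closedBall_rpow_le hs f x j k)
    by_contra! hcon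
    have h2 : 8 * l < 5 * l := by
      calc 8 * l < 4 * l + l := this.trans_le (by gcongr)
        _ = 5 * l := by ring
    exact h2.not_ge (by gcongr; norm_num)
  refine (measure_mono hsub).trans ?_
  rcases eq_or_ne l 0 with h0 | h0
  · have hu0 : ∫⁻ y, u y = 0 := by simpa [h0] using hinteg
    have hempty : {x | ∃ k : ℤ, l < 2 ^ (-2 * k : ℝ) *
        ∫⁻ y in closedBall x ((2 : ℝ) ^ (k : ℝ)), u y} = ∅ := by
      ext x
      simp only [Set.mem_ofPred_eq, Set.mem_empty_iff_false, iff_false, not_exists, not_lt]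
      intro k
      have : ∫⁻ y in closedBall x ((2 : ℝ) ^ (k : ℝ)), u y = 0 :=
        le_antisymm ((setLIntegral_le_lintegral _ _).trans hu0.le) zero_le
      rw [this, mul_zero]; exact zero_le
    rw [hempty, measure_empty]; exact zero_le
  · have hw := (mul_volume_maximal_lt_le u l).trans (by gcongr : _ ≤ 64 * (4 * 2 ^ (2 * j : ℝ) * l))
    rw [show 64 * (4 * 2 ^ (2 * j : ℝ) * l) = l * (256 * (2 : ℝ≥0∞) ^ (2 * j : ℝ)) by ring] at hw
    exact (ENNReal.mul_le_mul_iff_right h0 htop).1 hw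

theorem tsum_two_rpow_ne_top {a : ℝ} (ha : 0 < a) : ∑' n : ℕ, (2 : ℝ≥0∞) ^ (-a * n) ≠ ⊤ := by
  simp_rw [ENNReal.rpow_mul, ENNReal.rpow_natCast, ENNReal.tsum_geometric]
  refine ENNReal.inv_ne_top.2 (tsub_pos_of_lt ?_).ne'
  exact ENNReal.rpow_lt_one_of_one_lt_of_neg ENNReal.one_lt_two (by linarith)

theorem tsum_two_rpow_anti {a b : ℝ} (hab : a ≤ b) :
    ∑' n : ℕ, (2 : ℝ≥0∞) ^ (-b * n) ≤ ∑' n : ℕ, (2 : ℝ≥0∞) ^ (-a * n) :=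
  ENNReal.tsum_le_tsum fun n => two_rpow_le_two_rpow (by gcongr)

theorem setLIntegral_enorm_inv_rpow_le {m : ℝ} (hm : 0 ≤ m) (k : ℤ) :
    ∫⁻ v in closedBall (0 : ℂ) ((2 : ℝ) ^ (k : ℝ)), (‖v‖ₑ⁻¹) ^ m ≤
      (4 * 2 ^ m * ∑' n : ℕ, (2 : ℝ≥0∞) ^ (-(2 - m) * n)) * 2 ^ ((2 - m) * k) := by
  have hae : ∀ᵐ v ∂(volume.restrict (closedBall (0 : ℂ) ((2 : ℝ) ^ (k : ℝ)))),
      (‖v‖ₑ⁻¹) ^ m ≤ ∑' n : ℕ, (closedBall (0 : ℂ) ((2 : ℝ) ^ ((k - n : ℤ) : ℝ))).indicator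
        (fun _ => (2 : ℝ≥0∞) ^ (-m * (k - n - 1))) v := by
    rw [ae_restrict_iff' measurableSet_closedBall]
    filter_upwards [Measure.ae_ne volume (0 : ℂ)] with v hv0 hv
    obtain ⟨i, hi1, hi2⟩ := exists_mem_Ioc_zpow (norm_pos_iff.2 hv0) (one_lt_two (α := ℝ))
    rw [mem_closedBall_zero_iff, Real.rpow_intCast] at hv
    have hik : i < k := (zpow_lt_zpow_iff_right₀ one_lt_two).1 (hi1.trans_le hv)
    obtain ⟨n, hn⟩ : ∃ n : ℕ, i + 1 = k - n := ⟨(k - i - 1).toNat, by omega⟩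
    refine le_trans ?_ (ENNReal.le_tsum n)
    rw [Set.indicator_of_mem]
    · have h1 : (2 : ℝ≥0∞) ^ (i : ℝ) ≤ ‖v‖ₑ := by
        rw [← ofReal_two_rpow, ← ofReal_norm, Real.rpow_intCast]
        exact ENNReal.ofReal_le_ofReal hi1.le
      have h2 : (-m * (k - n - 1) : ℝ) = -(i : ℝ) * m := by
        have : ((i + 1 : ℤ) : ℝ) = ((k - n : ℤ) : ℝ) := by rw [hn]
        push_cast at this
        linear_combination (-m) * (-this)
      rw [h2, ENNReal.rpow_mul, ENNReal.rpow_neg]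
      gcongr
    · rw [mem_closedBall_zero_iff, Real.rpow_intCast, ← hn]; exact hi2
  calc ∫⁻ v in closedBall (0 : ℂ) ((2 : ℝ) ^ (k : ℝ)), (‖v‖ₑ⁻¹) ^ m
      ≤ ∫⁻ v in closedBall (0 : ℂ) ((2 : ℝ) ^ (k : ℝ)),
        ∑' n : ℕ, (closedBall (0 : ℂ) ((2 : ℝ) ^ ((k - n : ℤ) : ℝ))).indicator
        (fun _ => (2 : ℝ≥0∞) ^ (-m * (k - n - 1))) v := lintegral_mono_ae hae
    _ ≤ ∫⁻ v, ∑' n : ℕ, (closedBall (0 : ℂ) ((2 : ℝ) ^ ((k - n : ℤ) : ℝ))).indicator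
        (fun _ => (2 : ℝ≥0∞) ^ (-m * (k - n - 1))) v := setLIntegral_le_lintegral _ _
    _ = ∑' n : ℕ, (2 : ℝ≥0∞) ^ (-m * (k - n - 1)) * (2 ^ (2 * (k - n : ℤ) : ℝ) * NNReal.pi) := by
        rw [lintegral_tsum fun n =>
          (measurable_const.indicator measurableSet_closedBall).aemeasurable]
        congr with n
        rw [lintegral_indicator_const measurableSet_closedBall, volume_closedBall_two_rpow]
    _ ≤ ∑' n : ℕ, (4 * 2 ^ m * 2 ^ ((2 - m) * k)) * (2 : ℝ≥0∞) ^ (-(2 - m) * n) := by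
        refine ENNReal.tsum_le_tsum fun n => ?_
        calc _ ≤ (2 : ℝ≥0∞) ^ (-m * (k - n - 1)) * (2 ^ (2 * (k - n : ℤ) : ℝ) * 4) := by
              gcongr; exact pi_le_four_ennreal
          _ = 4 * ((2 : ℝ≥0∞) ^ (-m * (k - n - 1)) * 2 ^ (2 * (k - n : ℤ) : ℝ)) := by ring
          _ = 4 * (2 ^ m * 2 ^ ((2 - m) * k) * (2 : ℝ≥0∞) ^ (-(2 - m) * n)) := by
              rw [← two_rpow_add, ← two_rpow_add, ← two_rpow_add]
              congr 2; push_cast; ring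
          _ = _ := by ring
    _ = _ := by rw [ENNReal.tsum_mul_left]; ring

theorem setLIntegral_enorm_sub_inv_rpow_le {m : ℝ} (hm : 0 ≤ m) (k : ℤ) {x y : ℂ}
    (hy : y ∈ closedBall x ((2 : ℝ) ^ (k : ℝ))) :
    ∫⁻ w in closedBall x ((2 : ℝ) ^ (k : ℝ)), (‖y - w‖ₑ⁻¹) ^ m ≤
      (4 * 2 ^ m * ∑' n : ℕ, (2 : ℝ≥0∞) ^ (-(2 - m) * n)) * 2 ^ ((2 - m) * (k + 1)) := by
  have h := setLIntegral_enorm_inv_rpow_le hm (k + 1)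
  push_cast at h
  refine le_trans ?_ h
  rw [← lintegral_indicator measurableSet_closedBall, ← lintegral_indicator measurableSet_closedBall,
    ← lintegral_sub_left_eq_self ((closedBall 0 _).indicator _) y]
  refine lintegral_mono fun w => ?_
  by_cases hw : w ∈ closedBall x ((2 : ℝ) ^ (k : ℝ))
  · rw [Set.indicator_of_mem hw, Set.indicator_of_mem]
    rw [mem_closedBall_zero_iff]
    rw [mem_closedBall, dist_eq_norm] at hw hy
    calc ‖y - w‖ = ‖(y - x) - (w - x)‖ := by congr 1; ring
      _ ≤ ‖y - x‖ + ‖w - x‖ := norm_sub_le _ _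
      _ ≤ (2 : ℝ) ^ (k : ℝ) + (2 : ℝ) ^ (k : ℝ) := by gcongr
      _ = _ := by rw [Real.rpow_add two_pos, Real.rpow_one]; ring
  · rw [Set.indicator_of_notMem hw]; exact zero_le

/-- Young's convolution inequality in trilinear form, on a set of finite kernel mass. -/
theorem lintegral_lintegral_mul_mul_le {μ : Measure ℂ} [SFinite μ] {f g : ℂ → ℝ≥0∞}
    {K : ℂ → ℂ → ℝ≥0∞}
    (hf : Measurable f) (hg : Measurable g) (hK : Measurable (Function.uncurry K))
    {α β γ : ℝ} (hα : 0 < α) (hβ : 0 < β) (hγ : 0 < γ) (hα1 : α ≤ 1) (hβ1 : β ≤ 1) (hγ1 : γ ≤ 1)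
    (hsum : α + β + γ = 2) {κ : ℝ≥0∞}
    (hκ1 : ∀ᵐ y ∂μ, ∫⁻ w, K y w ^ γ⁻¹ ∂μ ≤ κ) (hκ2 : ∀ᵐ w ∂μ, ∫⁻ y, K y w ^ γ⁻¹ ∂μ ≤ κ) :
    ∫⁻ y, ∫⁻ w, f y * g w * K y w ∂μ ∂μ ≤
      (∫⁻ y, f y ^ α⁻¹ ∂μ) ^ α * (∫⁻ w, g w ^ β⁻¹ ∂μ) ^ β * κ ^ γ := by
  have hK' : Measurable fun z : ℂ × ℂ => K z.1 z.2 := hK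
  set F := ∫⁻ y, f y ^ α⁻¹ ∂μ
  set G := ∫⁻ w, g w ^ β⁻¹ ∂μ
  let h : Fin 3 → ℂ × ℂ → ℝ≥0∞ := ![fun z => f z.1 ^ α⁻¹ * g z.2 ^ β⁻¹,
    fun z => f z.1 ^ α⁻¹ * K z.1 z.2 ^ γ⁻¹, fun z => g z.2 ^ β⁻¹ * K z.1 z.2 ^ γ⁻¹]
  let e : Fin 3 → ℝ := ![1 - γ, 1 - β, 1 - α]
  have hsplit : ∀ (u : ℝ≥0∞) {a b c : ℝ}, 0 < a → 0 ≤ b → 0 ≤ c → b + c = a →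
      (u ^ a⁻¹) ^ b * (u ^ a⁻¹) ^ c = u := by
    intro u a b c ha hb hc habc
    rw [← ENNReal.rpow_add_of_nonneg _ _ hb hc, habc, ENNReal.rpow_inv_rpow ha.ne']
  have hpt : ∀ z : ℂ × ℂ, f z.1 * g z.2 * K z.1 z.2 = ∏ i, h i z ^ e i := by
    intro z
    simp only [Fin.prod_univ_three, h, e, Matrix.cons_val]
    rw [ENNReal.mul_rpow_of_nonneg _ _ (by linarith), ENNReal.mul_rpow_of_nonneg _ _ (by linarith),
      ENNReal.mul_rpow_of_nonneg _ _ (by linarith)]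
    have h1 := hsplit (f z.1) hα (sub_nonneg.2 hγ1) (sub_nonneg.2 hβ1) (by linarith)
    have h2 := hsplit (g z.2) hβ (sub_nonneg.2 hγ1) (sub_nonneg.2 hα1) (by linarith)
    have h3 := hsplit (K z.1 z.2) hγ (sub_nonneg.2 hβ1) (sub_nonneg.2 hα1) (by linarith)
    conv_lhs => rw [← h1, ← h2, ← h3]
    ring
  have hmeas : ∀ i, Measurable (h i) := by
    intro i
    fin_cases i
    · exact (by fun_prop : Measurable fun z : ℂ × ℂ => f z.1 ^ α⁻¹ * g z.2 ^ β⁻¹)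
    · exact (by fun_prop : Measurable fun z : ℂ × ℂ => f z.1 ^ α⁻¹ * K z.1 z.2 ^ γ⁻¹)
    · exact (by fun_prop : Measurable fun z : ℂ × ℂ => g z.2 ^ β⁻¹ * K z.1 z.2 ^ γ⁻¹)
  have hI0 : ∫⁻ z, h 0 z ∂(μ.prod μ) = F * G := by
    exact lintegral_prod_mul (hf.pow_const _).aemeasurable (hg.pow_const _).aemeasurable
  have hI1 : ∫⁻ z, h 1 z ∂(μ.prod μ) ≤ F * κ := by
    rw [lintegral_prod _ (hmeas 1).aemeasurable]
    calc _ = ∫⁻ y, f y ^ α⁻¹ * ∫⁻ w, K y w ^ γ⁻¹ ∂μ ∂μ := by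
          refine lintegral_congr fun y => ?_
          exact lintegral_const_mul (f y ^ α⁻¹) ((hK'.comp (measurable_prodMk_left (x := y))).pow_const γ⁻¹)
      _ ≤ ∫⁻ y, f y ^ α⁻¹ * κ ∂μ := by
          refine lintegral_mono_ae ?_
          filter_upwards [hκ1] with y hy
          gcongr
      _ = _ := lintegral_mul_const _ (by fun_prop)
  have hI2 : ∫⁻ z, h 2 z ∂(μ.prod μ) ≤ G * κ := by
    rw [lintegral_prod_symm _ (hmeas 2).aemeasurable]
    calc _ = ∫⁻ w, g w ^ β⁻¹ * ∫⁻ y, K y w ^ γ⁻¹ ∂μ ∂μ := by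
          refine lintegral_congr fun y => ?_
          exact lintegral_const_mul (g y ^ β⁻¹) ((hK'.comp (measurable_prodMk_right (y := y))).pow_const γ⁻¹)
      _ ≤ ∫⁻ y, g y ^ β⁻¹ * κ ∂μ := by
          refine lintegral_mono_ae ?_
          filter_upwards [hκ2] with y hy
          gcongr
      _ = _ := lintegral_mul_const _ (by fun_prop)
  calc ∫⁻ y, ∫⁻ w, f y * g w * K y w ∂μ ∂μ
      = ∫⁻ z, f z.1 * g z.2 * K z.1 z.2 ∂(μ.prod μ) :=
        (lintegral_prod (fun z : ℂ × ℂ => f z.1 * g z.2 * K z.1 z.2) (by fun_prop)).symm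
    _ = ∫⁻ z, ∏ i, h i z ^ e i ∂(μ.prod μ) := lintegral_congr hpt
    _ ≤ ∏ i, (∫⁻ z, h i z ∂(μ.prod μ)) ^ e i := by
        refine ENNReal.lintegral_prod_norm_pow_le _ (fun i _ => (hmeas i).aemeasurable) ?_ ?_
        · simp only [Fin.sum_univ_three, e, Matrix.cons_val]; linarith
        · intro i _
          fin_cases i <;> simp [e, *]
    _ ≤ (F * G) ^ (1 - γ) * (F * κ) ^ (1 - β) * (G * κ) ^ (1 - α) := by
        simp only [Fin.prod_univ_three, e, Matrix.cons_val]
        rw [hI0]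
        gcongr
    _ = _ := by
        have hadd : ∀ (u : ℝ≥0∞) {a b c : ℝ}, 0 ≤ b → 0 ≤ c → b + c = a → u ^ a = u ^ b * u ^ c :=
          fun u a b c hb hc h => by rw [← h, ENNReal.rpow_add_of_nonneg _ _ hb hc]
        rw [ENNReal.mul_rpow_of_nonneg _ _ (by linarith),
          ENNReal.mul_rpow_of_nonneg _ _ (by linarith), ENNReal.mul_rpow_of_nonneg _ _ (by linarith),
          hadd F (sub_nonneg.2 hγ1) (sub_nonneg.2 hβ1) (show _ = α by linarith),
          hadd G (sub_nonneg.2 hγ1) (sub_nonneg.2 hα1) (show _ = β by linarith),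
          hadd κ (sub_nonneg.2 hβ1) (sub_nonneg.2 hα1) (show _ = γ by linarith)]
        ring

/-- Constant in the fractional integration bound on dyadic balls. -/
def rieszConst (γ : ℝ) : ℝ≥0∞ :=
  (4 * 2 ^ γ⁻¹ * ∑' n : ℕ, (2 : ℝ≥0∞) ^ (-(2 - γ⁻¹) * n)) ^ γ * 2 ^ (2 * γ - 1)

theorem rieszConst_ne_top {γ : ℝ} (hγ : 1 / 2 < γ) : rieszConst γ ≠ ⊤ := by
  have h2 : 0 < 2 - γ⁻¹ := by
    rw [sub_pos, inv_lt_comm₀ (by linarith) two_pos]; linarith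
  refine ENNReal.mul_ne_top (ENNReal.rpow_ne_top_of_nonneg (by linarith) ?_) (two_rpow_ne_top _)
  exact ENNReal.mul_ne_top (ENNReal.mul_ne_top (by norm_num) (two_rpow_ne_top _))
    (tsum_two_rpow_ne_top h2)

theorem lintegral_closedBall_riesz_le {f g : ℂ → ℝ≥0∞} (hf : Measurable f) (hg : Measurable g)
    {α β γ : ℝ} (hα : 0 < α) (hβ : 0 < β) (hγ : 0 < γ) (hα1 : α ≤ 1) (hβ1 : β ≤ 1)
    (hγ1 : γ ≤ 1) (hsum : α + β + γ = 2) (x : ℂ) (k : ℤ) :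
    2 ^ (-2 * k : ℝ) * ∫⁻ y in closedBall x ((2 : ℝ) ^ (k : ℝ)),
      ∫⁻ w in closedBall x ((2 : ℝ) ^ (k : ℝ)), f y * g w * ‖y - w‖ₑ⁻¹ ≤
    rieszConst γ * 2 ^ (k : ℝ) *
      (2 ^ (-2 * k : ℝ) * ∫⁻ y in closedBall x ((2 : ℝ) ^ (k : ℝ)), f y ^ α⁻¹) ^ α *
      (2 ^ (-2 * k : ℝ) * ∫⁻ y in closedBall x ((2 : ℝ) ^ (k : ℝ)), g y ^ β⁻¹) ^ β := by
  have hm : 0 ≤ γ⁻¹ := by positivity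
  have hyoung := lintegral_lintegral_mul_mul_le
    (μ := volume.restrict (closedBall x ((2 : ℝ) ^ (k : ℝ)))) (K := fun y w => ‖y - w‖ₑ⁻¹) hf hg
    (by simp only [Function.uncurry_def]; fun_prop) hα hβ hγ hα1 hβ1 hγ1 hsum
    (ae_restrict_of_forall_mem measurableSet_closedBall
      fun y hy => setLIntegral_enorm_sub_inv_rpow_le hm k hy)
    (ae_restrict_of_forall_mem measurableSet_closedBall fun y hy => by
      simp_rw [enorm_sub_rev _ y]
      exact setLIntegral_enorm_sub_inv_rpow_le hm k hy)
  refine (mul_le_mul_right hyoung _).trans (le_of_eq ?_)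
  have hγ' : (2 - γ⁻¹) * (k + 1) * γ = k * (2 * γ - 1) + (2 * γ - 1) := by
    field_simp
  rw [ENNReal.mul_rpow_of_nonneg _ _ hα.le, ENNReal.mul_rpow_of_nonneg _ _ hβ.le,
    ENNReal.mul_rpow_of_nonneg _ _ hγ.le, rieszConst, ← ENNReal.rpow_mul, ← ENNReal.rpow_mul,
    ← ENNReal.rpow_mul (2 : ℝ≥0∞) (-2 * k) β, hγ', two_rpow_add (k * (2 * γ - 1))]
  have hexp : (2 : ℝ≥0∞) ^ (-2 * k : ℝ) * 2 ^ (k * (2 * γ - 1)) =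
      2 ^ (k : ℝ) * 2 ^ (-2 * k * α) * 2 ^ (-2 * k * β) := by
    rw [← two_rpow_add, ← two_rpow_add, ← two_rpow_add]
    congr 1
    linear_combination (2 * k : ℝ) * hsum
  set c := (4 * (2 : ℝ≥0∞) ^ γ⁻¹ * ∑' n : ℕ, (2 : ℝ≥0∞) ^ (-(2 - γ⁻¹) * n)) ^ γ
  set F := (∫⁻ y in closedBall x ((2 : ℝ) ^ (k : ℝ)), f y ^ α⁻¹) ^ α
  set G := (∫⁻ y in closedBall x ((2 : ℝ) ^ (k : ℝ)), g y ^ β⁻¹) ^ β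
  calc _ = ((2 : ℝ≥0∞) ^ (-2 * k : ℝ) * 2 ^ (k * (2 * γ - 1))) * (F * G * c * 2 ^ (2 * γ - 1)) := by
        ring
    _ = _ := by rw [hexp]; ring

theorem tsum_two_rpow_two_le : ∑' n : ℕ, (2 : ℝ≥0∞) ^ (-2 * n : ℝ) ≤ 2 := by
  have h := tsum_two_rpow_anti (a := 1) (b := 2) (by norm_num)
  refine h.trans (le_of_eq ?_)
  simp_rw [ENNReal.rpow_mul, ENNReal.rpow_natCast, ENNReal.tsum_geometric]
  rw [ENNReal.rpow_neg_one, ENNReal.one_sub_inv_two, inv_inv]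

theorem tsum_two_rpow_one : ∑' n : ℕ, (2 : ℝ≥0∞) ^ (-1 * n : ℝ) = 2 := by
  simp_rw [ENNReal.rpow_mul, ENNReal.rpow_natCast, ENNReal.tsum_geometric]
  rw [ENNReal.rpow_neg_one, ENNReal.one_sub_inv_two, inv_inv]

/-- A sum over `ℤ` is bounded by the sums over the two half-lines starting at `j`. -/
theorem tsum_int_le (u : ℤ → ℝ≥0∞) (j : ℤ) :
    ∑' k, u k ≤ ∑' n : ℕ, u (j - n) + ∑' n : ℕ, u (j + n) := by
  have hshift : ∑' k, u k = ∑' k, u (j + k) := ((Equiv.addLeft j).tsum_eq u).symm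
  rw [hshift, add_comm, tsum_of_nat_of_neg_add_one ENNReal.summable ENNReal.summable]
  refine add_le_add le_rfl ?_
  have := ENNReal.tsum_comp_le_tsum_of_injective (f := fun n : ℕ => n + 1) (add_left_injective 1)
    (fun n : ℕ => u (j - n))
  refine le_trans (le_of_eq ?_) this
  congr with n

theorem tsum_indicator_two_rpow_lt_le (V : ℝ≥0∞) :
    ∑' j : ℤ, {j : ℤ | (2 : ℝ≥0∞) ^ (2 * j : ℝ) < V}.indicator
      (fun j => (2 : ℝ≥0∞) ^ (2 * j : ℝ)) j ≤ 3 * V := by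
  rcases eq_or_ne V ⊤ with rfl | hV
  · simp
  rcases eq_or_ne V 0 with rfl | h0
  · simp
  obtain ⟨i, hi1, hi2⟩ := ENNReal.exists_mem_Ioc_zpow h0 hV (y := 4) (by norm_num) (by norm_num)
  have hpow : ∀ n : ℤ, (4 : ℝ≥0∞) ^ n = 2 ^ (2 * n : ℝ) := by
    intro n
    rw [ENNReal.rpow_mul, ENNReal.rpow_intCast]; norm_num
  rw [hpow] at hi1 hi2
  have hle : ∀ j : ℤ, (2 : ℝ≥0∞) ^ (2 * j : ℝ) < V → j ≤ i := by
    intro j hj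
    by_contra! hcon
    refine (hj.trans_le hi2).not_ge (two_rpow_le_two_rpow ?_)
    gcongr; exact_mod_cast hcon
  refine (tsum_int_le _ i).trans ?_
  calc _ ≤ ∑' n : ℕ, 2 ^ (2 * i : ℝ) * (2 : ℝ≥0∞) ^ (-2 * n : ℝ) + 2 ^ (2 * i : ℝ) := by
        refine add_le_add (ENNReal.tsum_le_tsum fun n => ?_) ?_
        · refine (Set.indicator_le_self _ _ _).trans (le_of_eq ?_)
          rw [← two_rpow_add]; congr 1; push_cast; ring
        · rw [tsum_eq_single 0]
          · simpa using Set.indicator_le_self _ _ _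
          · intro n hn
            refine Set.indicator_of_notMem (fun hmem => ?_) _
            have := hle _ hmem
            omega
    _ ≤ 2 ^ (2 * i : ℝ) * 2 + 2 ^ (2 * i : ℝ) := by
        rw [ENNReal.tsum_mul_left]
        gcongr
        exact tsum_two_rpow_two_le
    _ = 3 * 2 ^ (2 * i : ℝ) := by ring
    _ ≤ _ := by gcongr

/-- Layer cake in `ℝ≥0∞`. -/
theorem lintegral_Ioi_indicator_lt (a : ℝ≥0∞) :
    ∫⁻ τ in Set.Ioi (0 : ℝ), {τ : ℝ | ENNReal.ofReal τ < a}.indicator 1 τ = a := by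
  have hm : MeasurableSet {τ : ℝ | ENNReal.ofReal τ < a} :=
    measurableSet_lt (by fun_prop) measurable_const
  rw [lintegral_indicator_one hm, Measure.restrict_apply hm]
  rcases eq_or_ne a ⊤ with rfl | ha
  · have : {τ : ℝ | ENNReal.ofReal τ < ⊤} ∩ Set.Ioi 0 = Set.Ioi 0 := by ext; simp
    rw [this, Real.volume_Ioi]
  · have : {τ : ℝ | ENNReal.ofReal τ < a} ∩ Set.Ioi 0 = Set.Ioo 0 a.toReal := by
      ext τ
      simp only [Set.mem_inter_iff, Set.mem_ofPred_eq, Set.mem_Ioi, Set.mem_Ioo]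
      rw [and_comm]
      refine and_congr_right fun hτ => ?_
      rw [ENNReal.ofReal_lt_iff_lt_toReal hτ.le ha]
    rw [this, Real.volume_Ioo, sub_zero, ENNReal.ofReal_toReal ha]

theorem tsum_dyadicLevel_rpow_le {p : ℝ} (hp : 0 < p) {f : ℂ → ℝ≥0∞} (hf : Measurable f) :
    ∑' j : ℤ, 2 ^ (2 * j : ℝ) * dyadicLevel f j ^ p ≤ 3 * ∫⁻ x, f x ^ p := by
  have hmeas : ∀ a : ℝ≥0∞, MeasurableSet {τ : ℝ | ENNReal.ofReal τ < a} := fun a =>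
    measurableSet_lt (by fun_prop) measurable_const
  calc ∑' j : ℤ, 2 ^ (2 * j : ℝ) * dyadicLevel f j ^ p
      = ∑' j : ℤ, ∫⁻ τ in Set.Ioi (0 : ℝ), 2 ^ (2 * j : ℝ) *
          {τ : ℝ | ENNReal.ofReal τ < dyadicLevel f j ^ p}.indicator 1 τ := by
        congr with j
        rw [lintegral_const_mul _ (measurable_one.indicator (hmeas _)), lintegral_Ioi_indicator_lt]
    _ = ∫⁻ τ in Set.Ioi (0 : ℝ), ∑' j : ℤ, 2 ^ (2 * j : ℝ) *
          {τ : ℝ | ENNReal.ofReal τ < dyadicLevel f j ^ p}.indicator 1 τ :=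
        (lintegral_tsum fun j => ((measurable_one.indicator (hmeas _)).const_mul _).aemeasurable).symm
    _ ≤ ∫⁻ τ in Set.Ioi (0 : ℝ), 3 * volume {x | ENNReal.ofReal τ < f x ^ p} := by
        refine lintegral_mono fun τ => le_trans (ENNReal.tsum_le_tsum fun j => ?_)
          (tsum_indicator_two_rpow_lt_le _)
        by_cases hτ : ENNReal.ofReal τ < dyadicLevel f j ^ p
        · rw [Set.indicator_of_mem (by exact hτ), Set.indicator_of_mem]
          · simp
          · have h1 : ENNReal.ofReal τ ^ p⁻¹ < dyadicLevel f j := by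
              rwa [ENNReal.rpow_inv_lt_iff hp]
            have h2 := lt_volume_of_lt_dyadicLevel h1
            simp_rw [ENNReal.rpow_inv_lt_iff hp] at h2
            exact h2
        · rw [Set.indicator_of_notMem (by exact hτ), mul_zero]; exact zero_le
    _ = 3 * ∫⁻ τ in Set.Ioi (0 : ℝ), ∫⁻ x, {τ : ℝ | ENNReal.ofReal τ < f x ^ p}.indicator 1 τ := by
        rw [lintegral_const_mul' _ _ (by norm_num)]
        congr 1
        refine lintegral_congr fun τ => ?_
        rw [← lintegral_indicator_one (measurableSet_lt measurable_const (hf.pow_const _))]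
        rfl
    _ = 3 * ∫⁻ x, ∫⁻ τ in Set.Ioi (0 : ℝ), {τ : ℝ | ENNReal.ofReal τ < f x ^ p}.indicator 1 τ := by
        congr 1
        rw [lintegral_lintegral_swap]
        refine Measurable.aemeasurable ?_
        have : MeasurableSet {z : ℝ × ℂ | ENNReal.ofReal z.1 < f z.2 ^ p} :=
          measurableSet_lt (by fun_prop) (by fun_prop)
        exact measurable_one.indicator this
    _ = _ := by simp_rw [lintegral_Ioi_indicator_lt]

/-- The positive bilinear operator that dominates the gradient of the solution. -/
def wentePotential (f g : ℂ → ℝ≥0∞) (x : ℂ) : ℝ≥0∞ :=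
  ∑' k : ℤ, 2 ^ (-2 * k : ℝ) * ∫⁻ y in closedBall x ((2 : ℝ) ^ (k : ℝ)),
    ∫⁻ w in closedBall x ((2 : ℝ) ^ (k : ℝ)), f y * g w * ‖y - w‖ₑ⁻¹

/-- A majorant, in terms of rearrangements, for the values of `wentePotential f g` outside a set of
measure comparable to `4 ^ j`. -/
def wenteLevel (α β γ : ℝ) (f g : ℂ → ℝ≥0∞) (j : ℤ) : ℝ≥0∞ :=
  192 * rieszConst γ * ∑' n : ℕ, 2 ^ ((j + n : ℤ) : ℝ) *
    hardyAverage α⁻¹ f (j + n) ^ α * hardyAverage β⁻¹ g (j + n) ^ β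

theorem volume_wenteLevel_lt_le {f g : ℂ → ℝ≥0∞} (hf : Measurable f) (hg : Measurable g)
    {α β γ : ℝ} (hα : 0 < α) (hβ : 0 < β) (hγ : 0 < γ) (hα1 : α ≤ 1) (hβ1 : β ≤ 1)
    (hγ1 : γ ≤ 1) (hsum : α + β + γ = 2) (j : ℤ) :
    volume {x | wenteLevel α β γ f g j < wentePotential f g x} ≤ 512 * 2 ^ (2 * j : ℝ) := by
  set A := fun (k : ℤ) => hardyAverage α⁻¹ f k
  set B := fun (k : ℤ) => hardyAverage β⁻¹ g k
  set bad : (ℂ → ℝ≥0∞) → ℝ → Set ℂ := fun f s => {x | ∃ k : ℤ, 8 * hardyAverage s f j <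
      2 ^ (-2 * k : ℝ) * ∫⁻ y in closedBall x ((2 : ℝ) ^ (k : ℝ)), f y ^ s} with hbad
  have hsub : {x | wenteLevel α β γ f g j < wentePotential f g x} ⊆ bad f α⁻¹ ∪ bad g β⁻¹ := by
    intro x hx
    by_contra hcon
    simp only [hbad, Set.mem_union, Set.mem_ofPred_eq, not_or, not_exists, not_lt] at hcon
    obtain ⟨hfj, hgj⟩ := hcon
    refine (not_lt_of_ge ?_) (show wenteLevel α β γ f g j < wentePotential f g x from hx)
    have hterm : ∀ k i l : ℤ,
        2 ^ (-2 * k : ℝ) * ∫⁻ y in closedBall x ((2 : ℝ) ^ (k : ℝ)), f y ^ α⁻¹ ≤ 8 * A i →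
        2 ^ (-2 * k : ℝ) * ∫⁻ y in closedBall x ((2 : ℝ) ^ (k : ℝ)), g y ^ β⁻¹ ≤ 8 * B l →
        2 ^ (-2 * k : ℝ) * ∫⁻ y in closedBall x ((2 : ℝ) ^ (k : ℝ)),
          ∫⁻ w in closedBall x ((2 : ℝ) ^ (k : ℝ)), f y * g w * ‖y - w‖ₑ⁻¹ ≤
        64 * rieszConst γ * (2 ^ (k : ℝ) * A i ^ α * B l ^ β) := by
      intro k i l h1 h2
      have h8 : ∀ {e : ℝ}, e ≤ 1 → (8 : ℝ≥0∞) ^ e ≤ 8 := fun {e} he => by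
        conv_rhs => rw [← ENNReal.rpow_one 8]
        exact ENNReal.rpow_le_rpow_of_exponent_le (by norm_num) he
      calc _ ≤ rieszConst γ * 2 ^ (k : ℝ) * (8 * A i) ^ α * (8 * B l) ^ β := by
            refine (lintegral_closedBall_riesz_le hf hg hα hβ hγ hα1 hβ1 hγ1 hsum x k).trans ?_
            gcongr
        _ = (8 ^ α * 8 ^ β) * rieszConst γ * (2 ^ (k : ℝ) * A i ^ α * B l ^ β) := by
            rw [ENNReal.mul_rpow_of_nonneg _ _ hα.le, ENNReal.mul_rpow_of_nonneg _ _ hβ.le]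
            ring
        _ ≤ (8 * 8) * rieszConst γ * (2 ^ (k : ℝ) * A i ^ α * B l ^ β) := by
            gcongr
            · exact h8 hα1
            · exact h8 hβ1
        _ = _ := by norm_num
    set T := ∑' n : ℕ, 2 ^ ((j + n : ℤ) : ℝ) * A (j + n) ^ α * B (j + n) ^ β with hT
    have hT0 : 2 ^ (j : ℝ) * A j ^ α * B j ^ β ≤ T := by
      refine le_trans (le_of_eq ?_) (ENNReal.le_tsum 0)
      simp
    calc wentePotential f g x
        ≤ ∑' n : ℕ, 64 * rieszConst γ * (2 ^ ((j - n : ℤ) : ℝ) * A j ^ α * B j ^ β) +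
          ∑' n : ℕ, 64 * rieszConst γ * (2 ^ ((j + n : ℤ) : ℝ) * A (j + n) ^ α * B (j + n) ^ β) := by
          refine (tsum_int_le _ j).trans ?_
          refine add_le_add (ENNReal.tsum_le_tsum fun n => ?_) (ENNReal.tsum_le_tsum fun n => ?_)
          · exact hterm _ _ _ (hfj _) (hgj _)
          · exact hterm _ _ _ (average_rpow_le_hardyAverage (by positivity) hf x _)
              (average_rpow_le_hardyAverage (by positivity) hg x _)
      _ = 64 * rieszConst γ * (2 ^ (j : ℝ) * A j ^ α * B j ^ β) *
            ∑' n : ℕ, (2 : ℝ≥0∞) ^ (-1 * n : ℝ) + 64 * rieszConst γ * T := by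
          rw [← ENNReal.tsum_mul_left, hT, ← ENNReal.tsum_mul_left (a := 64 * rieszConst γ)]
          congr 1
          refine tsum_congr fun n => ?_
          rw [show ((j - n : ℤ) : ℝ) = j + -1 * n by push_cast; ring, two_rpow_add]
          ring
      _ ≤ 64 * rieszConst γ * T * 2 + 64 * rieszConst γ * T := by
          rw [tsum_two_rpow_one]
          gcongr
      _ = 192 * rieszConst γ * T := by ring
      _ = _ := rfl
  calc _ ≤ volume (bad f α⁻¹ ∪ bad g β⁻¹) := measure_mono hsub
    _ ≤ volume (bad f α⁻¹) + volume (bad g β⁻¹) := measure_union_le _ _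
    _ ≤ 256 * 2 ^ (2 * j : ℝ) + 256 * 2 ^ (2 * j : ℝ) :=
        add_le_add (volume_hardyAverage_lt_average_le (by positivity) hf j)
          (volume_hardyAverage_lt_average_le (by positivity) hg j)
    _ = _ := by ring

theorem hardyAverage_rpow_le_of_dyadicLevel_le {g : ℂ → ℝ≥0∞} {β θ : ℝ} (hβ : 0 < β)
    {B : ℝ≥0∞} (hB : ∀ k : ℤ, dyadicLevel g k ≤ B * 2 ^ (-2 * k * θ)) (k : ℤ) :
    hardyAverage β⁻¹ g k ^ β ≤
      (∑' n : ℕ, (2 : ℝ≥0∞) ^ (-(2 - 2 * θ * β⁻¹) * n)) ^ β * (B * 2 ^ (-2 * k * θ)) := by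
  calc hardyAverage β⁻¹ g k ^ β
      ≤ (∑' n : ℕ, (B * 2 ^ (-2 * k * θ)) ^ β⁻¹ * (2 : ℝ≥0∞) ^ (-(2 - 2 * θ * β⁻¹) * n)) ^ β := by
        refine ENNReal.rpow_le_rpow (ENNReal.tsum_le_tsum fun n => ?_) hβ.le
        calc (2 : ℝ≥0∞) ^ (-2 * n : ℝ) * dyadicLevel g (k - n) ^ β⁻¹
            ≤ 2 ^ (-2 * n : ℝ) * (B * 2 ^ (-2 * (k - n : ℤ) * θ)) ^ β⁻¹ := by
              gcongr
              exact hB _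
          _ = _ := by
              rw [ENNReal.mul_rpow_of_nonneg _ _ (by positivity),
                ENNReal.mul_rpow_of_nonneg _ _ (by positivity), ← ENNReal.rpow_mul,
                ← ENNReal.rpow_mul, mul_left_comm, ← two_rpow_add,
                mul_assoc (B ^ β⁻¹), ← two_rpow_add]
              congr 2; push_cast; ring
    _ = _ := by
        rw [ENNReal.tsum_mul_left, ENNReal.mul_rpow_of_nonneg _ _ hβ.le,
          ENNReal.rpow_inv_rpow hβ.ne', mul_comm]

theorem tsum_hardyAverage_rpow_le {f : ℂ → ℝ≥0∞} (hf : Measurable f) {α p : ℝ} (hα : 0 < α)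
    (hp : 0 < p) (hαp : 1 ≤ α * p) :
    ∑' j : ℤ, 2 ^ (2 * j : ℝ) * (hardyAverage α⁻¹ f j ^ α) ^ p ≤
      (∑' n : ℕ, (2 : ℝ≥0∞) ^ (-(2 - 2 * (α * p)⁻¹) * n)) ^ (α * p) * (3 * ∫⁻ x, f x ^ p) := by
  have hr0 : 0 < α * p := by positivity
  set e : ℤ → ℝ≥0∞ := fun k => 2 ^ (2 * k * (α * p)⁻¹) * dyadicLevel f k ^ α⁻¹
  calc _ = ∑' j : ℤ, (∑' n : ℕ, (2 : ℝ≥0∞) ^ (-(2 - 2 * (α * p)⁻¹) * n) * e (j + -(n : ℤ))) ^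
          (α * p) := by
        congr with j
        have h1 : ∑' n : ℕ, (2 : ℝ≥0∞) ^ (-(2 - 2 * (α * p)⁻¹) * n) * e (j + -(n : ℤ)) =
            2 ^ (2 * j * (α * p)⁻¹) * hardyAverage α⁻¹ f j := by
          rw [hardyAverage, ← ENNReal.tsum_mul_left]
          congr with n
          simp only [e]
          rw [← mul_assoc, ← mul_assoc, ← two_rpow_add, ← two_rpow_add, ← sub_eq_add_neg]
          congr 2; push_cast; ring
        rw [h1, ENNReal.mul_rpow_of_nonneg _ _ hr0.le, ← ENNReal.rpow_mul, ← ENNReal.rpow_mul]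
        congr 2; field_simp
    _ ≤ (∑' n : ℕ, (2 : ℝ≥0∞) ^ (-(2 - 2 * (α * p)⁻¹) * n)) ^ (α * p) * ∑' j, e j ^ (α * p) :=
        tsum_convolution_rpow_le hαp _ e fun n => -(n : ℤ)
    _ ≤ _ := by
        gcongr
        refine le_trans (le_of_eq ?_) (tsum_dyadicLevel_rpow_le hp hf)
        congr with j
        simp only [e]
        rw [ENNReal.mul_rpow_of_nonneg _ _ hr0.le, ← ENNReal.rpow_mul, ← ENNReal.rpow_mul]
        congr 2 <;> field_simp

theorem tsum_wenteLevel_rpow_le {f g : ℂ → ℝ≥0∞} (hf : Measurable f) {α β γ p : ℝ} (hα : 0 < α)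
    (hβ : 0 < β) (hp : 1 ≤ p) (hαp : 1 ≤ α * p) {B : ℝ≥0∞}
    (hB : ∀ k : ℤ, dyadicLevel g k ≤ B * 2 ^ (-2 * k * (1 - p⁻¹))) :
    (∑' j : ℤ, (2 ^ (j : ℝ) * wenteLevel α β γ f g j) ^ p) ^ p⁻¹ ≤
      1152 * rieszConst γ * (∑' n : ℕ, (2 : ℝ≥0∞) ^ (-(2 - 2 * (1 - p⁻¹) * β⁻¹) * n)) ^ β *
        (∑' n : ℕ, (2 : ℝ≥0∞) ^ (-(2 - 2 * (α * p)⁻¹) * n)) ^ α *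
        (B * (∫⁻ x, f x ^ p) ^ p⁻¹) := by
  have hp0 : 0 < p := by linarith
  set G1 := (∑' n : ℕ, (2 : ℝ≥0∞) ^ (-(2 - 2 * (1 - p⁻¹) * β⁻¹) * n)) ^ β
  set G2 := (∑' n : ℕ, (2 : ℝ≥0∞) ^ (-(2 - 2 * (α * p)⁻¹) * n)) with hG2
  set c := 192 * rieszConst γ * G1 * B with hc
  set e : ℤ → ℝ≥0∞ := fun k => 2 ^ (2 * k * p⁻¹) * hardyAverage α⁻¹ f k ^ α with he
  have hpt : ∀ j : ℤ, 2 ^ (j : ℝ) * wenteLevel α β γ f g j ≤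
      c * ∑' n : ℕ, (2 : ℝ≥0∞) ^ (-1 * n : ℝ) * e (j + n) := by
    intro j
    calc 2 ^ (j : ℝ) * wenteLevel α β γ f g j
        ≤ 2 ^ (j : ℝ) * (192 * rieszConst γ * ∑' n : ℕ, 2 ^ ((j + n : ℤ) : ℝ) *
          hardyAverage α⁻¹ f (j + n) ^ α *
            (G1 * (B * 2 ^ (-2 * (j + n : ℤ) * (1 - p⁻¹))))) := by
          rw [wenteLevel]
          refine mul_le_mul_right (mul_le_mul_right (ENNReal.tsum_le_tsum fun n => ?_) _) _
          gcongr
          exact hardyAverage_rpow_le_of_dyadicLevel_le hβ hB _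
      _ = _ := by
          rw [← ENNReal.tsum_mul_left, ← ENNReal.tsum_mul_left, ← ENNReal.tsum_mul_left]
          congr with n
          simp only [he, hc]
          have : (2 : ℝ≥0∞) ^ (j : ℝ) * 2 ^ ((j + n : ℤ) : ℝ) * 2 ^ (-2 * (j + n : ℤ) * (1 - p⁻¹)) =
              2 ^ (-1 * n : ℝ) * 2 ^ (2 * (j + n : ℤ) * p⁻¹) := by
            rw [← two_rpow_add, ← two_rpow_add, ← two_rpow_add]
            congr 1; push_cast; ring
          calc _ = ((2 : ℝ≥0∞) ^ (j : ℝ) * 2 ^ ((j + n : ℤ) : ℝ) *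
                2 ^ (-2 * (j + n : ℤ) * (1 - p⁻¹))) *
                (192 * rieszConst γ * hardyAverage α⁻¹ f (j + n) ^ α * G1 * B) := by ring
            _ = _ := by rw [this]; ring
  have hsum : ∑' j : ℤ, (2 ^ (j : ℝ) * wenteLevel α β γ f g j) ^ p ≤
      c ^ p * (2 ^ p * (G2 ^ (α * p) * (3 * ∫⁻ x, f x ^ p))) := by
    calc _ ≤ ∑' j : ℤ, c ^ p * (∑' n : ℕ, (2 : ℝ≥0∞) ^ (-1 * n : ℝ) * e (j + n)) ^ p := by
          refine ENNReal.tsum_le_tsum fun j => ?_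
          rw [← ENNReal.mul_rpow_of_nonneg _ _ hp0.le]
          exact ENNReal.rpow_le_rpow (hpt j) hp0.le
      _ ≤ c ^ p * (2 ^ p * ∑' j, e j ^ p) := by
          rw [ENNReal.tsum_mul_left]
          gcongr
          refine (tsum_convolution_rpow_le hp _ e fun n => (n : ℤ)).trans ?_
          rw [tsum_two_rpow_one]
      _ ≤ _ := by
          gcongr
          refine le_trans (le_of_eq ?_) (tsum_hardyAverage_rpow_le hf hα hp0 hαp)
          congr with j
          simp only [he]
          rw [ENNReal.mul_rpow_of_nonneg _ _ hp0.le, ← ENNReal.rpow_mul]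
          congr 2; field_simp
  calc _ ≤ (c ^ p * (2 ^ p * (G2 ^ (α * p) * (3 * ∫⁻ x, f x ^ p)))) ^ p⁻¹ := by gcongr
    _ = c * (2 * (G2 ^ α * (3 ^ p⁻¹ * (∫⁻ x, f x ^ p) ^ p⁻¹))) := by
        have hi : 0 ≤ p⁻¹ := by positivity
        rw [ENNReal.mul_rpow_of_nonneg _ _ hi, ENNReal.mul_rpow_of_nonneg _ _ hi,
          ENNReal.mul_rpow_of_nonneg _ _ hi, ENNReal.mul_rpow_of_nonneg _ _ hi,
          ENNReal.rpow_rpow_inv hp0.ne', ENNReal.rpow_rpow_inv hp0.ne', ENNReal.rpow_mul,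
          ENNReal.rpow_rpow_inv hp0.ne']
    _ ≤ c * (2 * (G2 ^ α * (3 * (∫⁻ x, f x ^ p) ^ p⁻¹))) := by
        gcongr
        conv_rhs => rw [← ENNReal.rpow_one 3]
        exact ENNReal.rpow_le_rpow_of_exponent_le (by norm_num) (inv_le_one_of_one_le₀ hp)
    _ = _ := by rw [hc]; ring

theorem lintegral_Ioi_indicator_rpow_le {p : ℝ} (hp : 1 ≤ p) (a : ℝ≥0∞) :
    ∫⁻ τ in Set.Ioi (0 : ℝ), {τ : ℝ | ENNReal.ofReal τ < a}.indicator
      (fun τ => ENNReal.ofReal τ ^ (p - 1)) τ ≤ a ^ p := by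
  calc _ ≤ ∫⁻ τ in Set.Ioi (0 : ℝ), a ^ (p - 1) *
        {τ : ℝ | ENNReal.ofReal τ < a}.indicator 1 τ := by
        refine lintegral_mono fun τ => ?_
        by_cases h : ENNReal.ofReal τ < a
        · rw [Set.indicator_of_mem (by exact h), Set.indicator_of_mem (by exact h), Pi.one_apply,
            mul_one]
          exact ENNReal.rpow_le_rpow h.le (by linarith)
        · rw [Set.indicator_of_notMem (by exact h)]; exact zero_le
    _ = a ^ (p - 1) * a ^ (1 : ℝ) := by
        rw [lintegral_const_mul _ (measurable_one.indicator
          (measurableSet_lt (by fun_prop) measurable_const)), lintegral_Ioi_indicator_lt,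
          ENNReal.rpow_one]
    _ = _ := by rw [← ENNReal.rpow_add_of_nonneg _ _ (by linarith) zero_le_one, sub_add_cancel]

/-- Dyadic control of the Lorentz functional of `L^{2,p}`. -/
theorem lintegral_lorentz_le {h : ℂ → ℝ≥0∞} {l : ℤ → ℝ≥0∞} {p : ℝ} (hp : 1 ≤ p)
    (hl : ∀ j : ℤ, volume {x | l j < h x} ≤ 512 * 2 ^ (2 * j : ℝ)) :
    (∫⁻ τ in Set.Ioi (0 : ℝ), (ENNReal.ofReal τ * volume {x | ENNReal.ofReal τ < h x} ^ (1 / 2 : ℝ))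
      ^ p / ENNReal.ofReal τ) ^ p⁻¹ ≤ 64 * (∑' j : ℤ, (2 ^ (j : ℝ) * l j) ^ p) ^ p⁻¹ := by
  have hp0 : 0 < p := by linarith
  set M := ∑' j : ℤ, (2 ^ (j : ℝ) * l j) ^ p with hM
  rcases eq_or_ne M ⊤ with hMtop | hMtop
  · rw [hMtop, ENNReal.top_rpow_of_pos (by positivity), ENNReal.mul_top (by norm_num)]
    exact le_top
  have hlM : ∀ j : ℤ, 2 ^ (j : ℝ) * l j ≤ M ^ p⁻¹ := fun j => by
    rw [ENNReal.le_rpow_inv_iff hp0]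
    exact ENNReal.le_tsum (f := fun j : ℤ => (2 ^ (j : ℝ) * l j) ^ p) j
  have htwo : ∀ a : ℝ≥0∞, a ≠ ⊤ → ∃ n : ℕ, a ≤ 2 ^ n := fun a ha => by
    obtain ⟨n, hn⟩ := ENNReal.exists_nat_gt ha
    exact ⟨n, hn.le.trans (by exact_mod_cast Nat.lt_two_pow_self.le)⟩
  have hsqrt : ∀ {V : ℝ≥0∞} {j : ℤ}, V ≤ 512 * 2 ^ (2 * j : ℝ) →
      V ^ (1 / 2 : ℝ) ≤ 32 * 2 ^ (j : ℝ) := by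
    intro V j hV
    calc V ^ (1 / 2 : ℝ) ≤ (32 ^ (2 : ℝ) * 2 ^ (2 * j : ℝ)) ^ (1 / 2 : ℝ) := by
          gcongr
          refine hV.trans ?_
          gcongr
          norm_num
      _ = _ := by
          rw [ENNReal.mul_rpow_of_nonneg _ _ (by norm_num), ← ENNReal.rpow_mul, ← ENNReal.rpow_mul]
          congr 1
          · norm_num
          · congr 1; ring
  have hpt : ∀ τ ∈ Set.Ioi (0 : ℝ),
      (ENNReal.ofReal τ * volume {x | ENNReal.ofReal τ < h x} ^ (1 / 2 : ℝ))
      ^ p / ENNReal.ofReal τ ≤ ∑' j : ℤ, (64 * 2 ^ (j : ℝ)) ^ p *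
        {τ : ℝ | ENNReal.ofReal τ < l j}.indicator (fun τ => ENNReal.ofReal τ ^ (p - 1)) τ := by
    intro τ hτ
    have hτ0 : ENNReal.ofReal τ ≠ 0 := by simpa using hτ
    set V := volume {x | ENNReal.ofReal τ < h x} with hV
    have hVj : ∀ j, l j ≤ ENNReal.ofReal τ → V ≤ 512 * 2 ^ (2 * j : ℝ) := fun j hj =>
      (measure_mono fun x (hx : ENNReal.ofReal τ < h x) => hj.trans_lt hx).trans (hl j)
    have hdiv : (ENNReal.ofReal τ * V ^ (1 / 2 : ℝ)) ^ p / ENNReal.ofReal τ =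
        (V ^ (1 / 2 : ℝ)) ^ p * ENNReal.ofReal τ ^ (p - 1) := by
      rw [ENNReal.mul_rpow_of_nonneg _ _ hp0.le, ENNReal.rpow_sub _ _ hτ0 ENNReal.ofReal_ne_top,
        ENNReal.rpow_one, mul_comm, mul_div_assoc]
    rw [hdiv]
    obtain ⟨j₀, hj₀⟩ : ∃ j, l j ≤ ENNReal.ofReal τ := by
      obtain ⟨n, hn⟩ := htwo (M ^ p⁻¹ / ENNReal.ofReal τ)
        (ENNReal.div_ne_top (ENNReal.rpow_ne_top_of_nonneg (by positivity) hMtop) hτ0)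
      refine ⟨n, ?_⟩
      have h1 := hlM n
      rw [ENNReal.div_le_iff hτ0 ENNReal.ofReal_ne_top] at hn
      have h2 : (2 : ℝ≥0∞) ^ ((n : ℤ) : ℝ) * l n ≤ 2 ^ ((n : ℤ) : ℝ) * ENNReal.ofReal τ := by
        refine h1.trans (hn.trans (le_of_eq ?_))
        simp
      exact (ENNReal.mul_le_mul_iff_right (two_rpow_ne_zero _) (two_rpow_ne_top _)).1 h2
    by_cases hall : ∀ j, l j ≤ ENNReal.ofReal τ → l (j - 1) ≤ ENNReal.ofReal τ
    · have hdown : ∀ n : ℕ, l (j₀ - n) ≤ ENNReal.ofReal τ := by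
        intro n
        induction n with
        | zero => simpa using hj₀
        | succ n ih => simpa [sub_sub] using hall _ ih
      have hV0 : V = 0 := by
        have hlim : Filter.Tendsto (fun n : ℕ => (512 * (2 : ℝ≥0∞) ^ (2 * j₀ : ℝ)) * 4⁻¹ ^ n)
            Filter.atTop (nhds (512 * 2 ^ (2 * j₀ : ℝ) * 0)) :=
          ENNReal.Tendsto.const_mul (ENNReal.tendsto_pow_atTop_nhds_zero_of_lt_one (by simp))
            (Or.inr (ENNReal.mul_ne_top (by norm_num) (two_rpow_ne_top _)))
        rw [mul_zero] at hlim
        refine le_antisymm (ge_of_tendsto' hlim fun n => (hVj _ (hdown n)).trans (le_of_eq ?_))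
          zero_le
        have : (2 * (j₀ - n : ℤ) : ℝ) = 2 * j₀ + -2 * n := by push_cast; ring
        rw [this, two_rpow_add, mul_assoc]
        congr 2
        rw [ENNReal.rpow_mul, ENNReal.rpow_natCast, ENNReal.rpow_neg]
        norm_num
      rw [hV0, ENNReal.zero_rpow_of_pos (by norm_num), ENNReal.zero_rpow_of_pos hp0, zero_mul]
      exact zero_le
    · push Not at hall
      obtain ⟨j, hj1, hj2⟩ := hall
      refine le_trans ?_ (ENNReal.le_tsum (j - 1))
      rw [Set.indicator_of_mem (by exact hj2)]
      gcongr
      refine (hsqrt (hVj j hj1)).trans (le_of_eq ?_)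
      rw [show (64 : ℝ≥0∞) = 32 * 2 ^ (1 : ℝ) by norm_num, mul_assoc, ← two_rpow_add]
      congr 2; push_cast; ring
  rw [ENNReal.rpow_inv_le_iff hp0, ENNReal.mul_rpow_of_nonneg _ _ hp0.le,
    ENNReal.rpow_inv_rpow hp0.ne']
  calc _ ≤ ∫⁻ τ in Set.Ioi (0 : ℝ), ∑' j : ℤ, (64 * 2 ^ (j : ℝ)) ^ p *
        {τ : ℝ | ENNReal.ofReal τ < l j}.indicator (fun τ => ENNReal.ofReal τ ^ (p - 1)) τ :=
        setLIntegral_mono' measurableSet_Ioi hpt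
    _ = ∑' j : ℤ, (64 * 2 ^ (j : ℝ)) ^ p * ∫⁻ τ in Set.Ioi (0 : ℝ),
        {τ : ℝ | ENNReal.ofReal τ < l j}.indicator (fun τ => ENNReal.ofReal τ ^ (p - 1)) τ := by
        have hm : ∀ j, Measurable ({τ : ℝ | ENNReal.ofReal τ < l j}.indicator
            (fun τ => ENNReal.ofReal τ ^ (p - 1))) := fun j =>
          Measurable.indicator (by fun_prop) (measurableSet_lt (by fun_prop) measurable_const)
        rw [lintegral_tsum fun j => ((hm j).const_mul _).aemeasurable]
        congr with j
        rw [lintegral_const_mul _ (hm j)]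
    _ ≤ ∑' j : ℤ, (64 * 2 ^ (j : ℝ)) ^ p * l j ^ p := by
        gcongr with j; exact lintegral_Ioi_indicator_rpow_le hp _
    _ = 64 ^ p * M := by
        rw [hM, ← ENNReal.tsum_mul_left]
        congr with j
        rw [← ENNReal.mul_rpow_of_nonneg _ _ hp0.le, ← ENNReal.mul_rpow_of_nonneg _ _ hp0.le,
          mul_assoc]

theorem dyadicLevel_le_of_weak {g : ℂ → ℝ≥0∞} {θ : ℝ} (hθ : 0 ≤ θ) {B : ℝ≥0∞}
    (hB : ∀ t : ℝ≥0, t * volume {x | (t : ℝ≥0∞) < g x} ^ θ ≤ B) (k : ℤ) :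
    dyadicLevel g k ≤ B * 2 ^ (-2 * k * θ) := by
  refine le_of_forall_gt_imp_ge_of_dense fun l hl => ?_
  rcases eq_or_ne l ⊤ with rfl | htop
  · exact le_top
  lift l to ℝ≥0 using htop
  refine sInf_le ?_
  by_contra hV
  have hV : 2 ^ (2 * k : ℝ) < volume {x | (l : ℝ≥0∞) < g x} := not_le.1 hV
  refine hl.not_ge ?_
  calc (l : ℝ≥0∞) = (l * (2 ^ (2 * k : ℝ)) ^ θ) * 2 ^ (-2 * k * θ) := by
        rw [mul_assoc, ← ENNReal.rpow_mul, ← two_rpow_add]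
        ring_nf; simp
    _ ≤ B * 2 ^ (-2 * k * θ) := by
        gcongr
        refine le_trans ?_ (hB l)
        gcongr

/-- Bilinear estimate `L^p × L^{p',∞} → L^{2,p}` for `wentePotential`, uniformly in `p ∈ [2, q]`. -/
theorem exists_lintegral_lorentz_wentePotential_le {q : ℝ} (hq : 2 < q) :
    ∃ C : ℝ≥0∞, C ≠ ⊤ ∧ ∀ p ∈ Set.Icc 2 q, ∀ (D : ℝ≥0∞) (f g : ℂ → ℝ≥0∞),
      Measurable f → Measurable g → ∀ B : ℝ≥0∞,
      (∀ t : ℝ≥0, t * volume {x | (t : ℝ≥0∞) < g x} ^ (1 - p⁻¹) ≤ B) →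
      (∫⁻ τ in Set.Ioi (0 : ℝ), (ENNReal.ofReal τ *
        volume {x | ENNReal.ofReal τ < D * wentePotential f g x} ^ (1 / 2 : ℝ))
        ^ p / ENNReal.ofReal τ) ^ p⁻¹ ≤ C * D * (B * (∫⁻ x, f x ^ p) ^ p⁻¹) := by
  have hq0 : 0 < q := by linarith
  set ε := (2 * q)⁻¹ with hε
  have hε0 : 0 < ε := by positivity
  have hε4 : ε < 1 / 4 := by
    rw [hε, inv_lt_comm₀ (by positivity) (by norm_num)]; linarith
  have hqε : q⁻¹ = 2 * ε := by rw [hε]; field_simp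
  set α := 1 / 2 + ε / 2 with hα
  set β := 1 - ε with hβ
  have hα0 : 0 < α := by linarith
  have hβ0 : 0 < β := by linarith
  set a := 2 - α⁻¹ with ha
  have ha0 : 0 < a := by
    rw [ha, sub_pos, inv_lt_comm₀ hα0 two_pos]; linarith
  set b := 2 - 2 * (1 - q⁻¹) * β⁻¹ with hb
  have hb0 : 0 < b := by
    rw [hb, sub_pos, ← div_eq_mul_inv, div_lt_iff₀ hβ0, hqε]; linarith
  refine ⟨64 * (1152 * rieszConst α * (∑' n : ℕ, (2 : ℝ≥0∞) ^ (-b * n)) ^ β *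
    (∑' n : ℕ, (2 : ℝ≥0∞) ^ (-a * n)) ^ α), ?_, ?_⟩
  · refine ENNReal.mul_ne_top (by norm_num) (ENNReal.mul_ne_top (ENNReal.mul_ne_top
      (ENNReal.mul_ne_top (by norm_num) (rieszConst_ne_top (by linarith))) ?_) ?_)
    · exact ENNReal.rpow_ne_top_of_nonneg hβ0.le (tsum_two_rpow_ne_top hb0)
    · exact ENNReal.rpow_ne_top_of_nonneg hα0.le (tsum_two_rpow_ne_top ha0)
  rintro p ⟨hp2, hpq⟩ D f g hf hg B hB
  have hp0 : 0 < p := by linarith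
  have hp1 : p⁻¹ ≤ 1 := inv_le_one_of_one_le₀ (by linarith)
  have hαp : 1 ≤ α * p := by nlinarith
  have hbound := tsum_wenteLevel_rpow_le (γ := α) hf hα0 hβ0 (by linarith) hαp
    (dyadicLevel_le_of_weak (sub_nonneg.2 hp1) hB)
  refine (lintegral_lorentz_le (l := fun j => D * wenteLevel α β α f g j) (by linarith)
    fun j => ?_).trans ?_
  · refine (measure_mono fun x hx => ?_).trans (volume_wenteLevel_lt_le hf hg hα0 hβ0 hα0
      (by linarith) (by linarith) (by linarith) (by ring) j)
    have hx : D * wenteLevel α β α f g j < D * wentePotential f g x := hx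
    exact lt_of_mul_lt_mul_left' hx
  · have hD : ∑' j : ℤ, (2 ^ (j : ℝ) * (D * wenteLevel α β α f g j)) ^ p =
        D ^ p * ∑' j : ℤ, (2 ^ (j : ℝ) * wenteLevel α β α f g j) ^ p := by
      rw [← ENNReal.tsum_mul_left]
      congr with j
      rw [← ENNReal.mul_rpow_of_nonneg _ _ hp0.le, mul_left_comm]
    rw [hD, ENNReal.mul_rpow_of_nonneg _ _ (by positivity), ENNReal.rpow_rpow_inv hp0.ne']
    calc _ ≤ 64 * (D * _) := mul_le_mul_right (mul_le_mul_right hbound _) _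
      _ ≤ 64 * (D * (1152 * rieszConst α * (∑' n : ℕ, (2 : ℝ≥0∞) ^ (-b * n)) ^ β *
        (∑' n : ℕ, (2 : ℝ≥0∞) ^ (-a * n)) ^ α * (B * (∫⁻ x, f x ^ p) ^ p⁻¹))) := by
          gcongr 64 * (D * (1152 * rieszConst α * ?_ ^ β * ?_ ^ α * _))
          · refine tsum_two_rpow_anti ?_
            rw [hb]
            gcongr
          · refine tsum_two_rpow_anti ?_
            rw [ha, mul_inv]
            have : p⁻¹ ≤ 2⁻¹ := by gcongr
            have : α⁻¹ * p⁻¹ ≤ α⁻¹ * 2⁻¹ := by gcongr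
            linarith
      _ = _ := by ring

theorem lintegral_comp_smul_complex (G : ℂ → ℝ≥0∞) (hG : Measurable G) {t : ℝ} (ht : 0 < t) :
    ∫⁻ v, G (t • v) = ENNReal.ofReal (t⁻¹ ^ 2) * ∫⁻ w, G w := by
  have h := Measure.map_addHaar_smul (volume : Measure ℂ) ht.ne'
  rw [Complex.finrank_real_complex] at h
  calc ∫⁻ v, G (t • v) = ∫⁻ w, G w ∂(Measure.map (t • ·) volume) :=
        (lintegral_map hG (measurable_const_smul t)).symm
    _ = _ := by
        rw [h, lintegral_smul_measure, abs_of_nonneg (by positivity), inv_pow]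
        rfl

theorem lintegral_Ici_inv_pow_three_le {c : ℝ} (hc : 0 < c) :
    ∫⁻ t in Set.Ici c, ENNReal.ofReal (t⁻¹ ^ 3) ≤ ENNReal.ofReal (c⁻¹ ^ 2) := by
  rw [setLIntegral_congr Ioi_ae_eq_Ici.symm]
  have hEq : Set.EqOn (fun t : ℝ => ENNReal.ofReal (t⁻¹ ^ 3))
      (fun t : ℝ => ENNReal.ofReal (t ^ (-3 : ℝ))) (Set.Ioi c) := by
    intro t ht
    have h0 : 0 < t := hc.trans ht
    simp only
    rw [Real.rpow_neg h0.le, inv_pow]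
    norm_cast
  rw [setLIntegral_congr_fun measurableSet_Ioi hEq,
    ← ofReal_integral_eq_lintegral_ofReal (integrableOn_Ioi_rpow_of_lt (by norm_num) hc),
    integral_Ioi_rpow_of_lt (by norm_num) hc]
  · apply ENNReal.ofReal_le_ofReal
    have : c ^ (-3 + 1 : ℝ) = c⁻¹ ^ 2 := by
      rw [show (-3 + 1 : ℝ) = -(2 : ℕ) by norm_num, Real.rpow_neg hc.le, Real.rpow_natCast, inv_pow]
    rw [this]
    have : 0 ≤ c⁻¹ ^ 2 := by positivity
    rw [show (-3 + 1 : ℝ) = -2 by norm_num, neg_div_neg_eq]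
    linarith
  · filter_upwards [ae_restrict_mem measurableSet_Ioi] with t ht
    exact Real.rpow_nonneg (hc.trans ht).le _

theorem lintegral_closedBall_lintegral_smul_le (H : ℂ → ℝ≥0∞) (hH : Measurable H) {ρ : ℝ}
    (hρ : 0 < ρ) :
    ∫⁻ v in closedBall (0 : ℂ) ρ, ∫⁻ t in Set.Ioc (0 : ℝ) 1, H (t • v) * ‖v‖ₑ ≤
      ENNReal.ofReal (ρ ^ 2) * ∫⁻ w, H w * ‖w‖ₑ⁻¹ := by
  set F : ℝ → ℂ → ℝ≥0∞ := fun t w =>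
    if ‖w‖ ≤ ρ * t then H w * ‖w‖ₑ * ENNReal.ofReal t⁻¹ else 0 with hF
  have hFm : Measurable (Function.uncurry F) := by
    refine Measurable.ite (measurableSet_le (by fun_prop) (by fun_prop)) ?_ measurable_const
    exact ((hH.comp measurable_snd).mul (by fun_prop)).mul
      (ENNReal.measurable_ofReal.comp (by fun_prop))
  calc ∫⁻ v in closedBall (0 : ℂ) ρ, ∫⁻ t in Set.Ioc (0 : ℝ) 1, H (t • v) * ‖v‖ₑ
      = ∫⁻ t in Set.Ioc (0 : ℝ) 1, ∫⁻ v in closedBall (0 : ℂ) ρ, H (t • v) * ‖v‖ₑ := by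
        refine lintegral_lintegral_swap (Measurable.aemeasurable ?_)
        exact (hH.comp (by fun_prop : Measurable fun z : ℂ × ℝ => z.2 • z.1)).mul (by fun_prop)
    _ = ∫⁻ t in Set.Ioc (0 : ℝ) 1, ∫⁻ w, ENNReal.ofReal (t⁻¹ ^ 2) * F t w := by
        refine setLIntegral_congr_fun measurableSet_Ioc fun t ht => ?_
        have ht0 : 0 < t := ht.1
        have hFt : Measurable (F t) := hFm.comp measurable_prodMk_left
        rw [lintegral_const_mul _ hFt, ← lintegral_comp_smul_complex _ hFt ht0,
          ← lintegral_indicator measurableSet_closedBall]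
        congr 1 with v
        simp only [Set.indicator, mem_closedBall_zero_iff, hF]
        have h1 : ‖t • v‖ ≤ ρ * t ↔ ‖v‖ ≤ ρ := by
          rw [norm_smul, Real.norm_of_nonneg ht0.le, mul_comm]
          exact mul_le_mul_iff_left₀ ht0
        simp only [h1]
        split_ifs
        · rw [mul_assoc, enorm_smul, Real.enorm_of_nonneg ht0.le, mul_comm (ENNReal.ofReal t),
            mul_assoc ‖v‖ₑ, ← ENNReal.ofReal_mul ht0.le, mul_inv_cancel₀ ht0.ne']
          simp
        · rfl
    _ = ∫⁻ w, ∫⁻ t in Set.Ioc (0 : ℝ) 1, ENNReal.ofReal (t⁻¹ ^ 2) * F t w := by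
        refine lintegral_lintegral_swap (Measurable.aemeasurable ?_)
        exact (ENNReal.measurable_ofReal.comp (by fun_prop)).mul hFm
    _ ≤ ∫⁻ w, ENNReal.ofReal (ρ ^ 2) * (H w * ‖w‖ₑ⁻¹) := by
        refine lintegral_mono fun w => ?_
        by_cases hw : w = 0
        · have : ∀ t, F t w = 0 := by simp [hF, hw]
          simp [this]
        have hw0 : 0 < ‖w‖ := norm_pos_iff.2 hw
        have hc : 0 < ‖w‖ / ρ := by positivity
        calc ∫⁻ t in Set.Ioc (0 : ℝ) 1, ENNReal.ofReal (t⁻¹ ^ 2) * F t w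
            ≤ ∫⁻ t in Set.Ioc (0 : ℝ) 1, (Set.Ici (‖w‖ / ρ)).indicator
                (fun t => H w * ‖w‖ₑ * ENNReal.ofReal (t⁻¹ ^ 3)) t := by
              refine setLIntegral_mono_ae' measurableSet_Ioc (Filter.Eventually.of_forall ?_)
              intro t ht
              have ht0 : 0 < t := ht.1
              simp only [hF, Set.indicator, Set.mem_Ici, div_le_iff₀' hρ]
              split_ifs
              · rw [mul_left_comm, ← ENNReal.ofReal_mul (by positivity), ← pow_succ]
              · simp
          _ ≤ ∫⁻ t, (Set.Ici (‖w‖ / ρ)).indicator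
                (fun t => H w * ‖w‖ₑ * ENNReal.ofReal (t⁻¹ ^ 3)) t := setLIntegral_le_lintegral _ _
          _ = H w * ‖w‖ₑ * ∫⁻ t in Set.Ici (‖w‖ / ρ), ENNReal.ofReal (t⁻¹ ^ 3) := by
              rw [lintegral_indicator measurableSet_Ici, lintegral_const_mul]
              exact ENNReal.measurable_ofReal.comp (by fun_prop)
          _ ≤ H w * ‖w‖ₑ * ENNReal.ofReal ((‖w‖ / ρ)⁻¹ ^ 2) :=
              mul_le_mul_right (lintegral_Ici_inv_pow_three_le hc) _
          _ = ENNReal.ofReal (ρ ^ 2) * (H w * ‖w‖ₑ⁻¹) := by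
              rw [mul_left_comm, mul_assoc]
              congr 1
              rw [← ofReal_norm, ← ENNReal.ofReal_inv_of_pos hw0, ← ENNReal.ofReal_mul (by positivity),
                ← ENNReal.ofReal_mul (by positivity)]
              congr 1
              field_simp
    _ = _ := lintegral_const_mul' _ _ ENNReal.ofReal_ne_top

theorem lintegral_enorm_sub_le {b : ℂ → ℝ} (hb : ContDiff ℝ 1 b) {Ω : Set ℂ} (hΩ : Convex ℝ Ω)
    (hΩm : MeasurableSet Ω) {x : ℂ} {R : ℝ} (hR : 0 < R) (hΩR : Ω ⊆ closedBall x R) {y : ℂ}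
    (hy : y ∈ Ω) :
    ∫⁻ z in Ω, ‖b y - b z‖ₑ ≤
      ENNReal.ofReal ((2 * R) ^ 2) * ∫⁻ w in Ω, ‖fderiv ℝ b w‖ₑ * ‖y - w‖ₑ⁻¹ := by
  set G : ℂ → ℝ≥0∞ := Ω.indicator fun w => ‖fderiv ℝ b w‖ₑ with hG
  have hGm : Measurable G :=
    (hb.continuous_fderiv one_ne_zero).enorm.measurable.indicator hΩm
  have key : ∀ z ∈ Ω, ‖b y - b z‖ₑ ≤ ∫⁻ t in Set.Ioc (0 : ℝ) 1, G (y + t • (z - y)) * ‖z - y‖ₑ := by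
    intro z hz
    have hl : ∀ t : ℝ, HasDerivAt (fun t : ℝ => y + t • (z - y)) (z - y) t := fun t => by
      simpa using ((hasDerivAt_id t).smul_const (z - y)).const_add y
    have hd : ∀ t : ℝ, HasDerivAt (fun t : ℝ => b (y + t • (z - y)))
        (fderiv ℝ b (y + t • (z - y)) (z - y)) t := fun t =>
      ((hb.differentiable one_ne_zero _).hasFDerivAt).comp_hasDerivAt t (hl t)
    have h1 := enorm_sub_le_lintegral_deriv_of_contDiffOn_Icc
      (f := fun t : ℝ => b (y + t • (z - y))) (a := 0) (b := 1)
      (ContDiff.contDiffOn (hb.comp (by fun_prop))) zero_le_one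
    rw [setLIntegral_congr Ioc_ae_eq_Icc.symm] at h1
    simp only [zero_smul, add_zero, one_smul, add_sub_cancel] at h1
    rw [← enorm_neg, neg_sub]
    refine h1.trans (setLIntegral_mono_ae' measurableSet_Ioc (Filter.Eventually.of_forall ?_))
    intro t ht
    have hmem : y + t • (z - y) ∈ Ω := hΩ.add_smul_sub_mem hy hz ⟨ht.1.le, ht.2⟩
    rw [(hd t).deriv, hG, Set.indicator_of_mem hmem]
    exact ContinuousLinearMap.le_opENorm _ _
  calc ∫⁻ z in Ω, ‖b y - b z‖ₑ
      ≤ ∫⁻ z in Ω, ∫⁻ t in Set.Ioc (0 : ℝ) 1, G (y + t • (z - y)) * ‖z - y‖ₑ :=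
        setLIntegral_mono_ae' hΩm (Filter.Eventually.of_forall key)
    _ ≤ ∫⁻ z in closedBall y (2 * R),
          ∫⁻ t in Set.Ioc (0 : ℝ) 1, G (y + t • (z - y)) * ‖z - y‖ₑ := by
        refine lintegral_mono_set fun z hz => ?_
        have h1 := mem_closedBall.1 (hΩR hz)
        have h2 := mem_closedBall.1 (hΩR hy)
        have := dist_triangle_right z y x
        exact mem_closedBall.2 (by linarith)
    _ = ∫⁻ v in closedBall 0 (2 * R), ∫⁻ t in Set.Ioc (0 : ℝ) 1, G (y + t • v) * ‖v‖ₑ := by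
        rw [← lintegral_indicator measurableSet_closedBall,
          ← lintegral_indicator measurableSet_closedBall,
          ← lintegral_add_left_eq_self _ y]
        congr 1 with z
        simp only [Set.indicator, mem_closedBall, dist_eq_norm, add_sub_cancel_left, sub_zero]
    _ ≤ ENNReal.ofReal ((2 * R) ^ 2) * ∫⁻ w, G (y + w) * ‖w‖ₑ⁻¹ :=
        lintegral_closedBall_lintegral_smul_le (fun v => G (y + v))
          (hGm.comp (measurable_const_add y)) (by positivity)
    _ = _ := by
        congr 1
        rw [← lintegral_indicator hΩm, ← lintegral_add_left_eq_self (Ω.indicator _) y]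
        congr 1 with w
        simp only [hG, Set.indicator, sub_add_cancel_left, enorm_neg]
        split_ifs <;> simp

theorem integral_smul_fderiv_of_hasCompactSupport {𝕜 F : Type*} [NormedField 𝕜] [NormedAlgebra ℝ 𝕜]
    [NormedAddCommGroup F] [NormedSpace ℝ F] [NormedSpace 𝕜 F] [IsScalarTower ℝ 𝕜 F]
    {f : ℂ → 𝕜} {g : ℂ → F} (hf : ContDiff ℝ 1 f) (hg : ContDiff ℝ 1 g)
    (hs : HasCompactSupport g) (v : ℂ) :
    ∫ y, f y • fderiv ℝ g y v = -∫ y, fderiv ℝ f y v • g y := by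
  have hf' : Continuous fun y => fderiv ℝ f y v :=
    (hf.continuous_fderiv one_ne_zero).clm_apply continuous_const
  have hg' : Continuous fun y => fderiv ℝ g y v :=
    (hg.continuous_fderiv one_ne_zero).clm_apply continuous_const
  have hs' : HasCompactSupport fun y => fderiv ℝ g y v := hs.fderiv_apply ℝ v
  exact integral_smul_fderiv_eq_neg_fderiv_smul_of_integrable
    ((hf'.smul hg.continuous).integrable_of_hasCompactSupport hs.smul_left)
    ((hf.continuous.smul hg').integrable_of_hasCompactSupport hs'.smul_left)
    ((hf.continuous.smul hg.continuous).integrable_of_hasCompactSupport hs.smul_left)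
    (fun y _ => hf.differentiable one_ne_zero y) (fun y _ => hg.differentiable one_ne_zero y)

/-- The Jacobian determinant `∂₁a ∂₂b - ∂₂a ∂₁b`. -/
def jacobian {F : Type*} [NormedAddCommGroup F] [NormedSpace ℝ F] (a : ℂ → ℝ) (b : ℂ → F)
    (y : ℂ) : F :=
  fderiv ℝ a y 1 • fderiv ℝ b y Complex.I - fderiv ℝ a y Complex.I • fderiv ℝ b y 1

theorem contDiff_fderiv_apply {F : Type*} [NormedAddCommGroup F] [NormedSpace ℝ F] {a : ℂ → F}
    (ha : ContDiff ℝ 2 a) (v : ℂ) : ContDiff ℝ 1 fun y => fderiv ℝ a y v :=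
  (ha.fderiv_right (m := 1) (by norm_num)).clm_apply contDiff_const

theorem fderiv_fderiv_apply_comm {F : Type*} [NormedAddCommGroup F] [NormedSpace ℝ F] {a : ℂ → F}
    (ha : ContDiff ℝ 2 a) (v w y : ℂ) :
    fderiv ℝ (fun y => fderiv ℝ a y v) y w = fderiv ℝ (fun y => fderiv ℝ a y w) y v := by
  have hd : DifferentiableAt ℝ (fderiv ℝ a) y :=
    ((ha.fderiv_right (m := 1) (by norm_num)).differentiable one_ne_zero) y
  rw [fderiv_clm_apply hd (differentiableAt_const v), fderiv_clm_apply hd (differentiableAt_const w)]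
  simpa using (ha.contDiffAt.isSymmSndFDerivAt (x := y) (by simp)).eq w v

theorem continuous_jacobian {F : Type*} [NormedAddCommGroup F] [NormedSpace ℝ F] {a : ℂ → ℝ}
    {b : ℂ → F} (ha : ContDiff ℝ 1 a) (hb : ContDiff ℝ 1 b) : Continuous (jacobian a b) := by
  have h1 := ha.continuous_fderiv one_ne_zero
  have h2 := hb.continuous_fderiv one_ne_zero
  unfold jacobian
  fun_prop

theorem enorm_jacobian_le {F : Type*} [NormedAddCommGroup F] [NormedSpace ℝ F] (a : ℂ → ℝ)
    (b : ℂ → F) (y : ℂ) : ‖jacobian a b y‖ₑ ≤ 2 * ‖fderiv ℝ a y‖ₑ * ‖fderiv ℝ b y‖ₑ := by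
  have h : ∀ v w : ℂ, ‖v‖ₑ = 1 → ‖w‖ₑ = 1 →
      ‖fderiv ℝ a y v • fderiv ℝ b y w‖ₑ ≤ ‖fderiv ℝ a y‖ₑ * ‖fderiv ℝ b y‖ₑ := by
    intro v w hv hw
    rw [enorm_smul]
    refine mul_le_mul' ?_ ?_
    · simpa [hv] using (fderiv ℝ a y).le_opENorm v
    · simpa [hw] using (fderiv ℝ b y).le_opENorm w
  have hI : ‖Complex.I‖ₑ = 1 := by simp [← ofReal_norm]
  calc ‖jacobian a b y‖ₑ ≤ _ + _ := enorm_sub_le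
    _ ≤ ‖fderiv ℝ a y‖ₑ * ‖fderiv ℝ b y‖ₑ + ‖fderiv ℝ a y‖ₑ * ‖fderiv ℝ b y‖ₑ :=
        add_le_add (h _ _ (by simp) hI) (h _ _ hI (by simp))
    _ = _ := by rw [← two_mul, mul_assoc]

theorem integral_jacobian_smul {F : Type*} [NormedAddCommGroup F] [NormedSpace ℝ F]
    {a b : ℂ → ℝ} {ψ : ℂ → F}
    (ha : ContDiff ℝ 2 a) (hb : ContDiff ℝ 2 b) (hψ : ContDiff ℝ 1 ψ) (hs : HasCompactSupport ψ)
    (c : ℝ) : ∫ y, jacobian a b y • ψ y = -∫ y, (b y - c) • jacobian a ψ y := by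
  have hA : ∀ v, ContDiff ℝ 1 fun y => (b y - c) * fderiv ℝ a y v := fun v =>
    ((hb.of_le (by norm_num)).sub contDiff_const).mul (contDiff_fderiv_apply ha v)
  have hAd : ∀ v w y, fderiv ℝ (fun y => (b y - c) * fderiv ℝ a y v) y w =
      (b y - c) * fderiv ℝ (fun y => fderiv ℝ a y v) y w + fderiv ℝ a y v * fderiv ℝ b y w := by
    intro v w y
    rw [fderiv_fun_mul (((hb.differentiable two_ne_zero) y).sub_const c)
      ((contDiff_fderiv_apply ha v).differentiable one_ne_zero y), fderiv_sub_const]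
    simp
  have hψ' : ∀ w, Continuous fun y => fderiv ℝ ψ y w := fun w =>
    (hψ.continuous_fderiv one_ne_zero).clm_apply continuous_const
  have hinteg : ∀ v w, Integrable fun y => ((b y - c) * fderiv ℝ a y v) • fderiv ℝ ψ y w :=
    fun v w => ((hA v).continuous.smul (hψ' w)).integrable_of_hasCompactSupport
      (hs.fderiv_apply ℝ w).smul_left
  have hinteg' : ∀ v w, Integrable fun y =>
      fderiv ℝ (fun y => (b y - c) * fderiv ℝ a y v) y w • ψ y := fun v w =>
    ((((hA v).continuous_fderiv one_ne_zero).clm_apply continuous_const).smul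
      hψ.continuous).integrable_of_hasCompactSupport hs.smul_left
  have h1 := integral_smul_fderiv_of_hasCompactSupport (hA 1) hψ hs Complex.I
  have h2 := integral_smul_fderiv_of_hasCompactSupport (hA Complex.I) hψ hs 1
  have h3 : ∫ y, (b y - c) • jacobian a ψ y = (∫ y, ((b y - c) * fderiv ℝ a y 1) •
      fderiv ℝ ψ y Complex.I) - ∫ y, ((b y - c) * fderiv ℝ a y Complex.I) • fderiv ℝ ψ y 1 := by
    rw [← integral_sub (hinteg _ _) (hinteg _ _)]
    congr 1 with y
    simp only [jacobian, smul_sub, mul_smul]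
  rw [h3, h1, h2, neg_sub_neg, ← integral_sub (hinteg' _ _) (hinteg' _ _), ← integral_neg]
  congr 1 with y
  rw [hAd, hAd, fderiv_fderiv_apply_comm ha, ← sub_smul, ← neg_smul]
  congr 1
  simp only [jacobian, smul_eq_mul]
  ring

theorem enorm_integral_jacobian_smul_le {a b : ℂ → ℝ} {ψ : ℂ → ℂ} (ha : ContDiff ℝ 2 a)
    (hb : ContDiff ℝ 2 b) (hψ : ContDiff ℝ 1 ψ) {x : ℂ} {ρ R L : ℝ} (hx : ‖x‖ ≤ ρ) (hR : 0 < R)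
    (hRρ : R ≤ 16 * ρ) (hs : tsupport ψ ⊆ closedBall 0 ρ ∩ closedBall x R)
    (hL : ∀ y, ‖fderiv ℝ ψ y‖ ≤ L) :
    ‖∫ y, jacobian a b y • ψ y‖ₑ ≤ 2048 * ENNReal.ofReal L *
      ∫⁻ y in closedBall 0 ρ ∩ closedBall x R, ∫⁻ w in closedBall 0 ρ ∩ closedBall x R,
        ‖fderiv ℝ a y‖ₑ * ‖fderiv ℝ b w‖ₑ * ‖y - w‖ₑ⁻¹ := by
  set Ω : Set ℂ := closedBall 0 ρ ∩ closedBall x R with hΩ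
  have hΩm : MeasurableSet Ω := measurableSet_closedBall.inter measurableSet_closedBall
  have hΩc : Convex ℝ Ω := (convex_closedBall _ _).inter (convex_closedBall _ _)
  have hcs : HasCompactSupport ψ := (isCompact_closedBall (0 : ℂ) ρ).of_isClosed_subset
    (isClosed_tsupport ψ) (hs.trans Set.inter_subset_left)
  have hρ : 0 < ρ := by linarith
  set s : ℝ := R / (16 * ρ) with hsd
  have hs0 : 0 ≤ s := by positivity
  have hs1 : s ≤ 1 := (div_le_one (by positivity)).2 hRρ
  have hsρ : s * ρ = R / 16 := by rw [hsd]; field_simp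
  set B : Set ℂ := closedBall ((1 - s) • x) (R / 16) with hB
  have hBΩ : B ⊆ Ω := by
    intro z hz
    rw [hB, mem_closedBall, dist_eq_norm] at hz
    have e1 : ‖(1 - s) • x‖ ≤ (1 - s) * ρ := by
      rw [norm_smul, Real.norm_of_nonneg (by linarith)]
      exact mul_le_mul_of_nonneg_left hx (by linarith)
    have e2 : ‖s • x‖ ≤ s * ρ := by
      rw [norm_smul, Real.norm_of_nonneg hs0]
      exact mul_le_mul_of_nonneg_left hx hs0
    constructor
    · rw [mem_closedBall_zero_iff]
      have : ‖z‖ ≤ ‖z - (1 - s) • x‖ + ‖(1 - s) • x‖ := by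
        simpa using norm_add_le (z - (1 - s) • x) ((1 - s) • x)
      linarith
    · rw [mem_closedBall, dist_eq_norm]
      have : ‖z - x‖ ≤ ‖z - (1 - s) • x‖ + ‖s • x‖ := by
        have h := norm_sub_le (z - (1 - s) • x) (s • x)
        rwa [sub_sub, ← add_smul, sub_add_cancel, one_smul] at h
      linarith
  have hvol : ENNReal.ofReal (R ^ 2) ≤ 256 * volume B := by
    rw [hB, Complex.volume_closedBall, ← ENNReal.ofReal_pow (by positivity)]
    have h1 : (1 : ℝ≥0∞) ≤ (NNReal.pi : ℝ≥0∞) := by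
      have : (1 : ℝ≥0) ≤ NNReal.pi := by
        rw [← NNReal.coe_le_coe, NNReal.coe_real_pi]
        push_cast
        linarith [Real.pi_gt_three]
      exact_mod_cast this
    calc ENNReal.ofReal (R ^ 2) = 256 * (ENNReal.ofReal ((R / 16) ^ 2) * 1) := by
          rw [show (256 : ℝ≥0∞) = ENNReal.ofReal 256 by simp, mul_one,
            ← ENNReal.ofReal_mul (by norm_num)]
          congr 1
          ring
      _ ≤ _ := by gcongr
  have hbc : Continuous b := hb.continuous
  have hac : Continuous fun y => ‖fderiv ℝ a y‖ₑ := (ha.continuous_fderiv two_ne_zero).enorm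
  have hpt : ∀ z y, ‖(b y - b z) • jacobian a ψ y‖ₑ ≤
      Ω.indicator (fun y => 2 * ENNReal.ofReal L * (‖fderiv ℝ a y‖ₑ * ‖b y - b z‖ₑ)) y := by
    intro z y
    by_cases hy : y ∈ Ω
    · rw [Set.indicator_of_mem hy, enorm_smul]
      have h2 : ‖fderiv ℝ ψ y‖ₑ ≤ ENNReal.ofReal L := by
        rw [← ofReal_norm]
        exact ENNReal.ofReal_le_ofReal (hL y)
      calc ‖b y - b z‖ₑ * ‖jacobian a ψ y‖ₑ
          ≤ ‖b y - b z‖ₑ * (2 * ‖fderiv ℝ a y‖ₑ * ENNReal.ofReal L) := by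
            gcongr
            exact (enorm_jacobian_le a ψ y).trans (by gcongr)
        _ = _ := by ring
    · have h0 : fderiv ℝ ψ y = 0 := by
        by_contra h
        exact hy (hs (support_fderiv_subset ℝ h))
      simp [jacobian, h0]
  have hmain : volume B * ‖∫ y, jacobian a b y • ψ y‖ₑ ≤
      2 * ENNReal.ofReal L * (ENNReal.ofReal ((2 * R) ^ 2) * ∫⁻ y in Ω, ∫⁻ w in Ω,
        ‖fderiv ℝ a y‖ₑ * ‖fderiv ℝ b w‖ₑ * ‖y - w‖ₑ⁻¹) := by
    calc volume B * ‖∫ y, jacobian a b y • ψ y‖ₑ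
        = ∫⁻ z in B, ‖∫ y, jacobian a b y • ψ y‖ₑ := by
          rw [setLIntegral_const, mul_comm]
      _ ≤ ∫⁻ z in B, ∫⁻ y in Ω, 2 * ENNReal.ofReal L * (‖fderiv ℝ a y‖ₑ * ‖b y - b z‖ₑ) := by
          refine lintegral_mono fun z => ?_
          rw [integral_jacobian_smul ha hb hψ hcs (b z), enorm_neg, ← lintegral_indicator hΩm]
          exact (enorm_integral_le_lintegral_enorm _).trans (lintegral_mono (hpt z))
      _ = ∫⁻ y in Ω, ∫⁻ z in B, 2 * ENNReal.ofReal L * (‖fderiv ℝ a y‖ₑ * ‖b y - b z‖ₑ) := by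
          refine lintegral_lintegral_swap (Measurable.aemeasurable ?_)
          have h1 : Measurable fun q : ℂ × ℂ => ‖fderiv ℝ a q.2‖ₑ :=
            hac.measurable.comp measurable_snd
          have h2 : Measurable fun q : ℂ × ℂ => ‖b q.2 - b q.1‖ₑ :=
            ((hbc.comp continuous_snd).sub (hbc.comp continuous_fst)).enorm.measurable
          exact (h1.mul h2).const_mul _
      _ ≤ ∫⁻ y in Ω, 2 * ENNReal.ofReal L * (ENNReal.ofReal ((2 * R) ^ 2) * ∫⁻ w in Ω,
            ‖fderiv ℝ a y‖ₑ * ‖fderiv ℝ b w‖ₑ * ‖y - w‖ₑ⁻¹) := by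
          refine setLIntegral_mono_ae' hΩm (Filter.Eventually.of_forall fun y hy => ?_)
          have hbm : Measurable fun z => ‖b y - b z‖ₑ :=
            (continuous_const.sub hbc).enorm.measurable
          rw [lintegral_const_mul _ (hbm.const_mul _), lintegral_const_mul _ hbm]
          refine mul_le_mul_right ?_ _
          calc ‖fderiv ℝ a y‖ₑ * ∫⁻ z in B, ‖b y - b z‖ₑ
              ≤ ‖fderiv ℝ a y‖ₑ * (ENNReal.ofReal ((2 * R) ^ 2) *
                  ∫⁻ w in Ω, ‖fderiv ℝ b w‖ₑ * ‖y - w‖ₑ⁻¹) :=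
                mul_le_mul_right ((lintegral_mono_set hBΩ).trans (lintegral_enorm_sub_le
                  (hb.of_le (by norm_num)) hΩc hΩm hR Set.inter_subset_right hy)) _
            _ = _ := by
                rw [mul_left_comm, ← lintegral_const_mul']
                · simp only [mul_assoc]
                · exact enorm_ne_top
      _ = _ := by
          rw [lintegral_const_mul', lintegral_const_mul']
          · exact ENNReal.ofReal_ne_top
          · exact ENNReal.mul_ne_top (by simp) ENNReal.ofReal_ne_top
  have hR2 : ENNReal.ofReal (R ^ 2) ≠ 0 := by
    rw [Ne, ENNReal.ofReal_eq_zero, not_le]; positivity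
  rw [← ENNReal.mul_le_mul_iff_right hR2 ENNReal.ofReal_ne_top]
  set J := ∫⁻ y in Ω, ∫⁻ w in Ω, ‖fderiv ℝ a y‖ₑ * ‖fderiv ℝ b w‖ₑ * ‖y - w‖ₑ⁻¹
  calc ENNReal.ofReal (R ^ 2) * ‖∫ y, jacobian a b y • ψ y‖ₑ
      ≤ 256 * volume B * ‖∫ y, jacobian a b y • ψ y‖ₑ := by gcongr
    _ ≤ 256 * (2 * ENNReal.ofReal L * (ENNReal.ofReal ((2 * R) ^ 2) * J)) := by
        rw [mul_assoc]
        gcongr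
    _ = _ := by
        rw [mul_pow, ENNReal.ofReal_mul (by norm_num)]
        norm_num
        ring

theorem hasFDerivAt_comp_norm_sub_sq {q : ℝ → ℝ} (hq : Differentiable ℝ q) (α β : ℝ) (x y : ℂ) :
    HasFDerivAt (fun y : ℂ => q (α + β * ‖y - x‖ ^ 2))
      ((deriv q (α + β * ‖y - x‖ ^ 2) * (2 * β)) • innerSL ℝ (y - x)) y := by
  have h1 : HasFDerivAt (fun y : ℂ => ‖y - x‖ ^ 2) (2 • innerSL ℝ (y - x)) y := by
    simpa using ((hasFDerivAt_id y).sub_const x).norm_sq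
  have h2 := (h1.const_mul β).const_add α
  have h3 := (hq (α + β * ‖y - x‖ ^ 2)).hasDerivAt.comp_hasFDerivAt y h2
  have h4 : (deriv q (α + β * ‖y - x‖ ^ 2) * (2 * β)) • innerSL ℝ (y - x) =
      deriv q (α + β * ‖y - x‖ ^ 2) • β • 2 • innerSL ℝ (y - x) := by
    rw [← Nat.cast_smul_eq_nsmul ℝ, smul_smul, smul_smul]
    congr 1
    push_cast
    ring
  rw [h4]
  exact h3

theorem norm_fderiv_comp_norm_sub_sq {q : ℝ → ℝ} (hq : Differentiable ℝ q) (α β : ℝ) (x y : ℂ) :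
    ‖fderiv ℝ (fun y : ℂ => q (α + β * ‖y - x‖ ^ 2)) y‖ =
      |deriv q (α + β * ‖y - x‖ ^ 2)| * (2 * |β|) * ‖y - x‖ := by
  rw [(hasFDerivAt_comp_norm_sub_sq hq α β x y).fderiv, norm_smul, innerSL_apply_norm,
    Real.norm_eq_abs, abs_mul, abs_mul, abs_two]

theorem contDiff_comp_norm_sub_sq {n : ℕ∞} {q : ℝ → ℝ} (hq : ContDiff ℝ n q) (α β : ℝ) (x : ℂ) :
    ContDiff ℝ n fun y : ℂ => q (α + β * ‖y - x‖ ^ 2) :=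
  hq.comp (contDiff_const.add (contDiff_const.mul ((contDiff_id.sub contDiff_const).norm_sq ℝ)))

theorem deriv_smoothTransition_of_nonpos {t : ℝ} (ht : t ≤ 0) :
    deriv Real.smoothTransition t = 0 :=
  IsLocalMin.deriv_eq_zero (Filter.Eventually.of_forall fun s => by
    rw [Real.smoothTransition.zero_of_nonpos ht]; exact Real.smoothTransition.nonneg s)

theorem deriv_smoothTransition_of_one_le {t : ℝ} (ht : 1 ≤ t) :
    deriv Real.smoothTransition t = 0 :=
  IsLocalMax.deriv_eq_zero (Filter.Eventually.of_forall fun s => by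
    rw [Real.smoothTransition.one_of_one_le ht]; exact Real.smoothTransition.le_one s)

theorem contDiff_smoothTransition {n : ℕ∞} : ContDiff ℝ n Real.smoothTransition :=
  Real.smoothTransition.contDiff

theorem contDiff_deriv_smoothTransition {n : ℕ} :
    ContDiff ℝ n (deriv Real.smoothTransition) :=
  ((contDiff_smoothTransition (n := (n + 1 : ℕ))).of_le (by push_cast; rfl)).deriv' 

theorem hasCompactSupport_deriv_smoothTransition :
    HasCompactSupport (deriv Real.smoothTransition) := by
  refine HasCompactSupport.intro (isCompact_Icc (a := (0 : ℝ)) (b := 1)) fun t ht => ?_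
  rcases le_or_gt t 0 with h | h
  · exact deriv_smoothTransition_of_nonpos h
  · refine deriv_smoothTransition_of_one_le ?_
    by_contra h1
    exact ht ⟨h.le, (not_le.1 h1).le⟩

theorem exists_deriv_smoothTransition_le : ∃ C : ℝ, 0 ≤ C ∧
    (∀ t, |deriv Real.smoothTransition t| ≤ C) ∧
    ∀ t, |deriv (deriv Real.smoothTransition) t| ≤ C := by
  obtain ⟨C1, h1⟩ := hasCompactSupport_deriv_smoothTransition.exists_bound_of_continuous
    (contDiff_deriv_smoothTransition (n := 0)).continuous
  obtain ⟨C2, h2⟩ := hasCompactSupport_deriv_smoothTransition.deriv.exists_bound_of_continuous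
    ((contDiff_deriv_smoothTransition (n := 1)).continuous_deriv le_rfl)
  exact ⟨max C1 C2, ((norm_nonneg _).trans (h1 0)).trans (le_max_left _ _),
    fun t => (h1 t).trans (le_max_left _ _), fun t => (h2 t).trans (le_max_right _ _)⟩

/-- A smooth cutoff equal to `1` on `closedBall x s` and to `0` outside `ball x (2 * s)`. -/
def radialCutoff (x : ℂ) (s : ℝ) (y : ℂ) : ℝ :=
  Real.smoothTransition (2 + -(s ^ 2)⁻¹ * ‖y - x‖ ^ 2)

theorem contDiff_radialCutoff {n : ℕ∞} (x : ℂ) (s : ℝ) : ContDiff ℝ n (radialCutoff x s) :=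
  contDiff_comp_norm_sub_sq contDiff_smoothTransition _ _ _

theorem radialCutoff_eq_one {x y : ℂ} {s : ℝ} (hs : 0 < s) (h : ‖y - x‖ ≤ s) :
    radialCutoff x s y = 1 := by
  apply Real.smoothTransition.one_of_one_le
  have : (s ^ 2)⁻¹ * ‖y - x‖ ^ 2 ≤ (s ^ 2)⁻¹ * s ^ 2 := by gcongr
  rw [inv_mul_cancel₀ (by positivity)] at this
  linarith

theorem radialCutoff_eq_zero {x y : ℂ} {s : ℝ} (hs : 0 < s) (h : 2 * s ≤ ‖y - x‖) :
    radialCutoff x s y = 0 := by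
  apply Real.smoothTransition.zero_of_nonpos
  have : (s ^ 2)⁻¹ * (2 * s) ^ 2 ≤ (s ^ 2)⁻¹ * ‖y - x‖ ^ 2 := by gcongr
  have h2 : (s ^ 2)⁻¹ * (2 * s) ^ 2 = 4 := by field_simp; norm_num
  linarith

theorem abs_radialCutoff_le_one (x : ℂ) (s : ℝ) (y : ℂ) : |radialCutoff x s y| ≤ 1 := by
  rw [radialCutoff, abs_of_nonneg (Real.smoothTransition.nonneg _)]
  exact Real.smoothTransition.le_one _

theorem norm_fderiv_radialCutoff_le {C : ℝ} (hC : ∀ t, |deriv Real.smoothTransition t| ≤ C)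
    (x : ℂ) (s : ℝ) (y : ℂ) :
    ‖fderiv ℝ (radialCutoff x s) y‖ ≤ C * (2 * (s ^ 2)⁻¹) * ‖y - x‖ := by
  unfold radialCutoff
  rw [norm_fderiv_comp_norm_sub_sq
    ((contDiff_smoothTransition (n := 1)).differentiable (by simp)), abs_neg,
    abs_of_nonneg (inv_nonneg.2 (sq_nonneg s))]
  exact mul_le_mul_of_nonneg_right (mul_le_mul_of_nonneg_right (hC _) (by positivity))
    (norm_nonneg _)

theorem norm_fderiv_mul_radialCutoff_sub_le {C : ℝ}
    (hC : ∀ t, |deriv Real.smoothTransition t| ≤ C) {W : ℂ → ℂ} (hW : ContDiff ℝ 1 W) {x : ℂ}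
    {A s : ℝ} (hs : 0 < s) (hA1 : ∀ y, ‖W y‖ * ‖y - x‖ ≤ A)
    (hA2 : ∀ y, ‖fderiv ℝ W y‖ * ‖y - x‖ ^ 2 ≤ A) {y : ℂ} (hy1 : s ≤ ‖y - x‖)
    (hy2 : ‖y - x‖ ≤ 4 * s) :
    ‖fderiv ℝ (fun y => (radialCutoff x (2 * s) y - radialCutoff x s y) • W y) y‖ ≤
      (1 + 10 * C) * A / s ^ 2 := by
  have hC0 : 0 ≤ C := (abs_nonneg _).trans (hC 0)
  have hd : ∀ s, DifferentiableAt ℝ (radialCutoff x s) y := fun s =>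
    (contDiff_radialCutoff (n := 1) x s).differentiable (by simp) y
  have hWs : ‖W y‖ ≤ A / s := by
    rw [le_div_iff₀ hs]
    exact (mul_le_mul_of_nonneg_left hy1 (norm_nonneg _)).trans (hA1 y)
  have hA0 : 0 ≤ A := (by positivity : 0 ≤ ‖W y‖ * ‖y - x‖).trans (hA1 y)
  have hWs2 : ‖fderiv ℝ W y‖ ≤ A / s ^ 2 := by
    rw [le_div_iff₀ (by positivity)]
    exact (mul_le_mul_of_nonneg_left (by gcongr) (norm_nonneg _)).trans (hA2 y)
  have h01 : |radialCutoff x (2 * s) y - radialCutoff x s y| ≤ 1 := by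
    have h : ∀ s, 0 ≤ radialCutoff x s y := fun s => Real.smoothTransition.nonneg _
    have h' : ∀ s, radialCutoff x s y ≤ 1 := fun s => Real.smoothTransition.le_one _
    rw [abs_le]
    constructor <;> linarith [h s, h (2 * s), h' s, h' (2 * s)]
  have hcut : ‖fderiv ℝ (fun y => radialCutoff x (2 * s) y - radialCutoff x s y) y‖ ≤
      10 * C / s := by
    rw [fderiv_fun_sub (hd _) (hd _)]
    calc _ ≤ _ := norm_sub_le _ _
      _ ≤ C * (2 * ((2 * s) ^ 2)⁻¹) * (4 * s) + C * (2 * (s ^ 2)⁻¹) * (4 * s) := by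
          gcongr
          · exact (norm_fderiv_radialCutoff_le hC x _ y).trans (by gcongr)
          · exact (norm_fderiv_radialCutoff_le hC x _ y).trans (by gcongr)
      _ = _ := by field_simp; ring
  rw [fderiv_fun_smul ((hd _).fun_sub (hd _)) (hW.differentiable one_ne_zero y)]
  calc _ ≤ _ := norm_add_le _ _
    _ ≤ 1 * (A / s ^ 2) + 10 * C / s * (A / s) := by
        refine add_le_add ?_ ?_
        · rw [norm_smul]
          exact mul_le_mul h01 hWs2 (norm_nonneg _) zero_le_one
        · rw [ContinuousLinearMap.norm_smulRight_apply]
          exact mul_le_mul hcut hWs (norm_nonneg _) (by positivity)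
    _ = _ := by field_simp

theorem enorm_integral_jacobian_smul_annulus_le {C : ℝ}
    (hC : ∀ t, |deriv Real.smoothTransition t| ≤ C) {a b : ℂ → ℝ} (ha : ContDiff ℝ 2 a)
    (hb : ContDiff ℝ 2 b) {W : ℂ → ℂ} (hW : ContDiff ℝ 1 W) {x : ℂ} {ρ : ℝ} (hx : ‖x‖ ≤ ρ)
    (hWs : tsupport W ⊆ closedBall 0 ρ) {A s : ℝ} (hs : 0 < s)
    (hA1 : ∀ y, ‖W y‖ * ‖y - x‖ ≤ A) (hA2 : ∀ y, ‖fderiv ℝ W y‖ * ‖y - x‖ ^ 2 ≤ A) :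
    ‖∫ y, jacobian a b y • ((radialCutoff x (2 * s) y - radialCutoff x s y) • W y)‖ₑ ≤
      2048 * ENNReal.ofReal ((1 + 10 * C) * A / s ^ 2) *
        ∫⁻ y in closedBall 0 ρ ∩ closedBall x (4 * s),
          ∫⁻ w in closedBall 0 ρ ∩ closedBall x (4 * s),
            ‖fderiv ℝ a y‖ₑ * ‖fderiv ℝ b w‖ₑ * ‖y - w‖ₑ⁻¹ := by
  set ψ : ℂ → ℂ := fun y => (radialCutoff x (2 * s) y - radialCutoff x s y) • W y with hψ
  have hts : tsupport ψ ⊆ {y | s ≤ ‖y - x‖ ∧ ‖y - x‖ ≤ 4 * s} := by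
    refine closure_minimal (fun y hy => ?_) ?_
    · by_contra h
      apply hy
      simp only [hψ]
      rw [Set.mem_ofPred_eq, not_and_or, not_le, not_le] at h
      rcases h with h | h
      · rw [radialCutoff_eq_one hs h.le, radialCutoff_eq_one (by positivity) (by linarith)]
        simp
      · rw [radialCutoff_eq_zero hs (by linarith),
          radialCutoff_eq_zero (by positivity) (by linarith)]
        simp
    · have hc : Continuous fun y => ‖y - x‖ := by fun_prop
      exact (isClosed_le continuous_const hc).inter (isClosed_le hc continuous_const)
  have hts' : tsupport ψ ⊆ closedBall 0 ρ :=
    (closure_mono (Function.support_smul_subset_right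
      (fun y => radialCutoff x (2 * s) y - radialCutoff x s y) W)).trans hWs
  by_cases hsρ : s ≤ 4 * ρ
  · refine enorm_integral_jacobian_smul_le ha hb ?_ hx (by positivity) (by linarith) ?_ ?_
    · exact ((contDiff_radialCutoff (n := 1) x _).sub (contDiff_radialCutoff (n := 1) x _)).smul hW
    · refine Set.subset_inter hts' fun y hy => ?_
      rw [mem_closedBall, dist_eq_norm]
      exact (hts hy).2
    · intro y
      by_cases hy : y ∈ tsupport ψ
      · exact norm_fderiv_mul_radialCutoff_sub_le hC hW hs hA1 hA2 (hts hy).1 (hts hy).2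
      · have h0 : fderiv ℝ ψ y = 0 := by
          by_contra h
          exact hy (support_fderiv_subset ℝ h)
        rw [h0, norm_zero]
        have hC0 : 0 ≤ C := (abs_nonneg _).trans (hC 0)
        have hA0 : 0 ≤ A := (by positivity : 0 ≤ ‖W y‖ * ‖y - x‖).trans (hA1 y)
        positivity
  · have h0 : ∀ y, ψ y = 0 := by
      intro y
      by_contra h
      have h1 := subset_tsupport ψ h
      have h2 := mem_closedBall_zero_iff.1 (hts' h1)
      have h3 := (hts h1).1
      have := norm_sub_le y x
      have := norm_nonneg x
      linarith
    have h1 : ∀ y, jacobian a b y • ψ y = 0 := fun y => by rw [h0, smul_zero]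
    rw [integral_congr_ae (Filter.Eventually.of_forall h1)]
    simp

theorem enorm_integral_jacobian_smul_le_wentePotential {C : ℝ}
    (hC : ∀ t, |deriv Real.smoothTransition t| ≤ C) {a b : ℂ → ℝ} (ha : ContDiff ℝ 2 a)
    (hb : ContDiff ℝ 2 b) {W : ℂ → ℂ} (hW : ContDiff ℝ 1 W) {x : ℂ} {ρ : ℝ} (hx : ‖x‖ ≤ ρ)
    (hWs : tsupport W ⊆ closedBall 0 ρ) {A : ℝ}
    (hA1 : ∀ y, ‖W y‖ * ‖y - x‖ ≤ A) (hA2 : ∀ y, ‖fderiv ℝ W y‖ * ‖y - x‖ ^ 2 ≤ A)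
    {f g : ℂ → ℝ≥0∞} (hf : ∀ y ∈ closedBall 0 ρ, ‖fderiv ℝ a y‖ₑ ≤ f y)
    (hg : ∀ y ∈ closedBall 0 ρ, ‖fderiv ℝ b y‖ₑ ≤ g y) :
    ‖∫ y, jacobian a b y • W y‖ₑ ≤
      ENNReal.ofReal (2048 * (16 * ((1 + 10 * C) * A))) * wentePotential f g x := by
  have hC0 : 0 ≤ C := (abs_nonneg _).trans (hC 0)
  have hA0 : 0 ≤ A := (by positivity : 0 ≤ ‖W 0‖ * ‖0 - x‖).trans (hA1 0)
  have hcs : HasCompactSupport W := (isCompact_closedBall (0 : ℂ) ρ).of_isClosed_subset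
    (isClosed_tsupport W) hWs
  set σ : ℤ → ℝ := fun k => (2 : ℝ) ^ (k : ℝ) with hσ
  have hσ0 : ∀ k, 0 < σ k := fun k => by positivity
  have hσadd : ∀ k l : ℤ, σ (k + l) = σ k * σ l := fun k l => by
    simp only [hσ]; push_cast; rw [Real.rpow_add two_pos]
  have hσ1 : σ 1 = 2 := by simp [hσ]
  have hσ2 : σ 2 = 4 := by simp only [hσ]; norm_num
  set I : ℤ → ℂ := fun k => ∫ y, jacobian a b y • (radialCutoff x (σ k) y • W y) with hI
  have hinteg : ∀ k, Integrable fun y => jacobian a b y • (radialCutoff x (σ k) y • W y) := fun k =>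
    ((continuous_jacobian (ha.of_le (by norm_num)) (hb.of_le (by norm_num))).smul
      ((contDiff_radialCutoff (n := 0) x _).continuous.smul
        hW.continuous)).integrable_of_hasCompactSupport hcs.smul_left.smul_left
  have hinteg' : Integrable fun y => jacobian a b y • W y :=
    ((continuous_jacobian (ha.of_le (by norm_num)) (hb.of_le (by norm_num))).smul
      hW.continuous).integrable_of_hasCompactSupport hcs.smul_left
  set Tm : ℤ → ℝ≥0∞ := fun k => 2 ^ (-2 * k : ℝ) * ∫⁻ y in closedBall x (σ k),
    ∫⁻ w in closedBall x (σ k), f y * g w * ‖y - w‖ₑ⁻¹ with hTm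
  set D : ℝ≥0∞ := ENNReal.ofReal (2048 * (16 * ((1 + 10 * C) * A))) with hD
  have hpiece : ∀ k : ℤ, ‖I (k + 1) - I k‖ₑ ≤ D * Tm (k + 2) := by
    intro k
    have e1 : I (k + 1) - I k = ∫ y, jacobian a b y •
        ((radialCutoff x (2 * σ k) y - radialCutoff x (σ k) y) • W y) := by
      simp only [hI]
      rw [← integral_sub (hinteg _) (hinteg _)]
      congr 1 with y
      rw [hσadd, hσ1, mul_comm (σ k), sub_smul, smul_sub]
    rw [e1]
    refine (enorm_integral_jacobian_smul_annulus_le hC ha hb hW hx hWs (hσ0 k) hA1 hA2).trans ?_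
    have e2 : σ (k + 2) = 4 * σ k := by rw [hσadd, hσ2, mul_comm]
    have e3 : 2048 * ENNReal.ofReal ((1 + 10 * C) * A / σ k ^ 2) =
        D * 2 ^ (-2 * (k + 2 : ℤ) : ℝ) := by
      rw [hD, ← ofReal_two_rpow, ← ENNReal.ofReal_mul (by positivity),
        show (2048 : ℝ≥0∞) = ENNReal.ofReal 2048 by simp, ← ENNReal.ofReal_mul (by norm_num)]
      congr 1
      have : (2 : ℝ) ^ (-2 * (k + 2 : ℤ) : ℝ) = (σ (k + 2) ^ 2)⁻¹ := by
        simp only [hσ]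
        rw [← Real.rpow_natCast, ← Real.rpow_mul two_pos.le, ← Real.rpow_neg two_pos.le]
        congr 1
        push_cast
        ring
      rw [this, e2]
      have := hσ0 k
      field_simp
      norm_num
    rw [e3, mul_assoc]
    refine mul_le_mul_right (mul_le_mul_right ?_ _) _
    rw [e2]
    have hm : MeasurableSet (closedBall (0 : ℂ) ρ ∩ closedBall x (4 * σ k)) :=
      measurableSet_closedBall.inter measurableSet_closedBall
    refine (setLIntegral_mono_ae' hm (Filter.Eventually.of_forall fun y hy => ?_)).trans
      (lintegral_mono_set Set.inter_subset_right)
    refine (setLIntegral_mono_ae' hm (Filter.Eventually.of_forall fun w hw => ?_)).trans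
      (lintegral_mono_set Set.inter_subset_right)
    exact mul_le_mul_left (mul_le_mul' (hf y hy.1) (hg w hw.1)) _
  have htele : ∀ (j : ℤ) (n : ℕ), ‖I (j + n)‖ₑ ≤ ‖I j‖ₑ + D * wentePotential f g x := by
    intro j n
    have h1 : I (j + n) = I j + ∑ i ∈ Finset.range n, (I (j + i + 1) - I (j + i)) := by
      have := Finset.sum_range_sub (fun i : ℕ => I (j + i)) n
      simp only [Nat.cast_add, Nat.cast_one, ← add_assoc, Nat.cast_zero, add_zero] at this
      rw [this]
      ring
    rw [h1]
    refine (enorm_add_le _ _).trans (add_le_add le_rfl ?_)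
    calc _ ≤ ∑ i ∈ Finset.range n, ‖I (j + i + 1) - I (j + i)‖ₑ := enorm_sum_le _ _
      _ ≤ ∑ i ∈ Finset.range n, D * Tm (j + i + 2) := Finset.sum_le_sum fun i _ => hpiece _
      _ = D * ∑ i ∈ Finset.range n, Tm (j + i + 2) := by rw [Finset.mul_sum]
      _ ≤ D * ∑' i : ℕ, Tm (j + i + 2) := mul_le_mul_right (ENNReal.sum_le_tsum _) _
      _ ≤ D * ∑' k : ℤ, Tm k := by
          refine mul_le_mul_right ?_ _
          refine ENNReal.tsum_comp_le_tsum_of_injective (f := fun i : ℕ => j + i + 2) ?_ Tm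
          intro m n h
          simpa using h
      _ = _ := rfl
  have hend : ∀ᶠ n : ℕ in Filter.atTop, I n = ∫ y, jacobian a b y • W y := by
    have h2 : Filter.Tendsto (fun n : ℕ => (2 : ℝ) ^ n) Filter.atTop Filter.atTop :=
      tendsto_pow_atTop_atTop_of_one_lt one_lt_two
    filter_upwards [h2.eventually_ge_atTop (2 * ρ)] with n hn
    simp only [hI]
    congr 1 with y
    by_cases hy : W y = 0
    · rw [hy, smul_zero]
    · have h3 := mem_closedBall_zero_iff.1 (hWs (subset_tsupport W hy))
      rw [radialCutoff_eq_one (hσ0 _), one_smul]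
      have := norm_sub_le y x
      have : σ n = 2 ^ n := by simp [hσ]
      linarith
  have hzero : Filter.Tendsto (fun n : ℕ => I (-n)) Filter.atTop (nhds 0) := by
    rw [show (0 : ℂ) = ∫ y : ℂ, (0 : ℂ) by simp]
    refine tendsto_integral_of_dominated_convergence (fun y => ‖jacobian a b y • W y‖)
      (fun n => (hinteg _).aestronglyMeasurable) hinteg'.norm ?_ ?_
    · refine fun n => Filter.Eventually.of_forall fun y => ?_
      rw [smul_comm, norm_smul, Real.norm_eq_abs]
      exact mul_le_of_le_one_left (norm_nonneg _) (abs_radialCutoff_le_one _ _ _)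
    · have hx0 : ∀ᵐ y : ℂ, y ≠ x := by
        simp [ae_iff]
      filter_upwards [hx0] with y hy
      have hy0 : 0 < ‖y - x‖ := norm_pos_iff.2 (sub_ne_zero.2 hy)
      have h2 : Filter.Tendsto (fun n : ℕ => ((2 : ℝ)⁻¹) ^ n) Filter.atTop (nhds 0) :=
        tendsto_pow_atTop_nhds_zero_of_lt_one (by norm_num) (by norm_num)
      refine tendsto_const_nhds.congr' ?_
      filter_upwards [h2.eventually_lt_const (half_pos hy0)] with n hn
      rw [radialCutoff_eq_zero (hσ0 _), zero_smul, smul_zero]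
      have : σ (-n) = 2⁻¹ ^ n := by simp [hσ]
      linarith
  have hfin : ∀ᶠ n : ℕ in Filter.atTop, ‖∫ y, jacobian a b y • W y‖ₑ ≤
      ‖I (-n)‖ₑ + D * wentePotential f g x := by
    filter_upwards [hend] with n hn
    have := htele (-n) (2 * n)
    rwa [show (-n + (2 * n : ℕ) : ℤ) = n by push_cast; ring, hn] at this
  have hlim : Filter.Tendsto (fun n : ℕ => ‖I (-n)‖ₑ + D * wentePotential f g x) Filter.atTop
      (nhds (0 + D * wentePotential f g x)) := by
    refine Filter.Tendsto.add ?_ tendsto_const_nhds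
    simpa using hzero.enorm
  rw [zero_add] at hlim
  exact ge_of_tendsto hlim hfin

/-- The Laplacian on the real plane `ℂ`. -/
def planeLaplacian {F : Type*} [NormedAddCommGroup F] [NormedSpace ℝ F] (f : ℂ → F) (y : ℂ) : F :=
  fderiv ℝ (fun z => fderiv ℝ f z 1) y 1 + fderiv ℝ (fun z => fderiv ℝ f z Complex.I) y Complex.I

/-- The Cauchy kernel `1 / (x - y)`, smoothly truncated to `0` on `closedBall x ε`. -/
def truncatedCauchyKernel (ε : ℝ) (x y : ℂ) : ℂ :=
  Real.smoothTransition (-1 + (ε ^ 2)⁻¹ * ‖y - x‖ ^ 2) • (x - y)⁻¹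

theorem truncatedCauchyKernel_eventuallyEq_zero {ε : ℝ} (hε : 0 < ε) (x : ℂ) :
    truncatedCauchyKernel ε x =ᶠ[nhds x] 0 := by
  filter_upwards [ball_mem_nhds x hε] with y hy
  rw [mem_ball, dist_eq_norm] at hy
  have : (ε ^ 2)⁻¹ * ‖y - x‖ ^ 2 ≤ (ε ^ 2)⁻¹ * ε ^ 2 := by gcongr
  rw [inv_mul_cancel₀ (by positivity)] at this
  rw [truncatedCauchyKernel, Real.smoothTransition.zero_of_nonpos (by linarith)]
  simp

theorem truncatedCauchyKernel_of_le {ε : ℝ} (hε : 0 < ε) {x y : ℂ}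
    (h : 2 * ε ^ 2 ≤ ‖y - x‖ ^ 2) : truncatedCauchyKernel ε x y = (x - y)⁻¹ := by
  have : (ε ^ 2)⁻¹ * (2 * ε ^ 2) ≤ (ε ^ 2)⁻¹ * ‖y - x‖ ^ 2 := by gcongr
  have h2 : (ε ^ 2)⁻¹ * (2 * ε ^ 2) = 2 := by field_simp
  rw [truncatedCauchyKernel, Real.smoothTransition.one_of_one_le (by linarith), one_smul]

theorem contDiff_truncatedCauchyKernel {n : ℕ∞} {ε : ℝ} (hε : 0 < ε) (x : ℂ) :
    ContDiff ℝ n (truncatedCauchyKernel ε x) := by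
  rw [contDiff_iff_contDiffAt]
  intro y
  by_cases hy : y = x
  · subst hy
    exact contDiffAt_const.congr_of_eventuallyEq (truncatedCauchyKernel_eventuallyEq_zero hε y)
  · refine (contDiff_comp_norm_sub_sq contDiff_smoothTransition _ _ _).contDiffAt.smul ?_
    exact (contDiffAt_const.sub contDiffAt_id).inv (sub_ne_zero.2 (Ne.symm hy))

theorem norm_truncatedCauchyKernel_mul_le (ε : ℝ) (x y : ℂ) :
    ‖truncatedCauchyKernel ε x y‖ * ‖y - x‖ ≤ 1 := by
  rw [truncatedCauchyKernel, norm_smul, norm_inv, norm_sub_rev y x, mul_assoc, Real.norm_eq_abs,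
    abs_of_nonneg (Real.smoothTransition.nonneg _)]
  exact mul_le_one₀ (Real.smoothTransition.le_one _) (by positivity) (inv_mul_le_one)

theorem fderiv_truncatedCauchyKernel_apply {ε : ℝ} {x y : ℂ} (hy : y ≠ x) (v : ℂ) :
    fderiv ℝ (truncatedCauchyKernel ε x) y v =
      Real.smoothTransition (-1 + (ε ^ 2)⁻¹ * ‖y - x‖ ^ 2) • (v * ((x - y) ^ 2)⁻¹) +
        (deriv Real.smoothTransition (-1 + (ε ^ 2)⁻¹ * ‖y - x‖ ^ 2) * (2 * (ε ^ 2)⁻¹) *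
          inner ℝ (y - x) v) • (x - y)⁻¹ := by
  have h1 := hasFDerivAt_comp_norm_sub_sq
    ((contDiff_smoothTransition (n := 1)).differentiable (by simp)) (-1) (ε ^ 2)⁻¹ x y
  have hne : x - y ≠ 0 := sub_ne_zero.2 (Ne.symm hy)
  have h2 : HasDerivAt (fun y : ℂ => (x - y)⁻¹) (((x - y) ^ 2)⁻¹) y := by
    have h : HasDerivAt (fun y : ℂ => x - y) (-1) y := (hasDerivAt_id y).const_sub x
    simpa using h.fun_inv hne
  have h3 := h1.smul (h2.hasFDerivAt.restrictScalars ℝ)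
  have h4 : fderiv ℝ (truncatedCauchyKernel ε x) y = _ := h3.fderiv
  rw [h4]
  simp only [add_apply, smul_apply, ContinuousLinearMap.smulRight_apply, smul_eq_mul,
    innerSL_apply_apply, ContinuousLinearMap.coe_restrictScalars',
    ContinuousLinearMap.toSpanSingleton_apply]

theorem fderiv_truncatedCauchyKernel_self {ε : ℝ} (hε : 0 < ε) (x : ℂ) :
    fderiv ℝ (truncatedCauchyKernel ε x) x = 0 := by
  rw [(truncatedCauchyKernel_eventuallyEq_zero hε x).fderiv_eq]
  simp

theorem norm_fderiv_truncatedCauchyKernel_mul_le {C : ℝ}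
    (hC : ∀ t, |deriv Real.smoothTransition t| ≤ C) {ε : ℝ} (hε : 0 < ε) (x y : ℂ) :
    ‖fderiv ℝ (truncatedCauchyKernel ε x) y‖ * ‖y - x‖ ^ 2 ≤ 1 + 4 * C := by
  have hC0 : 0 ≤ C := (abs_nonneg _).trans (hC 0)
  by_cases hy : y = x
  · rw [hy, fderiv_truncatedCauchyKernel_self hε]
    simp
    positivity
  have hne : 0 < ‖y - x‖ := norm_pos_iff.2 (sub_ne_zero.2 hy)
  rw [← le_div_iff₀ (by positivity)]
  refine ContinuousLinearMap.opNorm_le_bound _ (by positivity) fun v => ?_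
  rw [fderiv_truncatedCauchyKernel_apply hy]
  set t := -1 + (ε ^ 2)⁻¹ * ‖y - x‖ ^ 2 with ht
  have e1 : ‖Real.smoothTransition t • (v * ((x - y) ^ 2)⁻¹)‖ ≤ ‖v‖ / ‖y - x‖ ^ 2 := by
    rw [norm_smul, norm_mul, norm_inv, norm_pow, norm_sub_rev x y, Real.norm_eq_abs,
      abs_of_nonneg (Real.smoothTransition.nonneg _), ← div_eq_mul_inv]
    exact mul_le_of_le_one_left (by positivity) (Real.smoothTransition.le_one _)
  have e2 : |deriv Real.smoothTransition t| * (2 * (ε ^ 2)⁻¹) ≤ 4 * C / ‖y - x‖ ^ 2 := by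
    rcases le_or_gt t 1 with h | h
    · have : (ε ^ 2)⁻¹ ≤ 2 / ‖y - x‖ ^ 2 := by
        rw [le_div_iff₀ (by positivity)]
        linarith
      calc _ ≤ C * (2 * (2 / ‖y - x‖ ^ 2)) := by
            gcongr
            exact hC t
        _ = _ := by ring
    · rw [deriv_smoothTransition_of_one_le h.le]
      simp
      positivity
  have e3 : ‖(deriv Real.smoothTransition t * (2 * (ε ^ 2)⁻¹) * inner ℝ (y - x) v) • (x - y)⁻¹‖ ≤
      4 * C / ‖y - x‖ ^ 2 * ‖v‖ := by
    rw [norm_smul, norm_mul, norm_mul, norm_inv, norm_sub_rev x y, Real.norm_eq_abs,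
      Real.norm_eq_abs, abs_of_nonneg (by positivity : 0 ≤ 2 * (ε ^ 2)⁻¹)]
    calc _ ≤ 4 * C / ‖y - x‖ ^ 2 * (‖y - x‖ * ‖v‖) * ‖y - x‖⁻¹ := by
          gcongr
          exact norm_inner_le_norm _ _
      _ = _ := by field_simp
  calc _ ≤ _ := norm_add_le _ _
    _ ≤ _ := add_le_add e1 e3
    _ = _ := by ring

theorem fderiv_truncatedCauchyKernel_wirtinger {ε : ℝ} (hε : 0 < ε) (x y : ℂ) :
    fderiv ℝ (truncatedCauchyKernel ε x) y 1 +
        Complex.I * fderiv ℝ (truncatedCauchyKernel ε x) y Complex.I =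
      ((-2 * (ε ^ 2)⁻¹ *
        deriv Real.smoothTransition (-1 + (ε ^ 2)⁻¹ * ‖y - x‖ ^ 2) : ℝ) : ℂ) := by
  by_cases hy : y = x
  · rw [hy, fderiv_truncatedCauchyKernel_self hε, deriv_smoothTransition_of_nonpos (by simp)]
    simp
  have hne : x - y ≠ 0 := sub_ne_zero.2 (Ne.symm hy)
  rw [fderiv_truncatedCauchyKernel_apply hy, fderiv_truncatedCauchyKernel_apply hy]
  set t := -1 + (ε ^ 2)⁻¹ * ‖y - x‖ ^ 2 with ht
  have hi1 : inner ℝ (y - x) (1 : ℂ) = (y - x).re := by simp [Complex.inner]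
  have hiI : inner ℝ (y - x) Complex.I = (y - x).im := by
    rw [Complex.inner, Complex.mul_re]; simp; ring
  rw [hi1, hiI]
  simp only [Complex.real_smul]
  push_cast
  have hyx : ((y - x).re : ℂ) + (y - x).im * Complex.I = y - x := Complex.re_add_im _
  have hinv : (y - x) * (x - y)⁻¹ = -1 := by
    rw [← neg_sub x y, neg_mul, mul_inv_cancel₀ hne]
  have hI : Complex.I * Complex.I = -1 := Complex.I_mul_I
  linear_combination (↑(Real.smoothTransition t) * ((x - y) ^ 2)⁻¹) * hI +
    (↑(deriv Real.smoothTransition t) * (2 * ((ε : ℂ) ^ 2)⁻¹) * (x - y)⁻¹) * hyx +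
    (↑(deriv Real.smoothTransition t) * (2 * ((ε : ℂ) ^ 2)⁻¹)) * hinv

theorem planeLaplacian_truncatedCauchyKernel {ε : ℝ} (hε : 0 < ε) (x y : ℂ) :
    planeLaplacian (truncatedCauchyKernel ε x) y =
      fderiv ℝ (fun z => fderiv ℝ (truncatedCauchyKernel ε x) z 1 +
        Complex.I * fderiv ℝ (truncatedCauchyKernel ε x) z Complex.I) y 1 -
      Complex.I * fderiv ℝ (fun z => fderiv ℝ (truncatedCauchyKernel ε x) z 1 +
        Complex.I * fderiv ℝ (truncatedCauchyKernel ε x) z Complex.I) y Complex.I := by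
  have h2 : ContDiff ℝ 2 (truncatedCauchyKernel ε x) := contDiff_truncatedCauchyKernel hε x
  have hd : ∀ v, DifferentiableAt ℝ (fun z => fderiv ℝ (truncatedCauchyKernel ε x) z v) y :=
    fun v => (contDiff_fderiv_apply h2 v).differentiable one_ne_zero y
  rw [fderiv_fun_add (hd _) ((hd _).const_mul _), fderiv_const_mul (hd _), planeLaplacian]
  simp only [add_apply, smul_apply, smul_eq_mul]
  rw [fderiv_fderiv_apply_comm h2 Complex.I 1]
  linear_combination (fderiv ℝ (fun z => fderiv ℝ (truncatedCauchyKernel ε x) z Complex.I) y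
    Complex.I) * Complex.I_mul_I

/-- The reflected part `conj y / (r² - x conj y)` of the gradient of the Green function of
`ball 0 r` with pole `x`. -/
def reflectedKernel (r : ℝ) (x y : ℂ) : ℂ := conj (y / (r ^ 2 - conj x * y))

theorem normSq_sub_conj_mul (r : ℝ) (x y : ℂ) :
    ‖(r : ℂ) ^ 2 - conj x * y‖ ^ 2 =
      r ^ 2 * ‖y - x‖ ^ 2 + (r ^ 2 - ‖x‖ ^ 2) * (r ^ 2 - ‖y‖ ^ 2) := by
  simp only [← Complex.normSq_eq_norm_sq]
  rw [← Complex.ofReal_pow]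
  simp only [Complex.normSq_apply, Complex.sub_re, Complex.sub_im, Complex.mul_re, Complex.mul_im,
    Complex.conj_re, Complex.conj_im, Complex.ofReal_re, Complex.ofReal_im]
  ring

theorem mul_norm_sub_le_norm_sub_conj_mul {r : ℝ} {x y : ℂ} (hx : ‖x‖ < r) (hy : ‖y‖ < r) :
    r * ‖y - x‖ ≤ ‖(r : ℂ) ^ 2 - conj x * y‖ := by
  have hr : 0 ≤ r := (norm_nonneg x).trans hx.le
  refine le_of_sq_le_sq ?_ (norm_nonneg _)
  rw [normSq_sub_conj_mul, mul_pow]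
  have h1 : ‖x‖ ^ 2 ≤ r ^ 2 := by gcongr
  have h2 : ‖y‖ ^ 2 ≤ r ^ 2 := by gcongr
  nlinarith

theorem sub_conj_mul_ne_zero {r : ℝ} {x y : ℂ} (hx : ‖x‖ < r) (hy : ‖y‖ < r) :
    (r : ℂ) ^ 2 - conj x * y ≠ 0 := by
  intro h
  have h1 := normSq_sub_conj_mul r x y
  rw [h, norm_zero] at h1
  have h2 : ‖x‖ ^ 2 < r ^ 2 := by gcongr
  have h3 : ‖y‖ ^ 2 < r ^ 2 := by gcongr
  have : 0 < (r ^ 2 - ‖x‖ ^ 2) * (r ^ 2 - ‖y‖ ^ 2) := mul_pos (by linarith) (by linarith)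
  nlinarith [sq_nonneg (r * ‖y - x‖)]

theorem fderiv_conj_apply {h : ℂ → ℂ} {h' y : ℂ} (hh : HasDerivAt h h' y) (v : ℂ) :
    fderiv ℝ (fun z => conj (h z)) y v = conj (v * h') := by
  have h1 := (Complex.conjCLE : ℂ →L[ℝ] ℂ).hasFDerivAt.comp y (hh.hasFDerivAt.restrictScalars ℝ)
  have h2 : fderiv ℝ (fun z => conj (h z)) y = _ := h1.fderiv
  rw [h2]
  simp

theorem hasDerivAt_div_sub_conj_mul {r : ℝ} {x y : ℂ} (hx : ‖x‖ < r) (hy : ‖y‖ < r) :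
    HasDerivAt (fun y => y / ((r : ℂ) ^ 2 - conj x * y))
      ((r : ℂ) ^ 2 / ((r : ℂ) ^ 2 - conj x * y) ^ 2) y := by
  have h1 : HasDerivAt (fun y => (r : ℂ) ^ 2 - conj x * y) (-conj x) y := by
    simpa using ((hasDerivAt_id y).const_mul (conj x)).const_sub ((r : ℂ) ^ 2)
  refine ((hasDerivAt_id y).fun_div h1 (sub_conj_mul_ne_zero hx hy)).congr_deriv ?_
  simp [mul_comm y]

theorem fderiv_reflectedKernel_apply {r : ℝ} {x y : ℂ} (hx : ‖x‖ < r) (hy : ‖y‖ < r) (v : ℂ) :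
    fderiv ℝ (reflectedKernel r x) y v =
      conj (v * ((r : ℂ) ^ 2 / ((r : ℂ) ^ 2 - conj x * y) ^ 2)) :=
  fderiv_conj_apply (hasDerivAt_div_sub_conj_mul hx hy) v

theorem contDiffOn_reflectedKernel {n : ℕ∞} {r : ℝ} {x : ℂ} (hx : ‖x‖ < r) :
    ContDiffOn ℝ n (reflectedKernel r x) (ball 0 r) := by
  refine Complex.conjCLE.contDiff.comp_contDiffOn (f := fun y => y / ((r : ℂ) ^ 2 - conj x * y)) ?_
  simp only [div_eq_mul_inv]
  have h1 : ContDiffOn ℝ n (fun y : ℂ => (r : ℂ) ^ 2 - conj x * y) (ball 0 r) :=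
    contDiffOn_const.sub (contDiffOn_const.mul contDiffOn_id)
  exact contDiffOn_id.mul (h1.inv fun y hy => sub_conj_mul_ne_zero hx (mem_ball_zero_iff.1 hy))

theorem norm_reflectedKernel_mul_le {r : ℝ} {x y : ℂ} (hx : ‖x‖ < r) (hy : ‖y‖ < r) :
    ‖reflectedKernel r x y‖ * ‖y - x‖ ≤ 1 := by
  have hr : 0 < r := (norm_nonneg x).trans_lt hx
  have h := mul_norm_sub_le_norm_sub_conj_mul hx hy
  have h0 : 0 < ‖(r : ℂ) ^ 2 - conj x * y‖ := norm_pos_iff.2 (sub_conj_mul_ne_zero hx hy)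
  rw [reflectedKernel, Complex.norm_conj, norm_div, div_mul_eq_mul_div, div_le_one h0]
  exact (mul_le_mul_of_nonneg_right hy.le (norm_nonneg _)).trans h

theorem norm_fderiv_reflectedKernel_mul_le {r : ℝ} {x y : ℂ} (hx : ‖x‖ < r) (hy : ‖y‖ < r) :
    ‖fderiv ℝ (reflectedKernel r x) y‖ * ‖y - x‖ ^ 2 ≤ 1 := by
  have hr : 0 < r := (norm_nonneg x).trans_lt hx
  have h := mul_norm_sub_le_norm_sub_conj_mul hx hy
  have h0 : 0 < ‖(r : ℂ) ^ 2 - conj x * y‖ := norm_pos_iff.2 (sub_conj_mul_ne_zero hx hy)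
  have h1 : ‖fderiv ℝ (reflectedKernel r x) y‖ ≤ r ^ 2 / ‖(r : ℂ) ^ 2 - conj x * y‖ ^ 2 := by
    refine ContinuousLinearMap.opNorm_le_bound _ (by positivity) fun v => ?_
    rw [fderiv_reflectedKernel_apply hx hy, Complex.norm_conj, norm_mul, norm_div, norm_pow,
      norm_pow, Complex.norm_real, Real.norm_of_nonneg hr.le, mul_comm]
  refine (mul_le_mul_of_nonneg_right h1 (by positivity)).trans ?_
  rw [div_mul_eq_mul_div, div_le_one (by positivity), ← mul_pow]
  gcongr

theorem planeLaplacian_reflectedKernel {r : ℝ} {x y : ℂ} (hx : ‖x‖ < r) (hy : ‖y‖ < r) :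
    planeLaplacian (reflectedKernel r x) y = 0 := by
  have hev : ∀ v, (fun z => fderiv ℝ (reflectedKernel r x) z v) =ᶠ[nhds y]
      fun z => conj (v * ((r : ℂ) ^ 2 / ((r : ℂ) ^ 2 - conj x * z) ^ 2)) := fun v => by
    filter_upwards [isOpen_ball.mem_nhds (mem_ball_zero_iff.2 hy)] with z hz
    exact fderiv_reflectedKernel_apply hx (mem_ball_zero_iff.1 hz) v
  have hne := sub_conj_mul_ne_zero hx hy
  have hd : DifferentiableAt ℂ (fun z => (r : ℂ) ^ 2 / ((r : ℂ) ^ 2 - conj x * z) ^ 2) y :=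
    (differentiableAt_const _).div (by fun_prop) (pow_ne_zero 2 hne)
  rw [planeLaplacian, (hev 1).fderiv_eq, (hev Complex.I).fderiv_eq,
    fderiv_conj_apply (hd.hasDerivAt.const_mul _), fderiv_conj_apply (hd.hasDerivAt.const_mul _),
    ← map_add, ← mul_assoc Complex.I, Complex.I_mul_I]
  simp

theorem norm_truncatedCauchyKernel_add_reflectedKernel_le {ε r : ℝ} (hε : 0 < ε) {x y : ℂ}
    (hx : ‖x‖ < r) (hy : ‖y‖ < r) (hxy : 2 * ε ^ 2 ≤ ‖y - x‖ ^ 2) :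
    ‖truncatedCauchyKernel ε x y + reflectedKernel r x y‖ ≤
      (r ^ 2 - ‖y‖ ^ 2) / (r * ‖y - x‖ ^ 2) := by
  have hr : 0 < r := (norm_nonneg x).trans_lt hx
  have h := mul_norm_sub_le_norm_sub_conj_mul hx hy
  have hne := sub_conj_mul_ne_zero hx hy
  have h0 : 0 < ‖(r : ℂ) ^ 2 - conj x * y‖ := norm_pos_iff.2 hne
  have hyx : 0 < ‖y - x‖ := by
    by_contra h'
    have : ‖y - x‖ = 0 := le_antisymm (not_lt.1 h') (norm_nonneg _)
    rw [this] at hxy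
    have : 0 < ε ^ 2 := by positivity
    norm_num at hxy
    linarith
  have hne' : x - y ≠ 0 := by
    rw [← norm_pos_iff, norm_sub_rev]; exact hyx
  have hyr : ‖y‖ ^ 2 ≤ r ^ 2 := by gcongr
  have hcne : (r : ℂ) ^ 2 - x * conj y ≠ 0 := by
    have := (map_ne_zero (starRingEnd ℂ)).2 hne
    simpa using this
  have key : truncatedCauchyKernel ε x y + reflectedKernel r x y =
      ((r ^ 2 - ‖y‖ ^ 2 : ℝ) : ℂ) / ((x - y) * conj ((r : ℂ) ^ 2 - conj x * y)) := by
    rw [truncatedCauchyKernel_of_le hε hxy, reflectedKernel]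
    have hyy : ((‖y‖ ^ 2 : ℝ) : ℂ) = conj y * y := by
      rw [← Complex.normSq_eq_norm_sq, Complex.normSq_eq_conj_mul_self]
    push_cast at hyy ⊢
    rw [hyy]
    simp only [map_div₀, map_sub, map_mul, map_pow, Complex.conj_ofReal, Complex.conj_conj]
    field_simp
    ring
  rw [key, norm_div, norm_mul, Complex.norm_conj, Complex.norm_real,
    Real.norm_of_nonneg (by linarith), norm_sub_rev x y]
  refine div_le_div_of_nonneg_left (by linarith) (by positivity) ?_
  rw [sq, mul_left_comm]
  gcongr

theorem planeLaplacian_congr {F : Type*} [NormedAddCommGroup F] [NormedSpace ℝ F] {f g : ℂ → F}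
    {y : ℂ} (h : f =ᶠ[nhds y] g) : planeLaplacian f y = planeLaplacian g y := by
  have hv : ∀ v, (fun z => fderiv ℝ f z v) =ᶠ[nhds y] fun z => fderiv ℝ g z v := fun v => by
    filter_upwards [h.fderiv (𝕜 := ℝ)] with z hz
    rw [hz]
  rw [planeLaplacian, planeLaplacian, (hv _).fderiv_eq, (hv _).fderiv_eq]

theorem planeLaplacian_add {F : Type*} [NormedAddCommGroup F] [NormedSpace ℝ F] {f g : ℂ → F}
    (hf : ContDiff ℝ 2 f) (hg : ContDiff ℝ 2 g) (y : ℂ) :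
    planeLaplacian (fun z => f z + g z) y = planeLaplacian f y + planeLaplacian g y := by
  have h1 : ∀ v, fderiv ℝ (fun z => fderiv ℝ (fun z => f z + g z) z v) y v =
      fderiv ℝ (fun z => fderiv ℝ f z v) y v + fderiv ℝ (fun z => fderiv ℝ g z v) y v := by
    intro v
    have : (fun z => fderiv ℝ (fun z => f z + g z) z v) =
        fun z => fderiv ℝ f z v + fderiv ℝ g z v := by
      ext z
      rw [fderiv_fun_add (hf.differentiable two_ne_zero z) (hg.differentiable two_ne_zero z)]
      rfl
    rw [this, fderiv_fun_add ((contDiff_fderiv_apply hf v).differentiable one_ne_zero y)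
      ((contDiff_fderiv_apply hg v).differentiable one_ne_zero y)]
    rfl
  rw [planeLaplacian, h1, h1, planeLaplacian, planeLaplacian]
  abel

theorem planeLaplacian_smul {F : Type*} [NormedAddCommGroup F] [NormedSpace ℝ F] {f : ℂ → ℝ}
    {g : ℂ → F} (hf : ContDiff ℝ 2 f) (hg : ContDiff ℝ 2 g) (y : ℂ) :
    planeLaplacian (fun z => f z • g z) y = f y • planeLaplacian g y +
      ((2 : ℝ) • (fderiv ℝ f y 1 • fderiv ℝ g y 1 +
        fderiv ℝ f y Complex.I • fderiv ℝ g y Complex.I) + planeLaplacian f y • g y) := by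
  have h1 : ∀ v, fderiv ℝ (fun z => fderiv ℝ (fun z => f z • g z) z v) y v =
      f y • fderiv ℝ (fun z => fderiv ℝ g z v) y v + ((2 : ℝ) • (fderiv ℝ f y v • fderiv ℝ g y v) +
        fderiv ℝ (fun z => fderiv ℝ f z v) y v • g y) := by
    intro v
    have e : (fun z => fderiv ℝ (fun z => f z • g z) z v) =
        fun z => f z • fderiv ℝ g z v + fderiv ℝ f z v • g z := by
      ext z
      rw [fderiv_fun_smul (hf.differentiable two_ne_zero z) (hg.differentiable two_ne_zero z)]
      rfl
    have hf1 := (contDiff_fderiv_apply hf v).differentiable one_ne_zero y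
    have hg1 := (contDiff_fderiv_apply hg v).differentiable one_ne_zero y
    have hf0 := hf.differentiable two_ne_zero y
    have hg0 := hg.differentiable two_ne_zero y
    rw [e, fderiv_fun_add (hf0.fun_smul hg1) (hf1.fun_smul hg0), fderiv_fun_smul hf0 hg1,
      fderiv_fun_smul hf1 hg0]
    simp only [add_apply, smul_apply, ContinuousLinearMap.smulRight_apply]
    rw [two_smul]
    abel
  rw [planeLaplacian, h1, h1, planeLaplacian, planeLaplacian]
  module

theorem continuous_planeLaplacian {F : Type*} [NormedAddCommGroup F] [NormedSpace ℝ F] {f : ℂ → F}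
    (hf : ContDiff ℝ 2 f) : Continuous (planeLaplacian f) :=
  (((contDiff_fderiv_apply hf _).continuous_fderiv one_ne_zero).clm_apply continuous_const).add
    (((contDiff_fderiv_apply hf _).continuous_fderiv one_ne_zero).clm_apply continuous_const)

theorem integral_planeLaplacian_smul {F : Type*} [NormedAddCommGroup F] [NormedSpace ℝ F]
    {f : ℂ → ℝ} {g : ℂ → F} (hf : ContDiff ℝ 2 f) (hg : ContDiff ℝ 2 g)
    (hs : HasCompactSupport g) :
    ∫ y, planeLaplacian f y • g y = ∫ y, f y • planeLaplacian g y := by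
  have h1 : ∀ v, ∫ y, fderiv ℝ (fun z => fderiv ℝ f z v) y v • g y =
      ∫ y, f y • fderiv ℝ (fun z => fderiv ℝ g z v) y v := fun v => by
    have e1 := integral_smul_fderiv_of_hasCompactSupport (contDiff_fderiv_apply hf v)
      (hg.of_le (by norm_num)) hs v
    have e2 := integral_smul_fderiv_of_hasCompactSupport (hf.of_le (by norm_num))
      (contDiff_fderiv_apply hg v) (hs.fderiv_apply ℝ v) v
    rw [e2, e1, neg_neg]
  have hi1 : ∀ v, Integrable fun y => fderiv ℝ (fun z => fderiv ℝ f z v) y v • g y := fun v =>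
    ((((contDiff_fderiv_apply hf v).continuous_fderiv one_ne_zero).clm_apply
      continuous_const).smul hg.continuous).integrable_of_hasCompactSupport hs.smul_left
  have hi2 : ∀ v, Integrable fun y => f y • fderiv ℝ (fun z => fderiv ℝ g z v) y v := fun v =>
    (hf.continuous.smul (((contDiff_fderiv_apply hg v).continuous_fderiv one_ne_zero).clm_apply
      continuous_const)).integrable_of_hasCompactSupport
      ((hs.fderiv_apply ℝ v).fderiv_apply ℝ v).smul_left
  simp only [planeLaplacian, add_smul, smul_add]
  rw [integral_add (hi1 _) (hi1 _), integral_add (hi2 _) (hi2 _), h1, h1]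

theorem fderiv_comp_norm_sub_sq_apply {q : ℝ → ℝ} (hq : Differentiable ℝ q) (α β : ℝ) (x y v : ℂ) :
    fderiv ℝ (fun y : ℂ => q (α + β * ‖y - x‖ ^ 2)) y v =
      deriv q (α + β * ‖y - x‖ ^ 2) * (2 * β * inner ℝ (y - x) v) := by
  rw [(hasFDerivAt_comp_norm_sub_sq hq α β x y).fderiv, smul_apply, innerSL_apply_apply, smul_eq_mul]
  ring

theorem planeLaplacian_comp_norm_sub_sq {q : ℝ → ℝ} (hq : Differentiable ℝ q)
    (hq' : Differentiable ℝ (deriv q)) (α β : ℝ) (x y : ℂ) :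
    planeLaplacian (fun y : ℂ => q (α + β * ‖y - x‖ ^ 2)) y =
      deriv (deriv q) (α + β * ‖y - x‖ ^ 2) * (4 * β ^ 2 * ‖y - x‖ ^ 2) +
        4 * β * deriv q (α + β * ‖y - x‖ ^ 2) := by
  have h1 : ∀ v, fderiv ℝ (fun z => fderiv ℝ (fun y : ℂ => q (α + β * ‖y - x‖ ^ 2)) z v) y v =
      deriv (deriv q) (α + β * ‖y - x‖ ^ 2) * (4 * β ^ 2 * inner ℝ (y - x) v ^ 2) +
        2 * β * inner ℝ v v * deriv q (α + β * ‖y - x‖ ^ 2) := by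
    intro v
    have e : (fun z => fderiv ℝ (fun y : ℂ => q (α + β * ‖y - x‖ ^ 2)) z v) =
        fun z => deriv q (α + β * ‖z - x‖ ^ 2) * (2 * β * inner ℝ (z - x) v) := by
      ext z
      exact fderiv_comp_norm_sub_sq_apply hq α β x z v
    have hin : HasFDerivAt (fun z : ℂ => 2 * β * inner ℝ (z - x) v)
        ((2 * β) • innerSL ℝ v) y := by
      have h := ((innerSL ℝ v).hasFDerivAt (x := y - x)).comp y ((hasFDerivAt_id y).sub_const x)
      have h' := h.const_mul (2 * β)
      refine (h'.congr_of_eventuallyEq (Filter.Eventually.of_forall fun z => ?_)).congr_fderiv ?_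
      · simp only [Function.comp, innerSL_apply_apply, id]
        rw [real_inner_comm]
      · rw [ContinuousLinearMap.comp_id]
    rw [e, ((hasFDerivAt_comp_norm_sub_sq hq' α β x y).fun_mul hin).fderiv]
    simp only [add_apply, smul_apply, innerSL_apply_apply, smul_eq_mul]
    ring
  have hn : inner ℝ (y - x) (1 : ℂ) ^ 2 + inner ℝ (y - x) Complex.I ^ 2 = ‖y - x‖ ^ 2 := by
    rw [← Complex.normSq_eq_norm_sq, Complex.normSq_apply, Complex.inner, Complex.inner,
      Complex.mul_re, Complex.mul_re]
    simp
    ring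
  have e1 : inner ℝ (1 : ℂ) (1 : ℂ) = (1 : ℝ) := by simp
  have eI : inner ℝ Complex.I Complex.I = (1 : ℝ) := by simp
  rw [planeLaplacian, h1, h1, e1, eI, ← hn]
  ring

theorem deriv_smoothTransition_nonneg (t : ℝ) : 0 ≤ deriv Real.smoothTransition t :=
  Real.smoothTransition.monotone.deriv_nonneg

theorem exists_tendsto_integral_deriv_smoothTransition : ∃ c₀ : ℝ, 0 < c₀ ∧
    ∀ (g : ℂ → ℂ) (x : ℂ), Integrable g → Continuous g →
      Filter.Tendsto (fun c : ℝ => ∫ y, (c ^ 2 * deriv Real.smoothTransition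
        (-1 + c ^ 2 * ‖y - x‖ ^ 2)) • g y) Filter.atTop (nhds (c₀ • g x)) := by
  set P : ℂ → ℝ := fun v => deriv Real.smoothTransition (-1 + ‖v‖ ^ 2) with hP
  have hPc : Continuous P :=
    (contDiff_deriv_smoothTransition (n := 0)).continuous.comp (by fun_prop)
  have hP0 : ∀ v, 0 ≤ P v := fun v => deriv_smoothTransition_nonneg _
  have hPz : ∀ v, 2 ≤ ‖v‖ → P v = 0 := fun v hv =>
    deriv_smoothTransition_of_one_le (by nlinarith)
  have hPs : HasCompactSupport P := by
    refine HasCompactSupport.intro (isCompact_closedBall (0 : ℂ) 2) fun v hv => hPz v ?_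
    rw [mem_closedBall_zero_iff, not_le] at hv
    exact hv.le
  have hPi : Integrable P := hPc.integrable_of_hasCompactSupport hPs
  have hpos : 0 < ∫ v, P v := by
    refine lt_of_le_of_ne (integral_nonneg hP0) fun h => ?_
    have h1 : P = 0 := (hPc.ae_eq_iff_eq volume continuous_const).1
      ((integral_eq_zero_iff_of_nonneg hP0 hPi).1 h.symm)
    have h2 : ∀ t, deriv Real.smoothTransition t = 0 := by
      intro t
      rcases le_or_gt t 0 with ht | ht
      · exact deriv_smoothTransition_of_nonpos ht
      · have h3 := congrFun h1 (Real.sqrt (t + 1) : ℂ)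
        simp only [hP, Complex.norm_real, Real.norm_eq_abs, sq_abs, Pi.zero_apply] at h3
        rwa [Real.sq_sqrt (by linarith), show (-1 + (t + 1) : ℝ) = t by ring] at h3
    have h4 := is_const_of_deriv_eq_zero
      ((contDiff_smoothTransition (n := 1)).differentiable (by simp)) h2 0 1
    rw [Real.smoothTransition.zero_of_nonpos le_rfl, Real.smoothTransition.one_of_one_le le_rfl] at h4
    exact zero_ne_one h4
  refine ⟨∫ v, P v, hpos, fun g x hg hgc => ?_⟩
  set c₀ := ∫ v, P v
  have h := tendsto_integral_comp_smul_smul_of_integrable' (μ := (volume : Measure ℂ))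
    (φ := fun v => c₀⁻¹ * P v) (fun v => mul_nonneg (inv_nonneg.2 hpos.le) (hP0 v))
    (by rw [integral_const_mul]; exact inv_mul_cancel₀ hpos.ne') (by
      refine tendsto_const_nhds.congr' ?_
      have : ∀ᶠ v : ℂ in Bornology.cobounded ℂ, 2 ≤ ‖v‖ :=
        tendsto_norm_cobounded_atTop.eventually_ge_atTop 2
      filter_upwards [this] with v hv
      rw [hPz v hv, mul_zero, mul_zero]) hg (x₀ := x) hgc.continuousAt
  have h2 := h.const_smul c₀
  refine h2.congr fun c => ?_
  rw [← integral_smul]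
  congr 1 with y
  rw [smul_smul, Complex.finrank_real_complex]
  congr 1
  simp only [hP]
  rw [norm_smul, mul_pow, norm_sub_rev, Real.norm_eq_abs, sq_abs]
  field_simp

/-- A smooth cutoff equal to `1` where `‖y‖² ≤ r² - 2δ` and to `0` where `‖y‖² ≥ r² - δ`. -/
def boundaryCutoff (r δ : ℝ) (y : ℂ) : ℝ :=
  Real.smoothTransition ((r ^ 2 - δ) / δ + -δ⁻¹ * ‖y - 0‖ ^ 2)

theorem contDiff_boundaryCutoff {n : ℕ∞} (r δ : ℝ) : ContDiff ℝ n (boundaryCutoff r δ) :=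
  contDiff_comp_norm_sub_sq contDiff_smoothTransition _ _ _

theorem boundaryCutoff_arg {δ : ℝ} (hδ : 0 < δ) (r : ℝ) (y : ℂ) :
    (r ^ 2 - δ) / δ + -δ⁻¹ * ‖y - 0‖ ^ 2 = (r ^ 2 - δ - ‖y‖ ^ 2) / δ := by
  rw [sub_zero]
  field_simp
  ring

theorem boundaryCutoff_eq_one {r δ : ℝ} (hδ : 0 < δ) {y : ℂ} (hy : ‖y‖ ^ 2 ≤ r ^ 2 - 2 * δ) :
    boundaryCutoff r δ y = 1 := by
  rw [boundaryCutoff, boundaryCutoff_arg hδ]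
  exact Real.smoothTransition.one_of_one_le ((one_le_div hδ).2 (by linarith))

theorem boundaryCutoff_eq_zero {r δ : ℝ} (hδ : 0 < δ) {y : ℂ} (hy : r ^ 2 - δ ≤ ‖y‖ ^ 2) :
    boundaryCutoff r δ y = 0 := by
  rw [boundaryCutoff, boundaryCutoff_arg hδ]
  exact Real.smoothTransition.zero_of_nonpos (div_nonpos_of_nonpos_of_nonneg (by linarith) hδ.le)

theorem boundaryCutoff_eventuallyEq_one {r δ : ℝ} (hδ : 0 < δ) {y : ℂ}
    (hy : ‖y‖ ^ 2 < r ^ 2 - 2 * δ) : boundaryCutoff r δ =ᶠ[nhds y] fun _ => 1 := by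
  have : ∀ᶠ z : ℂ in nhds y, ‖z‖ ^ 2 < r ^ 2 - 2 * δ :=
    (by fun_prop : Continuous fun z : ℂ => ‖z‖ ^ 2).continuousAt.eventually_lt_const hy
  filter_upwards [this] with z hz
  exact boundaryCutoff_eq_one hδ hz.le

theorem boundaryCutoff_eventuallyEq_zero {r δ : ℝ} (hδ : 0 < δ) {y : ℂ}
    (hy : r ^ 2 - δ < ‖y‖ ^ 2) : boundaryCutoff r δ =ᶠ[nhds y] fun _ => 0 := by
  have : ∀ᶠ z : ℂ in nhds y, r ^ 2 - δ < ‖z‖ ^ 2 :=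
    (by fun_prop : Continuous fun z : ℂ => ‖z‖ ^ 2).continuousAt.eventually_const_lt hy
  filter_upwards [this] with z hz
  exact boundaryCutoff_eq_zero hδ hz.le

theorem tsupport_boundaryCutoff_subset {r δ : ℝ} (hδ : 0 < δ) :
    tsupport (boundaryCutoff r δ) ⊆ {y | ‖y‖ ^ 2 ≤ r ^ 2 - δ} := by
  refine closure_minimal (fun y hy => ?_) (isClosed_le (by fun_prop) continuous_const)
  by_contra h
  exact hy (boundaryCutoff_eq_zero hδ (not_le.1 h).le)

theorem boundaryCutoff_eventuallyEq_const {r δ : ℝ} (hδ : 0 < δ) {y : ℂ}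
    (hy : ¬(r ^ 2 - 2 * δ ≤ ‖y‖ ^ 2 ∧ ‖y‖ ^ 2 ≤ r ^ 2 - δ)) :
    ∃ k : ℝ, boundaryCutoff r δ =ᶠ[nhds y] fun _ => k := by
  rw [not_and_or, not_le, not_le] at hy
  rcases hy with hy | hy
  · exact ⟨1, boundaryCutoff_eventuallyEq_one hδ hy⟩
  · exact ⟨0, boundaryCutoff_eventuallyEq_zero hδ hy⟩

theorem fderiv_boundaryCutoff_eq_zero {r δ : ℝ} (hδ : 0 < δ) {y : ℂ}
    (hy : ¬(r ^ 2 - 2 * δ ≤ ‖y‖ ^ 2 ∧ ‖y‖ ^ 2 ≤ r ^ 2 - δ)) :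
    fderiv ℝ (boundaryCutoff r δ) y = 0 := by
  obtain ⟨k, hk⟩ := boundaryCutoff_eventuallyEq_const hδ hy
  rw [hk.fderiv_eq, fderiv_const_apply]

theorem planeLaplacian_boundaryCutoff_eq_zero {r δ : ℝ} (hδ : 0 < δ) {y : ℂ}
    (hy : ¬(r ^ 2 - 2 * δ ≤ ‖y‖ ^ 2 ∧ ‖y‖ ^ 2 ≤ r ^ 2 - δ)) :
    planeLaplacian (boundaryCutoff r δ) y = 0 := by
  obtain ⟨k, hk⟩ := boundaryCutoff_eventuallyEq_const hδ hy
  rw [planeLaplacian_congr hk]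
  simp [planeLaplacian]

theorem norm_fderiv_boundaryCutoff_le {C : ℝ} (hC : ∀ t, |deriv Real.smoothTransition t| ≤ C)
    {δ : ℝ} (hδ : 0 < δ) (r : ℝ) (y : ℂ) :
    ‖fderiv ℝ (boundaryCutoff r δ) y‖ ≤ C * (2 * δ⁻¹) * ‖y‖ := by
  unfold boundaryCutoff
  rw [norm_fderiv_comp_norm_sub_sq
    ((contDiff_smoothTransition (n := 1)).differentiable (by simp)), abs_neg,
    abs_of_nonneg (inv_nonneg.2 hδ.le), sub_zero]
  exact mul_le_mul_of_nonneg_right (mul_le_mul_of_nonneg_right (hC _) (by positivity))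
    (norm_nonneg _)

theorem abs_planeLaplacian_boundaryCutoff_le {C : ℝ}
    (hC : ∀ t, |deriv Real.smoothTransition t| ≤ C)
    (hC' : ∀ t, |deriv (deriv Real.smoothTransition) t| ≤ C)
    {δ : ℝ} (hδ : 0 < δ) (r : ℝ) (y : ℂ) :
    |planeLaplacian (boundaryCutoff r δ) y| ≤ C * (4 * δ⁻¹ ^ 2 * ‖y‖ ^ 2) + 4 * δ⁻¹ * C := by
  unfold boundaryCutoff
  rw [planeLaplacian_comp_norm_sub_sq
    ((contDiff_smoothTransition (n := 1)).differentiable (by simp))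
    ((contDiff_deriv_smoothTransition (n := 1)).differentiable (by simp)), sub_zero, neg_sq]
  refine (abs_add_le _ _).trans (add_le_add ?_ ?_)
  · rw [abs_mul, abs_of_nonneg (by positivity : 0 ≤ 4 * δ⁻¹ ^ 2 * ‖y‖ ^ 2)]
    exact mul_le_mul_of_nonneg_right (hC' _) (by positivity)
  · rw [abs_mul, mul_neg, abs_neg, abs_of_nonneg (by positivity : 0 ≤ 4 * δ⁻¹)]
    exact mul_le_mul_of_nonneg_left (hC _) (by positivity)

theorem volume_annulus_le {s t : ℝ} (hst : s ≤ t) (hs : 0 ≤ s) :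
    volume {y : ℂ | s ≤ ‖y‖ ^ 2 ∧ ‖y‖ ^ 2 ≤ t} ≤ ENNReal.ofReal (π * (t - s)) := by
  have hset : {y : ℂ | s ≤ ‖y‖ ^ 2 ∧ ‖y‖ ^ 2 ≤ t} =
      closedBall 0 (Real.sqrt t) \ ball 0 (Real.sqrt s) := by
    ext y
    rw [Set.mem_sdiff, mem_closedBall_zero_iff, mem_ball_zero_iff, not_lt, Set.mem_ofPred_eq,
      Real.le_sqrt (norm_nonneg _) (hs.trans hst), Real.sqrt_le_left (norm_nonneg _), and_comm]
  have hsub : ball (0 : ℂ) (Real.sqrt s) ⊆ closedBall 0 (Real.sqrt t) :=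
    ball_subset_closedBall.trans (closedBall_subset_closedBall (Real.sqrt_le_sqrt hst))
  have hpi : (NNReal.pi : ℝ≥0∞) = ENNReal.ofReal π := by
    rw [← NNReal.coe_real_pi, ENNReal.ofReal_coe_nnreal]
  rw [hset, measure_sdiff hsub measurableSet_ball.nullMeasurableSet measure_ball_lt_top.ne,
    Complex.volume_closedBall, Complex.volume_ball, ← ENNReal.ofReal_pow (Real.sqrt_nonneg _),
    ← ENNReal.ofReal_pow (Real.sqrt_nonneg _), Real.sq_sqrt hs, Real.sq_sqrt (hs.trans hst), hpi,
    ← ENNReal.ofReal_mul (hs.trans hst), ← ENNReal.ofReal_mul hs,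
    ← ENNReal.ofReal_sub _ (by positivity)]
  apply le_of_eq
  congr 1
  ring

theorem exists_contDiff_eqOn_ball {F : Type*} [NormedAddCommGroup F] [NormedSpace ℝ F] {f : ℂ → F}
    {r s : ℝ} (hf : ContDiffOn ℝ (⊤ : ℕ∞) f (ball 0 r)) (hs0 : 0 ≤ s) (hs : s < r) :
    ∃ g : ℂ → F, ContDiff ℝ (⊤ : ℕ∞) g ∧ ∀ y ∈ ball (0 : ℂ) s, g y = f y := by
  have hr : 0 < r := hs0.trans_lt hs
  set δ := (r ^ 2 - s ^ 2) / 2 with hδd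
  have hδ : 0 < δ := by
    have : s ^ 2 < r ^ 2 := by gcongr
    rw [hδd]; linarith
  refine ⟨fun y => boundaryCutoff r δ y • f y, contDiff_iff_contDiffAt.2 fun y => ?_, ?_⟩
  · by_cases hy : y ∈ ball (0 : ℂ) r
    · exact (contDiff_boundaryCutoff r δ).contDiffAt.smul
        (hf.contDiffAt (isOpen_ball.mem_nhds hy))
    · rw [mem_ball_zero_iff, not_lt] at hy
      have h1 : r ^ 2 ≤ ‖y‖ ^ 2 := by gcongr
      refine (contDiffAt_const (c := (0 : F))).congr_of_eventuallyEq ?_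
      filter_upwards [boundaryCutoff_eventuallyEq_zero hδ (y := y) (r := r) (by linarith)] with z hz
      rw [hz, zero_smul]
  · intro y hy
    rw [mem_ball_zero_iff] at hy
    have : ‖y‖ ^ 2 ≤ s ^ 2 := by gcongr
    simp only
    rw [boundaryCutoff_eq_one hδ (by rw [hδd]; linarith), one_smul]

/-- The cross terms in the Laplacian of a product `η • V`. -/
def laplacianRemainder (η : ℂ → ℝ) (V : ℂ → ℂ) (y : ℂ) : ℂ :=
  (2 : ℝ) • (fderiv ℝ η y 1 • fderiv ℝ V y 1 + fderiv ℝ η y Complex.I • fderiv ℝ V y Complex.I) +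
    planeLaplacian η y • V y

theorem norm_lt_of_sq_le_sub {r δ : ℝ} (hr : 0 < r) (hδ : 0 < δ) {y : ℂ}
    (hy : ‖y‖ ^ 2 ≤ r ^ 2 - δ) : ‖y‖ < r :=
  lt_of_pow_lt_pow_left₀ 2 hr.le (by linarith)

section Kernel

variable {C r δ ε : ℝ} {x : ℂ} {K : ℂ → ℂ}

theorem norm_boundaryCutoff_smul_mul_le (hδ : 0 < δ) (hx : ‖x‖ < r)
    (hK : ∀ y, ‖y‖ ^ 2 ≤ r ^ 2 - δ → K =ᶠ[nhds y] reflectedKernel r x) (y : ℂ) :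
    ‖boundaryCutoff r δ y • (truncatedCauchyKernel ε x y + K y)‖ * ‖y - x‖ ≤ 2 := by
  have hr : 0 < r := (norm_nonneg x).trans_lt hx
  rcases le_or_gt (r ^ 2 - δ) (‖y‖ ^ 2) with hy | hy
  · rw [boundaryCutoff_eq_zero hδ hy]
    simp
  · have hy' := norm_lt_of_sq_le_sub hr hδ hy.le
    have h1 := norm_truncatedCauchyKernel_mul_le ε x y
    have h2 := norm_reflectedKernel_mul_le hx hy'
    rw [(hK y hy.le).eq_of_nhds, norm_smul, Real.norm_eq_abs, boundaryCutoff,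
      abs_of_nonneg (Real.smoothTransition.nonneg _)]
    calc _ ≤ 1 * (‖truncatedCauchyKernel ε x y‖ + ‖reflectedKernel r x y‖) * ‖y - x‖ := by
          gcongr
          · exact Real.smoothTransition.le_one _
          · exact norm_add_le _ _
      _ ≤ 2 := by linarith

theorem norm_fderiv_truncatedCauchyKernel_add_mul_le
    (hC : ∀ t, |deriv Real.smoothTransition t| ≤ C) (hε : 0 < ε) (hKc : Differentiable ℝ K)
    (hx : ‖x‖ < r) {y : ℂ} (hy : ‖y‖ < r) (hK : K =ᶠ[nhds y] reflectedKernel r x) :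
    ‖fderiv ℝ (fun y => truncatedCauchyKernel ε x y + K y) y‖ * ‖y - x‖ ^ 2 ≤ 2 + 4 * C := by
  have h1 := norm_fderiv_truncatedCauchyKernel_mul_le hC hε x y
  have h2 := norm_fderiv_reflectedKernel_mul_le hx hy
  rw [fderiv_fun_add ((contDiff_truncatedCauchyKernel (n := 1) hε x).differentiable one_ne_zero y)
    (hKc y), hK.fderiv_eq]
  calc _ ≤ (‖fderiv ℝ (truncatedCauchyKernel ε x) y‖ + ‖fderiv ℝ (reflectedKernel r x) y‖) *
        ‖y - x‖ ^ 2 := by gcongr; exact norm_add_le _ _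
    _ ≤ _ := by linarith

theorem norm_truncatedCauchyKernel_add_mul_le (hε : 0 < ε)
    (hx : ‖x‖ < r) {y : ℂ} (hy : ‖y‖ < r) (hy' : r ^ 2 - 2 * δ ≤ ‖y‖ ^ 2)
    (hxy : 2 * ε ^ 2 ≤ ‖y - x‖ ^ 2) (hK : K =ᶠ[nhds y] reflectedKernel r x) :
    ‖truncatedCauchyKernel ε x y + K y‖ * ‖y - x‖ ^ 2 ≤ 2 * δ / r := by
  have hr : 0 < r := (norm_nonneg x).trans_lt hx
  have h1 := norm_truncatedCauchyKernel_add_reflectedKernel_le hε hx hy hxy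
  have h0 : 0 < ‖y - x‖ ^ 2 := lt_of_lt_of_le (by positivity) hxy
  rw [hK.eq_of_nhds]
  calc _ ≤ (r ^ 2 - ‖y‖ ^ 2) / (r * ‖y - x‖ ^ 2) * ‖y - x‖ ^ 2 := by gcongr
    _ = (r ^ 2 - ‖y‖ ^ 2) / r := by rw [← div_div, div_mul_cancel₀ _ h0.ne']
    _ ≤ _ := by gcongr; linarith

theorem norm_fderiv_boundaryCutoff_smul_mul_le
    (hC : ∀ t, |deriv Real.smoothTransition t| ≤ C) (hδ : 0 < δ) (hε : 0 < ε)
    (hKc : Differentiable ℝ K) (hx : ‖x‖ < r)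
    (hxs : ∀ y : ℂ, r ^ 2 - 2 * δ ≤ ‖y‖ ^ 2 → 2 * ε ^ 2 ≤ ‖y - x‖ ^ 2)
    (hK : ∀ y, ‖y‖ ^ 2 ≤ r ^ 2 - δ → K =ᶠ[nhds y] reflectedKernel r x) (y : ℂ) :
    ‖fderiv ℝ (fun y => boundaryCutoff r δ y • (truncatedCauchyKernel ε x y + K y)) y‖ *
      ‖y - x‖ ^ 2 ≤ 2 + 8 * C := by
  have hr : 0 < r := (norm_nonneg x).trans_lt hx
  have hC0 : 0 ≤ C := (abs_nonneg _).trans (hC 0)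
  rcases lt_or_ge (r ^ 2 - δ) (‖y‖ ^ 2) with hy | hy
  · have : (fun y => boundaryCutoff r δ y • (truncatedCauchyKernel ε x y + K y)) =ᶠ[nhds y]
        fun _ => 0 := by
      filter_upwards [boundaryCutoff_eventuallyEq_zero hδ hy] with z hz
      rw [hz, zero_smul]
    rw [this.fderiv_eq]
    simp only [fderiv_fun_const, Pi.zero_apply, norm_zero, zero_mul]
    positivity
  have hy' := norm_lt_of_sq_le_sub hr hδ hy
  have hVd : DifferentiableAt ℝ (fun y => truncatedCauchyKernel ε x y + K y) y :=
    ((contDiff_truncatedCauchyKernel (n := 1) hε x).differentiable one_ne_zero y).fun_add (hKc y)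
  have hηd : DifferentiableAt ℝ (boundaryCutoff r δ) y :=
    (contDiff_boundaryCutoff (n := 1) r δ).differentiable one_ne_zero y
  have h1 := norm_fderiv_truncatedCauchyKernel_add_mul_le hC hε hKc hx hy' (hK y hy)
  have hη1 : ‖boundaryCutoff r δ y‖ ≤ 1 := by
    rw [Real.norm_eq_abs, boundaryCutoff, abs_of_nonneg (Real.smoothTransition.nonneg _)]
    exact Real.smoothTransition.le_one _
  have h2 : ‖fderiv ℝ (boundaryCutoff r δ) y‖ *
      (‖truncatedCauchyKernel ε x y + K y‖ * ‖y - x‖ ^ 2) ≤ 4 * C := by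
    by_cases hs : r ^ 2 - 2 * δ ≤ ‖y‖ ^ 2 ∧ ‖y‖ ^ 2 ≤ r ^ 2 - δ
    · calc _ ≤ (C * (2 * δ⁻¹) * r) * (2 * δ / r) := by
            gcongr
            · exact (norm_fderiv_boundaryCutoff_le hC hδ r y).trans (by gcongr)
            · exact norm_truncatedCauchyKernel_add_mul_le hε hx hy' hs.1 (hxs y hs.1) (hK y hy)
        _ = 4 * C := by field_simp; ring
    · rw [fderiv_boundaryCutoff_eq_zero hδ hs, norm_zero, zero_mul]
      positivity
  rw [fderiv_fun_smul hηd hVd]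
  calc _ ≤ (1 * ‖fderiv ℝ (fun y => truncatedCauchyKernel ε x y + K y) y‖ +
        ‖fderiv ℝ (boundaryCutoff r δ) y‖ * ‖truncatedCauchyKernel ε x y + K y‖) *
        ‖y - x‖ ^ 2 := by
        gcongr
        refine (norm_add_le _ _).trans (add_le_add ?_ ?_)
        · rw [norm_smul]
          gcongr
        · rw [ContinuousLinearMap.norm_smulRight_apply]
    _ ≤ _ := by linarith

theorem laplacianRemainder_eq_zero (hδ : 0 < δ) (V : ℂ → ℂ) {y : ℂ}
    (hy : ¬(r ^ 2 - 2 * δ ≤ ‖y‖ ^ 2 ∧ ‖y‖ ^ 2 ≤ r ^ 2 - δ)) :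
    laplacianRemainder (boundaryCutoff r δ) V y = 0 := by
  simp [laplacianRemainder, fderiv_boundaryCutoff_eq_zero hδ hy,
    planeLaplacian_boundaryCutoff_eq_zero hδ hy]

theorem norm_laplacianRemainder_mul_le
    (hC : ∀ t, |deriv Real.smoothTransition t| ≤ C)
    (hC' : ∀ t, |deriv (deriv Real.smoothTransition) t| ≤ C) (hδ : 0 < δ) (hδr : δ ≤ r ^ 2)
    (hε : 0 < ε) (hKc : Differentiable ℝ K) (hx : ‖x‖ < r) {y : ℂ}
    (hys : r ^ 2 - 2 * δ ≤ ‖y‖ ^ 2) (hy : ‖y‖ ^ 2 ≤ r ^ 2 - δ) (hxy : 2 * ε ^ 2 ≤ ‖y - x‖ ^ 2)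
    (hK : K =ᶠ[nhds y] reflectedKernel r x) :
    ‖laplacianRemainder (boundaryCutoff r δ) (fun y => truncatedCauchyKernel ε x y + K y) y‖ *
      ‖y - x‖ ^ 2 ≤ δ⁻¹ * (8 * C * r * (4 + 4 * C)) := by
  have hr : 0 < r := (norm_nonneg x).trans_lt hx
  have hC0 : 0 ≤ C := (abs_nonneg _).trans (hC 0)
  have hy' := norm_lt_of_sq_le_sub hr hδ hy
  have h1 := norm_fderiv_truncatedCauchyKernel_add_mul_le hC hε hKc hx hy' hK
  have h2 := norm_truncatedCauchyKernel_add_mul_le hε hx hy' hys hxy hK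
  have h3 : ‖fderiv ℝ (boundaryCutoff r δ) y‖ ≤ C * (2 * δ⁻¹) * r :=
    (norm_fderiv_boundaryCutoff_le hC hδ r y).trans (by gcongr)
  have h4 : ‖planeLaplacian (boundaryCutoff r δ) y‖ ≤ C * (8 * δ⁻¹ ^ 2 * r ^ 2) := by
    have e1 : 4 * δ⁻¹ * C ≤ C * (4 * δ⁻¹ ^ 2 * r ^ 2) := by
      calc 4 * δ⁻¹ * C = C * (4 * δ⁻¹ ^ 2 * δ) := by field_simp
        _ ≤ _ := by gcongr
    have e2 : C * (4 * δ⁻¹ ^ 2 * ‖y‖ ^ 2) ≤ C * (4 * δ⁻¹ ^ 2 * r ^ 2) := by gcongr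
    refine (abs_planeLaplacian_boundaryCutoff_le hC hC' hδ r y).trans ?_
    linarith
  set V : ℂ → ℂ := fun y => truncatedCauchyKernel ε x y + K y with hV
  have h5 : ∀ v : ℂ, ‖v‖ = 1 → ‖fderiv ℝ (boundaryCutoff r δ) y v • fderiv ℝ V y v‖ ≤
      ‖fderiv ℝ (boundaryCutoff r δ) y‖ * ‖fderiv ℝ V y‖ := by
    intro v hv
    rw [norm_smul]
    gcongr
    · simpa [hv] using (fderiv ℝ (boundaryCutoff r δ) y).le_opNorm v
    · simpa [hv] using (fderiv ℝ V y).le_opNorm v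
  calc _ ≤ (2 * (‖fderiv ℝ (boundaryCutoff r δ) y‖ * ‖fderiv ℝ V y‖ +
        ‖fderiv ℝ (boundaryCutoff r δ) y‖ * ‖fderiv ℝ V y‖) +
        ‖planeLaplacian (boundaryCutoff r δ) y‖ * ‖V y‖) * ‖y - x‖ ^ 2 := by
        gcongr
        refine (norm_add_le _ _).trans (add_le_add ?_ (norm_smul _ _).le)
        rw [norm_smul, Real.norm_ofNat]
        gcongr
        exact (norm_add_le _ _).trans (add_le_add (h5 _ (by simp)) (h5 _ (by simp)))
    _ = 4 * (‖fderiv ℝ (boundaryCutoff r δ) y‖ * (‖fderiv ℝ V y‖ * ‖y - x‖ ^ 2)) +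
        ‖planeLaplacian (boundaryCutoff r δ) y‖ * (‖V y‖ * ‖y - x‖ ^ 2) := by ring
    _ ≤ 4 * ((C * (2 * δ⁻¹) * r) * (2 + 4 * C)) + C * (8 * δ⁻¹ ^ 2 * r ^ 2) * (2 * δ / r) := by
        gcongr
    _ = _ := by field_simp; ring

end Kernel

/-- Twice the holomorphic Wirtinger derivative of a real function. -/
def wirtinger (φ : ℂ → ℝ) (y : ℂ) : ℂ :=
  (fderiv ℝ φ y 1 : ℂ) - Complex.I * (fderiv ℝ φ y Complex.I : ℂ)

theorem continuous_wirtinger {φ : ℂ → ℝ} (hφ : ContDiff ℝ 1 φ) : Continuous (wirtinger φ) := by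
  have h := hφ.continuous_fderiv one_ne_zero
  unfold wirtinger
  fun_prop

theorem wirtinger_congr {φ ψ : ℂ → ℝ} {y : ℂ} (h : φ =ᶠ[nhds y] ψ) :
    wirtinger φ y = wirtinger ψ y := by
  rw [wirtinger, wirtinger, h.fderiv_eq]

theorem hasCompactSupport_wirtinger {φ : ℂ → ℝ} (hφ : HasCompactSupport φ) :
    HasCompactSupport (wirtinger φ) := by
  refine (hφ.fderiv (𝕜 := ℝ)).mono fun y hy => ?_
  rw [Function.mem_support] at hy ⊢
  contrapose! hy
  simp [wirtinger, hy]

theorem norm_fderiv_le_norm_wirtinger (φ : ℂ → ℝ) (y : ℂ) :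
    ‖fderiv ℝ φ y‖ ≤ ‖wirtinger φ y‖ := by
  refine ContinuousLinearMap.opNorm_le_bound _ (norm_nonneg _) fun v => ?_
  have h1 : fderiv ℝ φ y v = (wirtinger φ y * v).re := by
    have hv : v = v.re • (1 : ℂ) + v.im • Complex.I := by
      simp [Complex.re_add_im]
    conv_lhs => rw [hv, map_add, map_smul, map_smul]
    simp [wirtinger]
    ring
  rw [h1, ← norm_mul, Real.norm_eq_abs]
  exact Complex.abs_re_le_norm _

theorem integral_smul_planeLaplacian_truncatedCauchyKernel {ψ : ℂ → ℝ} (hψ : ContDiff ℝ 1 ψ)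
    {ε : ℝ} (hε : 0 < ε) (x : ℂ) :
    ∫ y, ψ y • planeLaplacian (truncatedCauchyKernel ε x) y =
      2 * ∫ y, ((ε ^ 2)⁻¹ * deriv Real.smoothTransition (-1 + (ε ^ 2)⁻¹ * ‖y - x‖ ^ 2)) •
        wirtinger ψ y := by
  set M : ℂ → ℂ := fun z => fderiv ℝ (truncatedCauchyKernel ε x) z 1 +
    Complex.I * fderiv ℝ (truncatedCauchyKernel ε x) z Complex.I with hM
  have hMe : ∀ z, M z = ((-2 * (ε ^ 2)⁻¹ *
      deriv Real.smoothTransition (-1 + (ε ^ 2)⁻¹ * ‖z - x‖ ^ 2) : ℝ) : ℂ) :=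
    fun z => fderiv_truncatedCauchyKernel_wirtinger hε x z
  have hK2 : ContDiff ℝ 2 (truncatedCauchyKernel ε x) := contDiff_truncatedCauchyKernel hε x
  have hMc : ContDiff ℝ 1 M :=
    (contDiff_fderiv_apply hK2 1).add (contDiff_const.mul (contDiff_fderiv_apply hK2 Complex.I))
  have hMs : HasCompactSupport M := by
    refine HasCompactSupport.intro (isCompact_closedBall x (2 * ε)) fun z hz => ?_
    rw [mem_closedBall, dist_eq_norm, not_le] at hz
    have h1 : (2 * ε) ^ 2 ≤ ‖z - x‖ ^ 2 := by gcongr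
    have h2 : (ε ^ 2)⁻¹ * (2 * ε) ^ 2 ≤ (ε ^ 2)⁻¹ * ‖z - x‖ ^ 2 := by gcongr
    have h3 : (ε ^ 2)⁻¹ * (2 * ε) ^ 2 = 4 := by field_simp; norm_num
    rw [hMe, deriv_smoothTransition_of_one_le (by linarith)]
    simp
  have hψ' : ∀ v, Continuous fun y => fderiv ℝ ψ y v := fun v =>
    (hψ.continuous_fderiv one_ne_zero).clm_apply continuous_const
  have hM' : ∀ v, Continuous fun y => fderiv ℝ M y v := fun v =>
    (hMc.continuous_fderiv one_ne_zero).clm_apply continuous_const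
  have hi1 : ∀ v, Integrable fun y => ψ y • fderiv ℝ M y v := fun v =>
    (hψ.continuous.smul (hM' v)).integrable_of_hasCompactSupport
      ((hMs.fderiv_apply (𝕜 := ℝ) v).smul_left)
  have hi2 : ∀ v, Integrable fun y => fderiv ℝ ψ y v • M y := fun v =>
    ((hψ' v).smul hMc.continuous).integrable_of_hasCompactSupport hMs.smul_left
  have e1 : ∫ y, ψ y • planeLaplacian (truncatedCauchyKernel ε x) y =
      (∫ y, ψ y • fderiv ℝ M y 1) - Complex.I * ∫ y, ψ y • fderiv ℝ M y Complex.I := by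
    rw [← integral_const_mul, ← integral_sub (hi1 1) ((hi1 Complex.I).const_mul _)]
    refine integral_congr_ae (.of_forall fun y => ?_)
    simp only [planeLaplacian_truncatedCauchyKernel hε x y, smul_sub, mul_smul_comm, ← hM]
  rw [e1, integral_smul_fderiv_of_hasCompactSupport hψ hMc hMs,
    integral_smul_fderiv_of_hasCompactSupport hψ hMc hMs, mul_neg, sub_neg_eq_add,
    neg_add_eq_sub, ← integral_const_mul, ← integral_const_mul,
    ← integral_sub ((hi2 Complex.I).const_mul _) (hi2 1)]
  refine integral_congr_ae (.of_forall fun y => ?_)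
  simp only [hMe, wirtinger, Complex.real_smul]
  push_cast
  ring

section Representation

variable {C r δ ε : ℝ} {x : ℂ} {K : ℂ → ℂ} {φ : ℂ → ℝ}

theorem integral_planeLaplacian_smul_boundaryCutoff_smul (hφ : ContDiff ℝ 2 φ) (hδ : 0 < δ)
    (hε : 0 < ε) (hx : ‖x‖ < r) (hKc : ContDiff ℝ 2 K)
    (hK : ∀ y, ‖y‖ ^ 2 ≤ r ^ 2 - δ → K =ᶠ[nhds y] reflectedKernel r x) :
    ∫ y, planeLaplacian φ y • boundaryCutoff r δ y • (truncatedCauchyKernel ε x y + K y) =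
      2 * (∫ y, ((ε ^ 2)⁻¹ * deriv Real.smoothTransition (-1 + (ε ^ 2)⁻¹ * ‖y - x‖ ^ 2)) •
        wirtinger (fun y => φ y * boundaryCutoff r δ y) y) +
      ∫ y, φ y • laplacianRemainder (boundaryCutoff r δ)
        (fun y => truncatedCauchyKernel ε x y + K y) y := by
  have hr : 0 < r := (norm_nonneg x).trans_lt hx
  have hη : ContDiff ℝ 2 (boundaryCutoff r δ) := contDiff_boundaryCutoff r δ
  have hηs : HasCompactSupport (boundaryCutoff r δ) := by
    refine HasCompactSupport.intro (isCompact_closedBall 0 r) fun y hy => ?_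
    rw [mem_closedBall_zero_iff, not_le] at hy
    have : r ^ 2 ≤ ‖y‖ ^ 2 := by gcongr
    exact boundaryCutoff_eq_zero hδ (by linarith)
  have hK1 : ContDiff ℝ 2 (truncatedCauchyKernel ε x) := contDiff_truncatedCauchyKernel hε x
  have hV : ContDiff ℝ 2 fun y => truncatedCauchyKernel ε x y + K y := hK1.add hKc
  have hpt : ∀ y, φ y • planeLaplacian (fun y => boundaryCutoff r δ y •
      (truncatedCauchyKernel ε x y + K y)) y =
      (φ y * boundaryCutoff r δ y) • planeLaplacian (truncatedCauchyKernel ε x) y +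
      φ y • laplacianRemainder (boundaryCutoff r δ)
        (fun y => truncatedCauchyKernel ε x y + K y) y := by
    intro y
    have h0 : boundaryCutoff r δ y • planeLaplacian K y = 0 := by
      rcases le_or_gt (r ^ 2 - δ) (‖y‖ ^ 2) with hy | hy
      · rw [boundaryCutoff_eq_zero hδ hy, zero_smul]
      · rw [planeLaplacian_congr (hK y hy.le),
          planeLaplacian_reflectedKernel hx (norm_lt_of_sq_le_sub hr hδ hy.le), smul_zero]
    rw [planeLaplacian_smul hη hV, planeLaplacian_add hK1 hKc, smul_add (boundaryCutoff r δ y), h0,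
      add_zero, smul_add, ← mul_smul]
    rfl
  have hηV : ContDiff ℝ 2 fun y => boundaryCutoff r δ y • (truncatedCauchyKernel ε x y + K y) :=
    hη.smul hV
  have hφη : ContDiff ℝ 1 fun y => φ y * boundaryCutoff r δ y :=
    (hφ.mul hη).of_le (by norm_num)
  rw [integral_planeLaplacian_smul hφ hηV hηs.smul_right,
    ← integral_smul_planeLaplacian_truncatedCauchyKernel hφη hε x, ← integral_add]
  · exact integral_congr_ae (.of_forall hpt)
  · exact ((hφ.continuous.mul hη.continuous).smul
      (continuous_planeLaplacian hK1)).integrable_of_hasCompactSupport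
      (hηs.mul_left (f := φ)).smul_right
  · have hc : Continuous (laplacianRemainder (boundaryCutoff r δ)
        fun y => truncatedCauchyKernel ε x y + K y) := by
      have h1 := hη.continuous_fderiv two_ne_zero
      have h2 := hV.continuous_fderiv two_ne_zero
      have h3 := continuous_planeLaplacian hη
      have h4 := hV.continuous
      unfold laplacianRemainder
      fun_prop
    refine (hφ.continuous.smul hc).integrable_of_hasCompactSupport ?_
    refine HasCompactSupport.intro (isCompact_closedBall 0 r) fun y hy => ?_
    rw [mem_closedBall_zero_iff, not_le] at hy
    have : r ^ 2 ≤ ‖y‖ ^ 2 := by gcongr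
    rw [Pi.smul_apply', laplacianRemainder_eq_zero hδ _ (by intro h; linarith [h.2]), smul_zero]

theorem enorm_integral_smul_laplacianRemainder_le
    (hC : ∀ t, |deriv Real.smoothTransition t| ≤ C)
    (hC' : ∀ t, |deriv (deriv Real.smoothTransition) t| ≤ C) (hδ : 0 < δ) (hδr : 2 * δ ≤ r ^ 2)
    (hε : 0 < ε) (hx : ‖x‖ < r) (hKc : Differentiable ℝ K)
    (hK : ∀ y, ‖y‖ ^ 2 ≤ r ^ 2 - δ → K =ᶠ[nhds y] reflectedKernel r x) {e ω : ℝ} (he : 0 < e)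
    (hεe : 2 * ε ^ 2 ≤ e ^ 2) (hxs : ∀ y : ℂ, r ^ 2 - 2 * δ ≤ ‖y‖ ^ 2 → e ≤ ‖y - x‖)
    (hω : 0 ≤ ω) (hφ : ∀ y : ℂ, r ^ 2 - 2 * δ ≤ ‖y‖ ^ 2 → ‖y‖ ^ 2 ≤ r ^ 2 - δ → |φ y| ≤ ω) :
    ‖∫ y, φ y • laplacianRemainder (boundaryCutoff r δ)
        (fun y => truncatedCauchyKernel ε x y + K y) y‖ₑ ≤
      ENNReal.ofReal (π * (8 * C * r * (4 + 4 * C)) / e ^ 2 * ω) := by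
  have hr : 0 < r := (norm_nonneg x).trans_lt hx
  have hC0 : 0 ≤ C := (abs_nonneg _).trans (hC 0)
  set S : Set ℂ := {y | r ^ 2 - 2 * δ ≤ ‖y‖ ^ 2 ∧ ‖y‖ ^ 2 ≤ r ^ 2 - δ} with hS
  have hn : Measurable fun y : ℂ => ‖y‖ ^ 2 := by fun_prop
  have hSm : MeasurableSet S :=
    (measurableSet_le measurable_const hn).inter (measurableSet_le hn measurable_const)
  have hpt : ∀ y, ‖φ y • laplacianRemainder (boundaryCutoff r δ)
      (fun y => truncatedCauchyKernel ε x y + K y) y‖ₑ ≤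
      S.indicator (fun _ => ENNReal.ofReal (ω * (δ⁻¹ * (8 * C * r * (4 + 4 * C)) / e ^ 2))) y := by
    intro y
    by_cases hy : y ∈ S
    · have hxy : e ^ 2 ≤ ‖y - x‖ ^ 2 := pow_le_pow_left₀ he.le (hxs y hy.1) 2
      have h1 := norm_laplacianRemainder_mul_le hC hC' hδ (by linarith) hε hKc hx hy.1 hy.2
        (hεe.trans hxy) (hK y hy.2)
      rw [Set.indicator_of_mem hy, ← ofReal_norm, norm_smul]
      refine ENNReal.ofReal_le_ofReal (mul_le_mul (hφ y hy.1 hy.2) ?_ (norm_nonneg _) hω)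
      rw [le_div_iff₀ (by positivity)]
      exact (mul_le_mul_of_nonneg_left hxy (norm_nonneg _)).trans h1
    · rw [laplacianRemainder_eq_zero hδ _ hy]
      simp
  calc _ ≤ ∫⁻ y, _ := enorm_integral_le_lintegral_enorm _
    _ ≤ ∫⁻ y, S.indicator (fun _ =>
        ENNReal.ofReal (ω * (δ⁻¹ * (8 * C * r * (4 + 4 * C)) / e ^ 2))) y := lintegral_mono hpt
    _ = ENNReal.ofReal (ω * (δ⁻¹ * (8 * C * r * (4 + 4 * C)) / e ^ 2)) * volume S := by
        rw [lintegral_indicator_const hSm]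
    _ ≤ ENNReal.ofReal (ω * (δ⁻¹ * (8 * C * r * (4 + 4 * C)) / e ^ 2)) *
        ENNReal.ofReal (π * (r ^ 2 - δ - (r ^ 2 - 2 * δ))) := by
        gcongr
        exact volume_annulus_le (by linarith) (by linarith)
    _ = _ := by
        rw [← ENNReal.ofReal_mul (by positivity)]
        congr 1
        field_simp
        ring

end Representation

theorem enorm_wirtinger_le_of_contDiff {c₀ C r δ e ω : ℝ} {x : ℂ} {K : ℂ → ℂ} {a b φ : ℂ → ℝ}
    (h₀ : ∀ (g : ℂ → ℂ) (x : ℂ), Integrable g → Continuous g →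
      Filter.Tendsto (fun c : ℝ => ∫ y, (c ^ 2 * deriv Real.smoothTransition
        (-1 + c ^ 2 * ‖y - x‖ ^ 2)) • g y) Filter.atTop (nhds (c₀ • g x)))
    (hC : ∀ t, |deriv Real.smoothTransition t| ≤ C)
    (hC' : ∀ t, |deriv (deriv Real.smoothTransition) t| ≤ C) (hδ : 0 < δ) (hr : 0 < r)
    (hx : ‖x‖ ^ 2 < r ^ 2 - 2 * δ) (ha : ContDiff ℝ 2 a) (hb : ContDiff ℝ 2 b)
    (hφ : ContDiff ℝ 2 φ) (hKc : ContDiff ℝ 2 K)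
    (hK : ∀ y, ‖y‖ ^ 2 ≤ r ^ 2 - δ → K =ᶠ[nhds y] reflectedKernel r x)
    (hlap : ∀ y, ‖y‖ ^ 2 ≤ r ^ 2 - δ → planeLaplacian φ y = jacobian a b y) {f g : ℂ → ℝ≥0∞}
    (hf : ∀ y, ‖y‖ ^ 2 ≤ r ^ 2 - δ → ‖fderiv ℝ a y‖ₑ ≤ f y)
    (hg : ∀ y, ‖y‖ ^ 2 ≤ r ^ 2 - δ → ‖fderiv ℝ b y‖ₑ ≤ g y) (he : 0 < e)
    (hxs : ∀ y : ℂ, r ^ 2 - 2 * δ ≤ ‖y‖ ^ 2 → e ≤ ‖y - x‖)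
    (hω : 0 ≤ ω) (hφω : ∀ y : ℂ, r ^ 2 - 2 * δ ≤ ‖y‖ ^ 2 → ‖y‖ ^ 2 ≤ r ^ 2 - δ → |φ y| ≤ ω) :
    ‖2 * (c₀ • wirtinger φ x)‖ₑ ≤
      ENNReal.ofReal (2048 * (16 * ((1 + 10 * C) * (2 + 8 * C)))) * wentePotential f g x +
        ENNReal.ofReal (π * (8 * C * r * (4 + 4 * C)) / e ^ 2 * ω) := by
  have hC0 : 0 ≤ C := (abs_nonneg _).trans (hC 0)
  have hxδ : ‖x‖ ^ 2 ≤ r ^ 2 - δ := by linarith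
  have hxr : ‖x‖ < r := norm_lt_of_sq_le_sub hr hδ hxδ
  have hδr : 2 * δ ≤ r ^ 2 := by linarith [sq_nonneg ‖x‖]
  have hmem : ∀ y : ℂ, y ∈ closedBall 0 (Real.sqrt (r ^ 2 - δ)) ↔ ‖y‖ ^ 2 ≤ r ^ 2 - δ := fun y => by
    rw [mem_closedBall_zero_iff, Real.le_sqrt (norm_nonneg _) (by linarith)]
  have hη : ContDiff ℝ 2 (boundaryCutoff r δ) := contDiff_boundaryCutoff r δ
  have hηs : HasCompactSupport (boundaryCutoff r δ) :=
    (isCompact_closedBall (0 : ℂ) (Real.sqrt (r ^ 2 - δ))).of_isClosed_subset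
      (isClosed_tsupport _) fun y hy => (hmem y).2 (tsupport_boundaryCutoff_subset hδ hy)
  have hψ : ContDiff ℝ 1 fun y => φ y * boundaryCutoff r δ y := (hφ.mul hη).of_le (by norm_num)
  have hψx : wirtinger (fun y => φ y * boundaryCutoff r δ y) x = wirtinger φ x := by
    refine wirtinger_congr ?_
    filter_upwards [boundaryCutoff_eventuallyEq_one hδ hx] with y hy
    rw [hy, mul_one]
  have hlim := h₀ (wirtinger fun y => φ y * boundaryCutoff r δ y) x
    ((continuous_wirtinger hψ).integrable_of_hasCompactSupport
      (hasCompactSupport_wirtinger hηs.mul_left)) (continuous_wirtinger hψ)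
  rw [hψx] at hlim
  refine le_of_tendsto (hlim.const_mul 2).enorm ?_
  filter_upwards [Filter.eventually_ge_atTop (2 / e), Filter.eventually_gt_atTop 0] with c hc hc0
  have hε : 0 < c⁻¹ := inv_pos.2 hc0
  have hεe : 2 * c⁻¹ ^ 2 ≤ e ^ 2 := by
    have h1 : 2 * c⁻¹ ≤ e := by
      rw [div_le_iff₀ he] at hc
      rw [← div_eq_mul_inv, div_le_iff₀ hc0]
      linarith
    have h2 : (2 * c⁻¹) ^ 2 ≤ e ^ 2 := by gcongr
    nlinarith [sq_nonneg c⁻¹]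
  have hrep := integral_planeLaplacian_smul_boundaryCutoff_smul hφ hδ hε hxr hKc hK
  have hR := enorm_integral_smul_laplacianRemainder_le (φ := φ) hC hC' hδ hδr hε hxr
    (hKc.differentiable two_ne_zero) hK he hεe hxs hω hφω
  have hjac : ∫ y, planeLaplacian φ y • boundaryCutoff r δ y •
      (truncatedCauchyKernel c⁻¹ x y + K y) = ∫ y, jacobian a b y • boundaryCutoff r δ y •
      (truncatedCauchyKernel c⁻¹ x y + K y) := by
    refine integral_congr_ae (.of_forall fun y => ?_)
    rcases le_or_gt (‖y‖ ^ 2) (r ^ 2 - δ) with hy | hy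
    · simp only [hlap y hy]
    · simp only [boundaryCutoff_eq_zero hδ hy.le, zero_smul, smul_zero]
  have hW : ContDiff ℝ 1 fun y =>
      boundaryCutoff r δ y • (truncatedCauchyKernel c⁻¹ x y + K y) :=
    (hη.of_le (by norm_num)).smul
      ((contDiff_truncatedCauchyKernel (n := 1) hε x).add (hKc.of_le (by norm_num)))
  have hxs' : ∀ y : ℂ, r ^ 2 - 2 * δ ≤ ‖y‖ ^ 2 → 2 * c⁻¹ ^ 2 ≤ ‖y - x‖ ^ 2 := fun y hy =>
    hεe.trans (pow_le_pow_left₀ he.le (hxs y hy) 2)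
  have hmain := enorm_integral_jacobian_smul_le_wentePotential hC ha hb hW
    (mem_closedBall_zero_iff.1 ((hmem x).2 hxδ))
    (fun y hy => (hmem y).2 (tsupport_boundaryCutoff_subset hδ
      (tsupport_smul_subset_left (boundaryCutoff r δ) _ hy)))
    (A := 2 + 8 * C)
    (fun y => (norm_boundaryCutoff_smul_mul_le hδ hxr hK y).trans (by linarith))
    (norm_fderiv_boundaryCutoff_smul_mul_le hC hδ hε (hKc.differentiable two_ne_zero) hxr hxs' hK)
    (fun y hy => hf y ((hmem y).1 hy)) (fun y hy => hg y ((hmem y).1 hy))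
  rw [hjac, inv_pow, inv_inv] at hrep
  rw [← sub_eq_of_eq_add hrep]
  exact enorm_sub_le.trans (add_le_add hmain hR)

/-- Pointwise bound of the gradient of the solution of `Δφ = ∇^⊥a · ∇b`. -/
theorem exists_enorm_fderiv_le_wentePotential : ∃ C₀ : ℝ≥0∞, C₀ ≠ ⊤ ∧
    ∀ (r : ℝ) (a b φ : ℂ → ℝ), ContDiffOn ℝ (⊤ : ℕ∞) a (ball 0 r) →
      ContDiffOn ℝ (⊤ : ℕ∞) b (ball 0 r) → ContDiffOn ℝ (⊤ : ℕ∞) φ (ball 0 r) →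
      ContinuousOn φ (closedBall 0 r) → (∀ y ∈ sphere (0 : ℂ) r, φ y = 0) →
      (∀ y ∈ ball (0 : ℂ) r, planeLaplacian φ y = jacobian a b y) → ∀ x ∈ ball (0 : ℂ) r,
      ‖fderiv ℝ φ x‖ₑ ≤ C₀ * wentePotential ((ball 0 r).indicator fun y => ‖fderiv ℝ a y‖ₑ)
        ((ball 0 r).indicator fun y => ‖fderiv ℝ b y‖ₑ) x := by
  obtain ⟨c₀, hc₀, h₀⟩ := exists_tendsto_integral_deriv_smoothTransition
  obtain ⟨C, hC0, hC, hC'⟩ := exists_deriv_smoothTransition_le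
  refine ⟨ENNReal.ofReal (2 * c₀)⁻¹ *
    ENNReal.ofReal (2048 * (16 * ((1 + 10 * C) * (2 + 8 * C)))),
    ENNReal.mul_ne_top ENNReal.ofReal_ne_top ENNReal.ofReal_ne_top, ?_⟩
  intro r a b φ ha hb hφ hφc hφ0 hlap x hx
  rw [mem_ball_zero_iff] at hx
  have hr : 0 < r := (norm_nonneg x).trans_lt hx
  set f := (ball (0 : ℂ) r).indicator fun y => ‖fderiv ℝ a y‖ₑ with hf
  set g := (ball (0 : ℂ) r).indicator fun y => ‖fderiv ℝ b y‖ₑ with hg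
  set e := (r - ‖x‖) / 2 with he
  have he0 : 0 < e := by rw [he]; linarith
  have key : ∀ ω : ℝ, 0 < ω → ‖2 * (c₀ • wirtinger φ x)‖ₑ ≤
      ENNReal.ofReal (2048 * (16 * ((1 + 10 * C) * (2 + 8 * C)))) * wentePotential f g x +
        ENNReal.ofReal (π * (8 * C * r * (4 + 4 * C)) / e ^ 2 * ω) := by
    intro ω hω
    obtain ⟨t₀, ht₀, hsub⟩ := exists_lt_subset_ball (x := (0 : ℂ)) (r := r)
      (s := closedBall 0 r ∩ φ ⁻¹' {u | ω ≤ |u|})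
      (hφc.preimage_isClosed_of_isClosed isClosed_closedBall
        (isClosed_le continuous_const continuous_abs)) (by
        rintro y ⟨hy1, hy2⟩
        refine mem_ball.2 (lt_of_le_of_ne (mem_closedBall.1 hy1) fun h => ?_)
        have : ω ≤ |φ y| := hy2
        rw [hφ0 y (mem_sphere.2 h), abs_zero] at this
        linarith)
    set t := max t₀ ((r + ‖x‖) / 2) with ht
    have htr : t < r := max_lt ht₀ (by linarith)
    have htx : (r + ‖x‖) / 2 ≤ t := le_max_right _ _
    have ht0 : 0 < t := lt_of_lt_of_le (by positivity) htx
    have ht2 : t ^ 2 < r ^ 2 := by gcongr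
    set δ := (r ^ 2 - t ^ 2) / 2 with hδd
    have hδ : 0 < δ := by rw [hδd]; linarith
    have hδt : r ^ 2 - 2 * δ = t ^ 2 := by rw [hδd]; ring
    set ρ := Real.sqrt (r ^ 2 - δ) with hρ
    have hρ2 : 0 ≤ r ^ 2 - δ := by nlinarith [sq_nonneg t]
    have hρr : ρ < r := by
      rw [hρ, Real.sqrt_lt' hr]; linarith
    have hnhds : ∀ y : ℂ, ‖y‖ ^ 2 ≤ r ^ 2 - δ → ball (0 : ℂ) ((ρ + r) / 2) ∈ nhds y := by
      intro y hy
      refine isOpen_ball.mem_nhds (mem_ball_zero_iff.2 ?_)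
      have : ‖y‖ ≤ ρ := by rwa [hρ, Real.le_sqrt (norm_nonneg _) hρ2]
      linarith
    have hs0 : 0 ≤ (ρ + r) / 2 := by positivity
    have hsr : (ρ + r) / 2 < r := by linarith
    have hext : ∀ {F : Type} [NormedAddCommGroup F] [NormedSpace ℝ F] (h : ℂ → F),
        ContDiffOn ℝ (⊤ : ℕ∞) h (ball 0 r) → ∃ h' : ℂ → F, ContDiff ℝ 2 h' ∧
          ∀ y, ‖y‖ ^ 2 ≤ r ^ 2 - δ → h' =ᶠ[nhds y] h := by
      intro F _ _ h hh
      obtain ⟨h', h1, h2⟩ := exists_contDiff_eqOn_ball hh hs0 hsr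
      exact ⟨h', contDiff_infty.1 h1 2, fun y hy =>
        Filter.eventually_of_mem (hnhds y hy) h2⟩
    obtain ⟨a', ha', hae⟩ := hext a ha
    obtain ⟨b', hb', hbe⟩ := hext b hb
    obtain ⟨φ', hφ', hφe⟩ := hext φ hφ
    obtain ⟨K, hKc, hK⟩ := hext _ (contDiffOn_reflectedKernel (n := ⊤) hx)
    have hball : ∀ y : ℂ, ‖y‖ ^ 2 ≤ r ^ 2 - δ → y ∈ ball (0 : ℂ) r := fun y hy =>
      mem_ball_zero_iff.2 (norm_lt_of_sq_le_sub hr hδ hy)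
    have hxt : ‖x‖ ^ 2 < r ^ 2 - 2 * δ := by
      rw [hδt]
      have : ‖x‖ < t := by linarith
      gcongr
    rw [← wirtinger_congr (hφe x (by linarith))]
    refine enorm_wirtinger_le_of_contDiff h₀ hC hC' hδ hr hxt ha' hb' hφ' hKc hK ?_ ?_ ?_ he0 ?_
      hω.le ?_
    · intro y hy
      rw [planeLaplacian_congr (hφe y hy), hlap y (hball y hy), jacobian, jacobian,
        (hae y hy).fderiv_eq, (hbe y hy).fderiv_eq]
    · intro y hy
      rw [(hae y hy).fderiv_eq, hf, Set.indicator_of_mem (hball y hy)]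
    · intro y hy
      rw [(hbe y hy).fderiv_eq, hg, Set.indicator_of_mem (hball y hy)]
    · intro y hy
      rw [hδt] at hy
      have h1 : t ≤ ‖y‖ := le_of_sq_le_sq hy (norm_nonneg _)
      have h2 := norm_sub_norm_le y x
      rw [he]
      linarith
    · intro y hy1 hy2
      rw [hδt] at hy1
      have h1 : t ≤ ‖y‖ := le_of_sq_le_sq hy1 (norm_nonneg _)
      rw [(hφe y hy2).eq_of_nhds]
      by_contra h
      have h2 := hsub ⟨ball_subset_closedBall (hball y hy2), (not_le.1 h).le⟩
      rw [mem_ball_zero_iff] at h2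
      linarith [le_max_left t₀ ((r + ‖x‖) / 2)]
  have hlim : ‖2 * (c₀ • wirtinger φ x)‖ₑ ≤
      ENNReal.ofReal (2048 * (16 * ((1 + 10 * C) * (2 + 8 * C)))) * wentePotential f g x := by
    set M := π * (8 * C * r * (4 + 4 * C)) / e ^ 2 with hM
    have hM0 : 0 ≤ M := by positivity
    refine ENNReal.le_of_forall_pos_le_add fun κ hκ _ => ?_
    refine (key (κ / (M + 1)) (by positivity)).trans ?_
    gcongr
    rw [← ENNReal.ofReal_coe_nnreal]
    refine ENNReal.ofReal_le_ofReal ?_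
    rw [mul_div_assoc', div_le_iff₀ (by positivity)]
    nlinarith [κ.2]
  have hw : wirtinger φ x = (2 * c₀)⁻¹ • (2 * (c₀ • wirtinger φ x)) := by
    rw [Complex.real_smul, Complex.real_smul]
    have : (c₀ : ℂ) ≠ 0 := by exact_mod_cast hc₀.ne'
    push_cast
    field_simp
  calc ‖fderiv ℝ φ x‖ₑ ≤ ‖wirtinger φ x‖ₑ := by
        rw [← ofReal_norm, ← ofReal_norm]
        exact ENNReal.ofReal_le_ofReal (norm_fderiv_le_norm_wirtinger φ x)
    _ = ENNReal.ofReal (2 * c₀)⁻¹ * ‖2 * (c₀ • wirtinger φ x)‖ₑ := by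
        conv_lhs => rw [hw]
        rw [enorm_smul, Real.enorm_eq_ofReal (by positivity)]
    _ ≤ _ := by
        rw [mul_assoc]
        exact mul_le_mul_right hlim _

/-- The isometry `ℂ → ℝ²` sending `0` to `c`. -/
def planeChart (c : E2) (z : ℂ) : E2 := c + Complex.orthonormalBasisOneI.repr z

theorem measurePreserving_planeChart (c : E2) : MeasurePreserving (planeChart c) :=
  (measurePreserving_add_left volume c).comp
    Complex.orthonormalBasisOneI.repr.measurePreserving

theorem measurableEmbedding_planeChart (c : E2) : MeasurableEmbedding (planeChart c) :=
  (Complex.orthonormalBasisOneI.repr.toHomeomorph.trans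
    (Homeomorph.addLeft c)).measurableEmbedding

theorem contDiff_planeChart (c : E2) : ContDiff ℝ (⊤ : ℕ∞) (planeChart c) :=
  contDiff_const.add Complex.orthonormalBasisOneI.repr.toContinuousLinearEquiv.contDiff

theorem dist_planeChart (c : E2) (z : ℂ) : dist (planeChart c z) c = ‖z‖ := by
  rw [planeChart, dist_eq_norm, add_sub_cancel_left, LinearIsometryEquiv.norm_map]

theorem planeChart_preimage_ball (c : E2) (r : ℝ) : planeChart c ⁻¹' ball c r = ball 0 r := by
  ext z
  rw [Set.mem_preimage, mem_ball, dist_planeChart, mem_ball_zero_iff]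

theorem planeChart_mem_ball_iff {c : E2} {r : ℝ} {z : ℂ} :
    planeChart c z ∈ ball c r ↔ z ∈ ball (0 : ℂ) r := by
  rw [mem_ball, dist_planeChart, mem_ball_zero_iff]

theorem fderiv_comp_planeChart (c : E2) (f : E2 → ℝ) (z : ℂ) :
    fderiv ℝ (f ∘ planeChart c) z = (fderiv ℝ f (planeChart c z)).comp
      (Complex.orthonormalBasisOneI.repr.toContinuousLinearEquiv : ℂ →L[ℝ] E2) := by
  have h := Complex.orthonormalBasisOneI.repr.toContinuousLinearEquiv.comp_right_fderiv
    (f := fun y => f (c + y)) (x := z)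
  rw [fderiv_comp_add_left] at h
  exact h

theorem norm_fderiv_comp_planeChart (c : E2) (f : E2 → ℝ) (z : ℂ) :
    ‖fderiv ℝ (f ∘ planeChart c) z‖ = ‖fderiv ℝ f (planeChart c z)‖ := by
  rw [fderiv_comp_planeChart]
  exact ContinuousLinearMap.opNorm_comp_linearIsometryEquiv _ Complex.orthonormalBasisOneI.repr

theorem fderiv_comp_planeChart_one (c : E2) (f : E2 → ℝ) (z : ℂ) :
    fderiv ℝ (f ∘ planeChart c) z 1 = pd 0 f (planeChart c z) := by
  rw [fderiv_comp_planeChart, pd]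
  have h : Complex.orthonormalBasisOneI.repr 1 = EuclideanSpace.single (0 : Fin 2) (1 : ℝ) := by
    simpa using Complex.orthonormalBasisOneI.repr_self 0
  exact congrArg _ h

theorem fderiv_comp_planeChart_I (c : E2) (f : E2 → ℝ) (z : ℂ) :
    fderiv ℝ (f ∘ planeChart c) z Complex.I = pd 1 f (planeChart c z) := by
  rw [fderiv_comp_planeChart, pd]
  have h : Complex.orthonormalBasisOneI.repr Complex.I =
      EuclideanSpace.single (1 : Fin 2) (1 : ℝ) := by
    simpa using Complex.orthonormalBasisOneI.repr_self 1
  exact congrArg _ h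

theorem planeLaplacian_comp_planeChart (c : E2) (f : E2 → ℝ) (z : ℂ) :
    planeLaplacian (f ∘ planeChart c) z = lap f (planeChart c z) := by
  have h1 : (fun z => fderiv ℝ (f ∘ planeChart c) z 1) = pd 0 f ∘ planeChart c :=
    funext fun z => fderiv_comp_planeChart_one c f z
  have h2 : (fun z => fderiv ℝ (f ∘ planeChart c) z Complex.I) = pd 1 f ∘ planeChart c :=
    funext fun z => fderiv_comp_planeChart_I c f z
  rw [planeLaplacian, h1, h2, fderiv_comp_planeChart_one, fderiv_comp_planeChart_I, lap]

theorem volume_planeChart (c : E2) (r : ℝ) (P : E2 → Prop) :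
    volume {x ∈ ball c r | P x} = volume {z ∈ ball (0 : ℂ) r | P (planeChart c z)} := by
  rw [← (measurePreserving_planeChart c).measure_preimage_emb (measurableEmbedding_planeChart c)]
  congr 1
  ext z
  exact and_congr planeChart_mem_ball_iff Iff.rfl

/-- Wente-type estimate with `∇a ∈ L^p`, `∇b ∈ L^{p',∞}`:
`‖∇φ‖_{L^{2,p}} ≤ C_q ‖∇a‖_{L^p} ‖∇b‖_{L^{p',∞}}` for `p ∈ [2,q]`, `p' = p/(p-1)`,
with `C_q` depending only on `q ∈ (2,∞)`. -/
theorem wente_L2p (q : ℝ) (hq : 2 < q) :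
    ∃ C > (0:ℝ), ∀ p ∈ Set.Icc (2:ℝ) q, ∀ (c : E2) (r : ℝ), 0 < r →
      ∀ a b φ : E2 → ℝ,
      ContDiffOn ℝ (⊤ : ℕ∞) a (ball c r) → ContDiffOn ℝ (⊤ : ℕ∞) b (ball c r) →
      ContDiffOn ℝ (⊤ : ℕ∞) φ (ball c r) → ContinuousOn φ (closedBall c r) →
      IntegrableOn (fun x => ‖fderiv ℝ a x‖ ^ p) (ball c r) →
      lorentzNorm (p / (p - 1)) ⊤ (fun x => ‖fderiv ℝ b x‖) (ball c r) ≠ ⊤ →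
      (∀ x ∈ ball c r, lap φ x = pd 0 a x * pd 1 b x - pd 1 a x * pd 0 b x) →
      (∀ x ∈ sphere c r, φ x = 0) →
      lorentzNorm 2 (ENNReal.ofReal p) (fun x => ‖fderiv ℝ φ x‖) (ball c r) ≤
        ENNReal.ofReal (C * (∫ x in ball c r, ‖fderiv ℝ a x‖ ^ p) ^ (1 / p)) *
          lorentzNorm (p / (p - 1)) ⊤ (fun x => ‖fderiv ℝ b x‖) (ball c r) := by
  obtain ⟨C₁, hC₁, hLor⟩ := exists_lintegral_lorentz_wentePotential_le hq
  obtain ⟨C₀, hC₀, hpt⟩ := exists_enorm_fderiv_le_wentePotential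
  refine ⟨(C₁ * C₀).toReal + 1, by positivity, ?_⟩
  intro p hp c r hr a b φ ha hb hφ hφc hai _ hlap hφ0
  have hp0 : 0 < p := by linarith [hp.1]
  have hmaps : Set.MapsTo (planeChart c) (ball 0 r) (ball c r) := fun z hz =>
    planeChart_mem_ball_iff.2 hz
  have hT := contDiff_planeChart c
  have hgrad := hpt r (a ∘ planeChart c) (b ∘ planeChart c) (φ ∘ planeChart c)
    (ha.comp hT.contDiffOn hmaps) (hb.comp hT.contDiffOn hmaps) (hφ.comp hT.contDiffOn hmaps)
    (hφc.comp hT.continuous.continuousOn fun z hz => by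
      rw [mem_closedBall, dist_planeChart]; exact mem_closedBall_zero_iff.1 hz)
    (fun z hz => hφ0 _ (by rw [mem_sphere, dist_planeChart]; exact mem_sphere_zero_iff_norm.1 hz))
    (fun z hz => by
      rw [planeLaplacian_comp_planeChart, hlap _ (hmaps hz), jacobian, fderiv_comp_planeChart_one,
        fderiv_comp_planeChart_one, fderiv_comp_planeChart_I, fderiv_comp_planeChart_I,
        smul_eq_mul, smul_eq_mul])
  set f := (ball (0 : ℂ) r).indicator fun z => ‖fderiv ℝ (a ∘ planeChart c) z‖ₑ with hf
  set g := (ball (0 : ℂ) r).indicator fun z => ‖fderiv ℝ (b ∘ planeChart c) z‖ₑ with hg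
  have hfm : Measurable f := (measurable_fderiv ℝ _).enorm.indicator measurableSet_ball
  have hgm : Measurable g := (measurable_fderiv ℝ _).enorm.indicator measurableSet_ball
  set B := lorentzNorm (p / (p - 1)) ⊤ (fun x => ‖fderiv ℝ b x‖) (ball c r) with hB
  set A := ∫ x in ball c r, ‖fderiv ℝ a x‖ ^ p with hA
  have hexp : 1 / (p / (p - 1)) = 1 - p⁻¹ := by field_simp
  have hB' : ∀ t : ℝ≥0, t * volume {z | (t : ℝ≥0∞) < g z} ^ (1 - p⁻¹) ≤ B := by
    intro t
    rw [hB, lorentzNorm, if_pos rfl, wnorm, ← hexp]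
    refine le_trans (le_of_eq ?_) (le_iSup _ t)
    congr 2
    rw [volume_planeChart]
    congr 1
    ext z
    rw [Set.mem_ofPred_eq, Set.mem_ofPred_eq, hg]
    by_cases hz : z ∈ ball (0 : ℂ) r
    · rw [Set.indicator_of_mem hz, ← norm_fderiv_comp_planeChart, abs_norm, ← ofReal_norm,
        ← ENNReal.ofReal_coe_nnreal, ENNReal.ofReal_lt_ofReal_iff_of_nonneg t.coe_nonneg]
      exact (and_iff_right hz).symm
    · simp [hz]
  have hA' : (∫⁻ z, f z ^ p) ^ p⁻¹ = ENNReal.ofReal (A ^ (1 / p)) := by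
    have h1 : ∫⁻ z, f z ^ p = ENNReal.ofReal A := by
      rw [hA, ofReal_integral_eq_lintegral_ofReal hai
        (.of_forall fun x => by positivity),
        ← (measurePreserving_planeChart c).setLIntegral_comp_preimage_emb
          (measurableEmbedding_planeChart c), planeChart_preimage_ball,
        ← lintegral_indicator measurableSet_ball]
      refine lintegral_congr fun z => ?_
      by_cases hz : z ∈ ball (0 : ℂ) r
      · rw [hf, Set.indicator_of_mem hz, Set.indicator_of_mem hz, ← norm_fderiv_comp_planeChart,
          ← ofReal_norm, ENNReal.ofReal_rpow_of_nonneg (norm_nonneg _) hp0.le]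
      · rw [hf, Set.indicator_of_notMem hz, Set.indicator_of_notMem hz,
          ENNReal.zero_rpow_of_pos hp0]
    have hA0 : 0 ≤ A := integral_nonneg fun x => by positivity
    rw [h1, one_div, ENNReal.ofReal_rpow_of_nonneg hA0 (by positivity)]
  have hmain := hLor p hp C₀ f g hfm hgm B hB'
  rw [lorentzNorm, if_neg ENNReal.ofReal_ne_top, ENNReal.toReal_ofReal hp0.le, one_div p]
  calc _ ≤ _ := by
        refine ENNReal.rpow_le_rpow (setLIntegral_mono' measurableSet_Ioi fun τ hτ => ?_)
          (inv_nonneg.2 hp0.le)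
        gcongr ?_ / _
        refine ENNReal.rpow_le_rpow (mul_le_mul_right (ENNReal.rpow_le_rpow ?_ (by norm_num)) _)
          hp0.le
        rw [volume_planeChart]
        refine measure_mono fun z hz => ?_
        refine lt_of_lt_of_le ?_ (hgrad z hz.1)
        rw [← ofReal_norm, ENNReal.ofReal_lt_ofReal_iff_of_nonneg (Set.mem_Ioi.1 hτ).le,
          norm_fderiv_comp_planeChart, ← abs_norm]
        exact hz.2
    _ ≤ C₁ * C₀ * (B * (∫⁻ z, f z ^ p) ^ p⁻¹) := hmain
    _ ≤ ENNReal.ofReal ((C₁ * C₀).toReal + 1) * (B * (∫⁻ z, f z ^ p) ^ p⁻¹) := by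
        gcongr
        refine (ENNReal.ofReal_toReal (ENNReal.mul_ne_top hC₁ hC₀)).symm.le.trans ?_
        exact ENNReal.ofReal_le_ofReal (by linarith)
    _ = _ := by
        rw [hA', one_div, ENNReal.ofReal_mul (by positivity), mul_comm B, mul_assoc]

end
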